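/- arXiv:2605.26780 — 4 statements merged into one kernel-verified Lean document; each statement's English description precedes it below -/
import Mathlib

section
/- Let real parameters (α, δ, μ, σ, η, λ, ξ, ζ) satisfy η ≥ 0, ξ ≥ 0, ζ ≥ 0, λ ≤ 0, 2α + 4πδ + μ − 4ζ ≥ 0, 2α + σ − 2η − 4ζ ≥ 0, and D := 6πα − πμ + 4πσ + 24πη + 4λ + 4ξ − 12πζ > 0. Then h₂(K, S(K))² := ∫₀^{2π} |p(θ) − p_S(θ)|² dθ ≤ (2π/(3D)) · W, where W = α∫₀^{2π}ρ(θ)²dθ + δL² + μA + σ|Ã| + η∫₀^{2π}ρ_β(θ)²dθ + λ(ρ_e − ρ_i)² + ξ(ρ_M − ρ_m)² + ζ∫₀^{2π}ρ(θ)⁻¹dθ. -/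
open MeasureTheory

noncomputable section


theorem aux_wirt (u u' : ℝ → ℝ) (hu : ∀ x, HasDerivAt u (u' x) x) (hu' : Continuous u')
   (a b : ℝ) (hab : a ≤ b) (hba : b - a ≤ Real.pi) (ha : u a = 0) (hb : u b = 0) :
   ∫ x in a..b, u x ^ 2 - u' x ^ 2 ≤ 0 := by
  have hc : Continuous u := continuous_iff_continuousAt.2 fun x => (hu x).continuousAt
  have key : ∀ k : ℝ, 0 < k → k < 1 → k ^ 2 * (∫ x in a..b, u x ^ 2) ≤ ∫ x in a..b, u' x ^ 2 := by
    intro k hk0 hk1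
    set m := (a + b) / 2 with hm
    have hcos : ∀ x ∈ Set.uIcc a b, 0 < Real.cos (k * (x - m)) := by
      intro x hx
      rw [Set.uIcc_of_le hab] at hx
      have hpi := Real.pi_pos
      apply Real.cos_pos_of_mem_Ioo
      have h1 : |x - m| ≤ Real.pi / 2 := by
        rw [abs_le]; constructor <;> linarith [hx.1, hx.2]
      have h2 : |k * (x - m)| < Real.pi / 2 := by
        rw [abs_mul, abs_of_pos hk0]
        nlinarith [abs_nonneg (x - m)]
      exact ⟨(abs_lt.1 h2).1, (abs_lt.1 h2).2⟩
    have hd : ∀ x ∈ Set.uIcc a b, HasDerivAt (fun x => u x ^ 2 * (k * Real.tan (k * (x - m))))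
        ((u' x + u x * (k * Real.tan (k * (x - m)))) ^ 2 - u' x ^ 2 + k ^ 2 * u x ^ 2) x := by
      intro x hx
      have hne := (hcos x hx).ne'
      have h1 : HasDerivAt (fun x => k * (x - m)) k x := by
        simpa using ((hasDerivAt_id x).sub_const m).const_mul k
      have h2 := ((Real.hasDerivAt_tan hne).comp x h1).const_mul k
      have h3 := ((hu x).pow 2).mul h2
      refine h3.congr_deriv ?_
      simp only [Function.comp, Pi.pow_apply]
      rw [Real.tan_eq_sin_div_cos]
      field_simp
      have := Real.sin_sq_add_cos_sq (k * (x - m))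
      push_cast
      linear_combination (-k^2*u x^2) * this
    have htan : ContinuousOn (fun x => Real.tan (k * (x - m))) (Set.uIcc a b) := by
      apply Real.continuousOn_tan.comp (by fun_prop)
      intro x hx
      exact (hcos x hx).ne'
    have hco : ContinuousOn (fun x => (u' x + u x * (k * Real.tan (k * (x - m)))) ^ 2) (Set.uIcc a b) := by
      fun_prop
    have hi1 : IntervalIntegrable (fun x => (u' x + u x * (k * Real.tan (k * (x - m)))) ^ 2) volume a b :=
      hco.intervalIntegrable
    have hi2 : IntervalIntegrable (fun x => u' x ^ 2) volume a b := (hu'.pow 2).intervalIntegrable _ _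
    have hi3 : IntervalIntegrable (fun x => k ^ 2 * u x ^ 2) volume a b :=
      (continuous_const.mul (hc.pow 2)).intervalIntegrable _ _
    have h := intervalIntegral.integral_eq_sub_of_hasDerivAt hd ((hi1.sub hi2).add hi3)
    rw [intervalIntegral.integral_add (hi1.sub hi2) hi3, intervalIntegral.integral_sub hi1 hi2,
      intervalIntegral.integral_const_mul, ha, hb] at h
    have hn : 0 ≤ ∫ x in a..b, (u' x + u x * (k * Real.tan (k * (x - m)))) ^ 2 :=
      intervalIntegral.integral_nonneg hab fun x _ => sq_nonneg _
    linarith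
  have hj1 : IntervalIntegrable (fun x => u x ^ 2) volume a b := (hc.pow 2).intervalIntegrable _ _
  have hj2 : IntervalIntegrable (fun x => u' x ^ 2) volume a b := (hu'.pow 2).intervalIntegrable _ _
  rw [intervalIntegral.integral_sub hj1 hj2]
  set X := ∫ x in a..b, u x ^ 2
  set Y := ∫ x in a..b, u' x ^ 2
  have ht : Filter.Tendsto (fun k : ℝ => k ^ 2 * X) (nhdsWithin 1 (Set.Iio 1)) (nhds (1 ^ 2 * X)) := by
    apply Filter.Tendsto.mono_left _ nhdsWithin_le_nhds
    exact Continuous.tendsto (by fun_prop) 1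
  have := le_of_tendsto ht (b := Y) (by
    filter_upwards [Ioo_mem_nhdsLT (show (0:ℝ) < 1 by norm_num)] with k hk
    exact key k hk.1 hk.2)
  linarith

theorem aux_gap (u u' : ℝ → ℝ) (hu : ∀ x, HasDerivAt u (u' x) x) (hu' : Continuous u')
    (hper : Function.Periodic u (2 * Real.pi)) (hper' : Function.Periodic u' (2 * Real.pi))
    (hz : ∀ φ : ℝ, ∃ θ, u θ = 0 ∧ Real.cos (θ - φ) ≤ 0) :
    ∫ x in (0:ℝ)..(2 * Real.pi), u x ^ 2 - u' x ^ 2 ≤ 0 := by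
  have hc : Continuous u := continuous_iff_continuousAt.2 fun x => (hu x).continuousAt
  have hpi := Real.pi_pos
  obtain ⟨z, hz0, -⟩ := hz 0
  have hz2 : u (z + 2 * Real.pi) = 0 := by rw [hper, hz0]
  have hcl : IsClosed {x | u x = 0} := isClosed_eq hc continuous_const
  obtain ⟨a, ⟨ha1, ha2⟩, haM⟩ := (isCompact_Icc.inter_right hcl).exists_isMaxOn
    (s := Set.Icc z (z + Real.pi) ∩ {x | u x = 0}) ⟨z, ⟨le_rfl, by linarith⟩, hz0⟩ continuousOn_id
  obtain ⟨b, ⟨hb1, hb2⟩, hbM⟩ := (isCompact_Icc.inter_right hcl).exists_isMinOn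
    (s := Set.Icc (z + Real.pi) (z + 2 * Real.pi) ∩ {x | u x = 0})
    ⟨z + 2 * Real.pi, ⟨by linarith, by linarith⟩, hz2⟩ continuousOn_id
  simp only [isMaxOn_iff, isMinOn_iff, id] at haM hbM
  have hba : b - a ≤ Real.pi := by
    by_contra hcon
    push Not at hcon
    obtain ⟨θ, hθ, hcosθ⟩ := hz ((a + b) / 2 - Real.pi)
    obtain ⟨n, hn, -⟩ := existsUnique_add_zsmul_mem_Ico (show (0:ℝ) < 2 * Real.pi by linarith) θ z
    simp only [zsmul_eq_mul] at hn
    have hut : u (θ + n * (2 * Real.pi)) = 0 := by rw [← hθ]; exact hper.int_mul n θ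
    have hct : Real.cos (θ + n * (2 * Real.pi) - ((a + b) / 2 - Real.pi)) ≤ 0 := by
      have : θ + n * (2 * Real.pi) - ((a + b) / 2 - Real.pi) = θ - ((a + b) / 2 - Real.pi) + n * (2 * Real.pi) := by ring
      rw [this, Real.cos_add_int_mul_two_pi]; exact hcosθ
    set t := θ + n * (2 * Real.pi)
    rcases le_total t (z + Real.pi) with h | h
    · have h1 := haM t ⟨⟨hn.1, h⟩, hut⟩
      have : 0 < Real.cos (t - ((a + b) / 2 - Real.pi)) := by
        apply Real.cos_pos_of_mem_Ioo
        constructor <;> linarith [hn.1, hb1.2]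
      linarith
    · have h1 := hbM t ⟨⟨h, hn.2.le⟩, hut⟩
      have : 0 < Real.cos (t - ((a + b) / 2 - Real.pi) - 2 * Real.pi) := by
        apply Real.cos_pos_of_mem_Ioo
        constructor <;> linarith [hn.2, ha1.1]
      rw [Real.cos_sub_two_pi] at this
      linarith
  have hi : ∀ x y, IntervalIntegrable (fun x => u x ^ 2 - u' x ^ 2) volume x y := fun x y =>
    ((hc.pow 2).sub (hu'.pow 2)).intervalIntegrable _ _
  have hp2 : Function.Periodic (fun x => u x ^ 2 - u' x ^ 2) (2 * Real.pi) := by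
    intro x; simp only [hper x, hper' x]
  have h0 := hp2.intervalIntegral_add_eq 0 z
  rw [zero_add] at h0
  rw [h0, ← intervalIntegral.integral_add_adjacent_intervals (hi z a) (hi a _),
    ← intervalIntegral.integral_add_adjacent_intervals (hi a b) (hi b _)]
  have e1 := aux_wirt u u' hu hu' z a ha1.1 (by linarith [ha1.2]) hz0 ha2
  have e2 := aux_wirt u u' hu hu' a b (by linarith [ha1.2, hb1.1]) hba ha2 hb2
  have e3 := aux_wirt u u' hu hu' b (z + 2 * Real.pi) hb1.2 (by linarith [hb1.1]) hb2 hz2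
  linarith

theorem aux_opt (p : ℝ → ℝ) (hp : Continuous p) (hper : Function.Periodic p (2 * Real.pi)) :
    ∃ x y R : ℝ, (∀ θ, p θ ≤ R + x * Real.cos θ + y * Real.sin θ) ∧
     ∀ φ : ℝ, ∃ θ, p θ - R - (x * Real.cos θ + y * Real.sin θ) = 0 ∧ Real.cos (θ - φ) ≤ 0 := by
  have hpi := Real.pi_pos
  have hred : ∀ g : ℝ → ℝ, Function.Periodic g (2 * Real.pi) → ∀ θ, ∃ t ∈ Set.Icc 0 (2 * Real.pi), g θ = g t := by
    intro g hg θ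
    obtain ⟨t, ht, h⟩ := hg.exists_mem_Ico₀ (by linarith) θ
    exact ⟨t, ⟨ht.1, ht.2.le⟩, h⟩
  have hne : (Set.Icc 0 (2 * Real.pi)).Nonempty := ⟨0, le_rfl, by linarith⟩
  obtain ⟨tm, -, hm⟩ := isCompact_Icc.exists_isMinOn hne hp.continuousOn
  obtain ⟨tM, -, hM⟩ := isCompact_Icc.exists_isMaxOn hne hp.continuousOn
  rw [isMinOn_iff] at hm
  rw [isMaxOn_iff] at hM
  have hm' : ∀ θ, p tm ≤ p θ := fun θ => by
    obtain ⟨t, ht, h⟩ := hred p hper θ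
    rw [h]; exact hm t ht
  have hM' : ∀ θ, p θ ≤ p tM := fun θ => by
    obtain ⟨t, ht, h⟩ := hred p hper θ
    rw [h]; exact hM t ht
  set m := p tm
  set M := p tM
  set S : Set (ℝ × ℝ × ℝ) := {q | ∀ θ, p θ ≤ q.2.2 + q.1 * Real.cos θ + q.2.1 * Real.sin θ} with hS
  have hScl : IsClosed S := by
    rw [hS, Set.ofPred_forall]
    exact isClosed_iInter fun θ => isClosed_le continuous_const (by fun_prop)
  set B : Set (ℝ × ℝ × ℝ) := Set.Icc (-(M - m)) (M - m) ×ˢ Set.Icc (-(M - m)) (M - m) ×ˢ Set.Icc m M with hB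
  have hBc : IsCompact B := isCompact_Icc.prod (isCompact_Icc.prod isCompact_Icc)
  have hSB : ∀ q ∈ S, q.2.2 ≤ M → q ∈ B := by
    intro q hq hqM
    have h0 := (hm' 0).trans (hq 0)
    have h1 := (hm' _).trans (hq Real.pi)
    have h2 := (hm' _).trans (hq (Real.pi / 2))
    have h3 := (hm' _).trans (hq (-(Real.pi / 2)))
    simp at h0 h1 h2 h3
    refine ⟨⟨?_, ?_⟩, ⟨?_, ?_⟩, ⟨?_, ?_⟩⟩ <;> linarith
  have h0S : ((0, 0, M) : ℝ × ℝ × ℝ) ∈ S := by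
    intro θ; simpa using hM' θ
  obtain ⟨q, ⟨hqB, hqS⟩, hqm⟩ := (hBc.inter_right hScl).exists_isMinOn (f := fun q => q.2.2)
    ⟨_, hSB _ h0S le_rfl, h0S⟩ (by fun_prop)
  rw [isMinOn_iff] at hqm
  have hmin : ∀ q' ∈ S, q.2.2 ≤ q'.2.2 := by
    intro q' hq'
    by_cases h : q'.2.2 ≤ M
    · exact hqm q' ⟨hSB q' hq' h, hq'⟩
    · push Not at h
      exact hqB.2.2.2.trans h.le
  refine ⟨q.1, q.2.1, q.2.2, hqS, ?_⟩
  intro φ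
  by_contra hcon
  push Not at hcon
  set g : ℝ → ℝ := fun θ => q.2.2 + q.1 * Real.cos θ + q.2.1 * Real.sin θ - p θ with hg
  have hgc : Continuous g := by fun_prop
  have hg0 : ∀ θ, 0 ≤ g θ := fun θ => sub_nonneg.2 (hqS θ)
  have hex : ∃ ε > 0, ∀ θ ∈ Set.Icc 0 (2 * Real.pi), 0 < g θ + ε * Real.cos (θ - φ) := by
    set C := Set.Icc 0 (2 * Real.pi) ∩ {θ | Real.cos (θ - φ) ≤ 0} with hC
    have hCc : IsCompact C := isCompact_Icc.inter_right (isClosed_le (by fun_prop) continuous_const)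
    rcases C.eq_empty_or_nonempty with h | h
    · refine ⟨1, one_pos, fun θ hθ => ?_⟩
      have : ¬ Real.cos (θ - φ) ≤ 0 := fun h' => by
        have : θ ∈ C := ⟨hθ, h'⟩
        rw [h] at this; exact this
      push Not at this
      linarith [hg0 θ]
    · obtain ⟨c, hc, hcm⟩ := hCc.exists_isMinOn h hgc.continuousOn
      rw [isMinOn_iff] at hcm
      have hgp : 0 < g c := by
        rcases (hg0 c).lt_or_eq with h | h
        · exact h
        · exfalso
          have := hcon c (by simp only [hg] at h; linarith)
          exact absurd hc.2 (not_le.2 this)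
      refine ⟨g c / 2, by linarith, fun θ hθ => ?_⟩
      by_cases h' : Real.cos (θ - φ) ≤ 0
      · have := hcm θ ⟨hθ, h'⟩
        nlinarith [Real.neg_one_le_cos (θ - φ)]
      · push Not at h'
        have := hg0 θ
        positivity
  obtain ⟨ε, hε, hpos⟩ := hex
  obtain ⟨t, ht, htm⟩ := isCompact_Icc.exists_isMinOn hne
    (f := fun θ => g θ + ε * Real.cos (θ - φ)) (by fun_prop)
  rw [isMinOn_iff] at htm
  have hgper : Function.Periodic (fun θ => g θ + ε * Real.cos (θ - φ)) (2 * Real.pi) := by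
    intro x
    have : x + 2 * Real.pi - φ = (x - φ) + 2 * Real.pi := by ring
    simp only [hg, hper x, Real.cos_add_two_pi, Real.sin_add_two_pi, this]
  have hall : ∀ θ, g t + ε * Real.cos (t - φ) ≤ g θ + ε * Real.cos (θ - φ) := by
    intro θ
    obtain ⟨s, hs, h⟩ := hred _ hgper θ
    have h' := htm s hs
    linarith
  have := hmin (q.1 + ε * Real.cos φ, q.2.1 + ε * Real.sin φ, q.2.2 - (g t + ε * Real.cos (t - φ))) (by
    intro θ
    have := hall θ
    rw [Real.cos_sub θ φ] at this
    simp only [hg] at this ⊢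
    nlinarith [this])
  have h2 := hpos t ht
  simp only at this
  linarith

theorem aux_bonn (p p1 : ℝ → ℝ) (hp : ∀ x, HasDerivAt p (p1 x) x) (hp1 : Continuous p1)
    (hper : Function.Periodic p (2 * Real.pi)) (hper1 : Function.Periodic p1 (2 * Real.pi)) :
    ∃ x y R : ℝ, (∀ θ, p θ ≤ R + x * Real.cos θ + y * Real.sin θ) ∧
      (∫ θ in (0:ℝ)..(2 * Real.pi), p θ ^ 2) - (∫ θ in (0:ℝ)..(2 * Real.pi), p1 θ ^ 2)
        - 2 * R * (∫ θ in (0:ℝ)..(2 * Real.pi), p θ) + 2 * Real.pi * R ^ 2 ≤ 0 := by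
  have hc : Continuous p := continuous_iff_continuousAt.2 fun x => (hp x).continuousAt
  obtain ⟨x, y, R, h1, h2⟩ := aux_opt p hc hper
  refine ⟨x, y, R, h1, ?_⟩
  have hl : ∀ θ, HasDerivAt (fun θ => x * Real.cos θ + y * Real.sin θ) (-x * Real.sin θ + y * Real.cos θ) θ := by
    intro θ
    exact (((Real.hasDerivAt_cos θ).const_mul x).add ((Real.hasDerivAt_sin θ).const_mul y)).congr_deriv (by ring)
  have hl' : ∀ θ, HasDerivAt (fun θ => -x * Real.sin θ + y * Real.cos θ) (-(x * Real.cos θ + y * Real.sin θ)) θ := by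
    intro θ
    exact (((Real.hasDerivAt_sin θ).const_mul (-x)).add ((Real.hasDerivAt_cos θ).const_mul y)).congr_deriv (by ring)
  have key := aux_gap (fun θ => p θ - R - (x * Real.cos θ + y * Real.sin θ))
    (fun θ => p1 θ - (-x * Real.sin θ + y * Real.cos θ))
    (fun θ => ((hp θ).sub_const R).sub (hl θ)) (by fun_prop)
    (fun θ => by simp only [hper θ, Real.cos_add_two_pi, Real.sin_add_two_pi])
    (fun θ => by simp only [hper1 θ, Real.cos_add_two_pi, Real.sin_add_two_pi]) h2
  set l := fun θ => x * Real.cos θ + y * Real.sin θ with hldef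
  set l' := fun θ => -x * Real.sin θ + y * Real.cos θ with hldef'
  have hlc : Continuous l := by fun_prop
  have hlc' : Continuous l' := by fun_prop
  have hd : ∀ θ, HasDerivAt (fun θ => 2 * (p θ * l' θ) - l θ * l' θ - 2 * R * l' θ)
      (2 * (p1 θ * l' θ + p θ * (- l θ)) - (l' θ * l' θ + l θ * (- l θ)) - 2 * R * (- l θ)) θ := fun θ =>
    ((((hp θ).mul (hl' θ)).const_mul 2).sub ((hl θ).mul (hl' θ))).sub ((hl' θ).const_mul (2 * R))
  have hint := intervalIntegral.integral_eq_sub_of_hasDerivAt (a := 0) (b := 2 * Real.pi) (fun θ _ => hd θ)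
    (Continuous.intervalIntegrable (by fun_prop) _ _)
  have e0 : p (2 * Real.pi) = p 0 := by simpa using hper 0
  have e1 : l (2 * Real.pi) = l 0 := by simp [hldef]
  have e2 : l' (2 * Real.pi) = l' 0 := by simp [hldef']
  rw [e0, e1, e2, sub_self] at hint
  have i1 : IntervalIntegrable (fun x => p x ^ 2) volume 0 (2 * Real.pi) := (hc.pow 2).intervalIntegrable _ _
  have i2 : IntervalIntegrable (fun x => p1 x ^ 2) volume 0 (2 * Real.pi) := (hp1.pow 2).intervalIntegrable _ _
  have i3 : IntervalIntegrable (fun x => 2 * R * p x) volume 0 (2 * Real.pi) := (continuous_const.mul hc).intervalIntegrable _ _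
  have i4 : IntervalIntegrable (fun x => R ^ 2) volume 0 (2 * Real.pi) := continuous_const.intervalIntegrable _ _
  have e : ∀ θ, (p θ - R - l θ) ^ 2 - (p1 θ - l' θ) ^ 2 = (p θ ^ 2 - p1 θ ^ 2 - 2 * R * p θ + R ^ 2)
      + (2 * (p1 θ * l' θ + p θ * (- l θ)) - (l' θ * l' θ + l θ * (- l θ)) - 2 * R * (- l θ)) := fun θ => by ring
  have key' : ∫ θ in (0:ℝ)..(2 * Real.pi), (p θ - R - l θ) ^ 2 - (p1 θ - l' θ) ^ 2 ≤ 0 := key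
  simp_rw [e] at key'
  rw [intervalIntegral.integral_add (((i1.sub i2).sub i3).add i4) (Continuous.intervalIntegrable (by fun_prop) _ _), hint,
    intervalIntegral.integral_add ((i1.sub i2).sub i3) i4, intervalIntegral.integral_sub (i1.sub i2) i3,
    intervalIntegral.integral_sub i1 i2, intervalIntegral.integral_const_mul, intervalIntegral.integral_const] at key'
  simp only [smul_eq_mul] at key'
  linarith

theorem aux_2pi : (0:ℝ) < 2 * Real.pi := by positivity

def auxC (f : ℝ → ℝ) (n : ℤ) : ℂ := fourierCoeffOn aux_2pi (fun x => (f x : ℂ)) n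

theorem auxC_int (f : ℝ → ℝ) (n : ℤ) : auxC f n = ((1 / (2 * Real.pi) : ℝ) : ℂ) *
    ∫ x in (0:ℝ)..(2 * Real.pi), (f x : ℂ) * Complex.exp (-(n * x : ℝ) * Complex.I) := by
  rw [auxC, fourierCoeffOn_eq_integral]
  rw [Complex.real_smul, sub_zero]
  congr 1
  apply intervalIntegral.integral_congr
  intro x _
  simp only [smul_eq_mul]
  rw [fourier_coe_apply, mul_comm]
  congr 2
  have : (Real.pi : ℂ) ≠ 0 := by exact_mod_cast Real.pi_ne_zero
  push_cast
  field_simp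

theorem aux_pars (f : ℝ → ℝ) (hf : Continuous f) :
    HasSum (fun n : ℤ => 2 * Real.pi * ‖auxC f n‖ ^ 2) (∫ x in (0:ℝ)..(2 * Real.pi), f x ^ 2) := by
  have hm : MemLp (fun x => (f x : ℂ)) 2 (volume.restrict (Set.Ioc 0 (2 * Real.pi))) := by
    have hc : Continuous (fun x => (f x : ℂ)) := by fun_prop
    obtain ⟨C, hC⟩ := (isCompact_Icc (a := (0:ℝ)) (b := 2 * Real.pi)).exists_bound_of_continuousOn hc.continuousOn
    apply MemLp.of_bound hc.aestronglyMeasurable C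
    filter_upwards [ae_restrict_mem measurableSet_Ioc] with x hx
    exact hC x ⟨hx.1.le, hx.2⟩
  have h := (hasSum_sq_fourierCoeffOn aux_2pi hm).mul_left (2 * Real.pi)
  have hpi := Real.pi_ne_zero
  have e : 2 * Real.pi * ((2 * Real.pi - 0)⁻¹ • ∫ x in (0:ℝ)..(2 * Real.pi), ‖(f x : ℂ)‖ ^ 2) =
      ∫ x in (0:ℝ)..(2 * Real.pi), f x ^ 2 := by
    simp only [Complex.norm_real, Real.norm_eq_abs, sq_abs, smul_eq_mul, sub_zero]
    field_simp
  rw [e] at h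
  exact h

theorem aux_der (f f' : ℝ → ℝ) (hf : ∀ x, HasDerivAt f (f' x) x) (hf' : Continuous f')
    (hper : Function.Periodic f (2 * Real.pi)) (n : ℤ) : ‖auxC f' n‖ ^ 2 = (n:ℝ) ^ 2 * ‖auxC f n‖ ^ 2 := by
  have e0 : f (2 * Real.pi) = f 0 := by simpa using hper 0
  have hpi := Real.pi_ne_zero
  have hpi' : (Real.pi : ℂ) ≠ 0 := by exact_mod_cast Real.pi_ne_zero
  rcases eq_or_ne n 0 with rfl | hn
  · have : auxC f' 0 = 0 := by
      rw [auxC_int]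
      have h := intervalIntegral.integral_eq_sub_of_hasDerivAt (a := 0) (b := 2 * Real.pi) (fun x _ => hf x)
        (hf'.intervalIntegrable _ _)
      simp only [Int.cast_zero, zero_mul, Complex.ofReal_zero, neg_zero, Complex.exp_zero, mul_one]
      rw [intervalIntegral.integral_ofReal, h, e0]; simp
    simp [this]
  · have h := fourierCoeffOn_of_hasDerivAt aux_2pi (f := fun x => (f x : ℂ)) (f' := fun x => (f' x : ℂ)) hn
      (fun x _ => (hf x).ofReal_comp) (Continuous.intervalIntegrable (by fun_prop) _ _)
    have hn' : (n : ℂ) ≠ 0 := by exact_mod_cast hn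
    have h2 : auxC f' n = Complex.I * n * auxC f n := by
      unfold auxC
      rw [h, e0]
      push_cast
      field_simp
      simp
      ring
    rw [h2]
    simp [mul_pow]

theorem aux_c0 (f : ℝ → ℝ) : 2 * Real.pi * ‖auxC f 0‖ ^ 2 =
    (∫ x in (0:ℝ)..(2 * Real.pi), f x) ^ 2 / (2 * Real.pi) := by
  have hpi := Real.pi_pos
  rw [auxC_int]
  simp only [Int.cast_zero, zero_mul, Complex.ofReal_zero, neg_zero, Complex.exp_zero, mul_one]
  rw [intervalIntegral.integral_ofReal, ← Complex.ofReal_mul, Complex.norm_real, Real.norm_eq_abs, sq_abs]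
  field_simp

theorem aux_c1 (f : ℝ → ℝ) (hf : Continuous f) (n : ℤ) (hn : n = 1 ∨ n = -1) : 2 * Real.pi * ‖auxC f n‖ ^ 2 =
    ((∫ x in (0:ℝ)..(2 * Real.pi), f x * Real.cos x) ^ 2 + 
     (∫ x in (0:ℝ)..(2 * Real.pi), f x * Real.sin x) ^ 2) / (2 * Real.pi) := by
  have hpi := Real.pi_pos
  have key : ∫ x in (0:ℝ)..(2 * Real.pi), (f x : ℂ) * Complex.exp (-(n * x : ℝ) * Complex.I) = 
    ((∫ x in (0:ℝ)..(2 * Real.pi), f x * Real.cos x : ℝ) : ℂ) + 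
     ((- n * ∫ x in (0:ℝ)..(2 * Real.pi), f x * Real.sin x : ℝ) : ℂ) * Complex.I := by
    rw [Complex.ofReal_mul, ← intervalIntegral.integral_ofReal, ← intervalIntegral.integral_ofReal, 
      ← intervalIntegral.integral_const_mul, ← intervalIntegral.integral_mul_const,
      ← intervalIntegral.integral_add (Continuous.intervalIntegrable (by fun_prop) _ _) (Continuous.intervalIntegrable (by fun_prop) _ _)]
    apply intervalIntegral.integral_congr
    intro x _
    simp only
    rw [Complex.exp_mul_I]
    rcases hn with rfl | rfl
    · simp; ring
    · simp; ring
  rw [auxC_int, key, norm_mul, mul_pow, ← Complex.normSq_eq_norm_sq (_ + _), Complex.normSq_add_mul_I,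
    Complex.norm_real, Real.norm_eq_abs, sq_abs]
  have : (n:ℝ)^2 = 1 := by rcases hn with rfl | rfl <;> simp
  rw [mul_pow (-(n:ℝ)), neg_sq, this]
  field_simp

theorem aux_wirts (p p1 p2 p3 : ℝ → ℝ) (h0 : ∀ x, HasDerivAt p (p1 x) x) (h1 : ∀ x, HasDerivAt p1 (p2 x) x)
    (h2 : ∀ x, HasDerivAt p2 (p3 x) x) (c0 : Continuous p) (c1 : Continuous p1) (c2 : Continuous p2) (c3 : Continuous p3)
    (q0 : Function.Periodic p (2 * Real.pi)) (q1 : Function.Periodic p1 (2 * Real.pi))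
    (q2 : Function.Periodic p2 (2 * Real.pi)) (J0 J1 J2 J3 T X Y : ℝ)
    (hJ0 : J0 = ∫ x in (0:ℝ)..(2 * Real.pi), p x ^ 2) (hJ1 : J1 = ∫ x in (0:ℝ)..(2 * Real.pi), p1 x ^ 2)
    (hJ2 : J2 = ∫ x in (0:ℝ)..(2 * Real.pi), p2 x ^ 2) (hJ3 : J3 = ∫ x in (0:ℝ)..(2 * Real.pi), p3 x ^ 2)
    (hT : T = (∫ x in (0:ℝ)..(2 * Real.pi), p x) ^ 2 / (2 * Real.pi))
    (hX : X = ∫ x in (0:ℝ)..(2 * Real.pi), p x * Real.cos x)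
    (hY : Y = ∫ x in (0:ℝ)..(2 * Real.pi), p x * Real.sin x) :
    J1 ≤ J2 ∧ 0 ≤ J2 - 5 * J1 + 4 * J0 - 4 * T ∧ 0 ≤ J3 - J2 - 16 * J1 + 16 * J0 - 16 * T ∧
    - 4 * T - 6 * ((X ^ 2 + Y ^ 2) / (2 * Real.pi)) ≤ J1 - 4 * J0 := by
  have hpi := Real.pi_pos
  set a : ℤ → ℝ := fun n => 2 * Real.pi * ‖auxC p n‖ ^ 2 with ha
  have ha0 : ∀ n, 0 ≤ a n := fun n => by positivity
  have s0 : HasSum a J0 := by rw [hJ0]; exact aux_pars p c0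
  have s1 : HasSum (fun n : ℤ => (n:ℝ) ^ 2 * a n) J1 := by
    rw [hJ1]; convert aux_pars p1 c1 using 2 with n
    rw [aux_der p p1 h0 c1 q0]; ring
  have s2 : HasSum (fun n : ℤ => (n:ℝ) ^ 4 * a n) J2 := by
    rw [hJ2]; convert aux_pars p2 c2 using 2 with n
    rw [aux_der p1 p2 h1 c2 q1, aux_der p p1 h0 c1 q0]; ring
  have s3 : HasSum (fun n : ℤ => (n:ℝ) ^ 6 * a n) J3 := by
    rw [hJ3]; convert aux_pars p3 c3 using 2 with n
    rw [aux_der p2 p3 h2 c3 q2, aux_der p1 p2 h1 c2 q1, aux_der p p1 h0 c1 q0]; ring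
  have a0 : a 0 = T := by rw [hT]; exact aux_c0 p
  have a1 : a 1 = (X ^ 2 + Y ^ 2) / (2 * Real.pi) := by rw [hX, hY]; exact aux_c1 p c0 1 (Or.inl rfl)
  have a1' : a (-1) = (X ^ 2 + Y ^ 2) / (2 * Real.pi) := by rw [hX, hY]; exact aux_c1 p c0 (-1) (Or.inr rfl)
  have hn1 : ∀ n : ℤ, n ≠ 0 → (1:ℝ) ≤ (n:ℝ) ^ 2 := fun n hn => by
    have : 1 ≤ n ^ 2 := by have := sq_pos_of_ne_zero hn (R := ℤ); lia
    exact_mod_cast this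
  have hn4 : ∀ n : ℤ, n ≠ 0 → n ≠ 1 → n ≠ -1 → (4:ℝ) ≤ (n:ℝ) ^ 2 := fun n hn hn1 hn2 => by
    have : 4 ≤ n ^ 2 := by
      rcases lt_or_gt_of_ne hn with h | h
      · have : n ≤ -2 := by omega
        nlinarith
      · have : 2 ≤ n := by omega
        nlinarith
    exact_mod_cast this
  refine ⟨?_, ?_, ?_, ?_⟩
  · apply hasSum_le _ s1 s2
    intro n
    apply mul_le_mul_of_nonneg_right _ (ha0 n)
    rcases eq_or_ne n 0 with rfl | hn
    · simp
    · nlinarith [hn1 n hn]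
  · have s := ((s2.sub (s1.mul_left 5)).add (s0.mul_left 4))
    have := sum_le_hasSum {0} (fun n hn => ?_) s
    · simp [a0] at this
      linarith
    · simp only [Finset.mem_singleton] at hn
      have : (n:ℝ) ^ 4 * a n - 5 * ((n:ℝ) ^ 2 * a n) + 4 * a n = (((n:ℝ)^2 - 1) * ((n:ℝ)^2 - 4)) * a n := by ring
      rw [this]
      apply mul_nonneg _ (ha0 n)
      by_cases h : n = 1 ∨ n = -1
      · rcases h with rfl | rfl <;> norm_num
      · push Not at h
        exact mul_nonneg (by linarith [hn1 n hn]) (by linarith [hn4 n hn h.1 h.2])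
  · have s := ((s3.sub s2).sub (s1.mul_left 16)).add (s0.mul_left 16)
    have := sum_le_hasSum {0} (fun n hn => ?_) s
    · simp [a0] at this
      linarith
    · simp only [Finset.mem_singleton] at hn
      have : (n:ℝ) ^ 6 * a n - (n:ℝ) ^ 4 * a n - 16 * ((n:ℝ) ^ 2 * a n) + 16 * a n =
         (((n:ℝ)^2 - 1) * ((n:ℝ)^2 - 4) * ((n:ℝ)^2 + 4)) * a n := by ring
      rw [this]
      apply mul_nonneg _ (ha0 n)
      apply mul_nonneg _ (by positivity)
      by_cases h : n = 1 ∨ n = -1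
      · rcases h with rfl | rfl <;> norm_num
      · push Not at h
        exact mul_nonneg (by linarith [hn1 n hn]) (by linarith [hn4 n hn h.1 h.2])
  · have s := s1.sub (s0.mul_left 4)
    have := sum_le_hasSum {0, 1, -1} (fun n hn => ?_) s
    · rw [Finset.sum_insert (by decide), Finset.sum_insert (by decide), Finset.sum_singleton, a0, a1, a1'] at this
      push_cast at this
      linarith
    · simp only [Finset.mem_singleton, Finset.mem_insert, not_or] at hn
      have := hn4 n hn.1 hn.2.1 hn.2.2
      nlinarith [ha0 n]

theorem aux_geo (p p1 p2 : ℝ → ℝ) (h0 : ∀ x, HasDerivAt p (p1 x) x) (h1 : ∀ x, HasDerivAt p1 (p2 x) x)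
    (q0 : Function.Periodic p (2 * Real.pi)) (hpos : ∀ x, 0 < p x + p2 x)
    (K : Set (EuclideanSpace ℝ (Fin 2)))
    (hK : K = {x | ∀ θ : ℝ, x 0 * Real.cos θ + x 1 * Real.sin θ ≤ p θ})
    (ρe ρi : ℝ)
    (hρe : ρe = sInf {r : ℝ | 0 ≤ r ∧ ∃ c, K ⊆ Metric.closedBall c r})
    (hρi : ρi = sSup {r : ℝ | 0 ≤ r ∧ ∃ c, Metric.closedBall c r ⊆ K})
    (x y R x' y' r : ℝ) (hR : ∀ θ, p θ ≤ R + x * Real.cos θ + y * Real.sin θ)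
    (hr : ∀ θ, r + x' * Real.cos θ + y' * Real.sin θ ≤ p θ) :
    0 ≤ ρe - ρi ∧ ρe - ρi ≤ R - r := by
  have hpi := Real.pi_pos
  -- the boundary point at angle 0 lies in K
  have hγ : (!₂[p 0, p1 0] : EuclideanSpace ℝ (Fin 2)) ∈ K := by
    rw [hK]
    intro θ
    simp only [Matrix.cons_val_zero, Matrix.cons_val_one]
    have hd : ∀ φ s, HasDerivAt (fun s => p s * Real.cos (φ - s) + p1 s * Real.sin (φ - s))
        ((p s + p2 s) * Real.sin (φ - s)) s := by
      intro φ s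
      have e : HasDerivAt (fun s => φ - s) (-1) s := by
        simpa using (hasDerivAt_id s).const_sub φ
      have ec : HasDerivAt (fun s => Real.cos (φ - s)) (Real.sin (φ - s)) s :=
        ((Real.hasDerivAt_cos (φ - s)).comp s e).congr_deriv (by ring)
      have es : HasDerivAt (fun s => Real.sin (φ - s)) (-Real.cos (φ - s)) s :=
        ((Real.hasDerivAt_sin (φ - s)).comp s e).congr_deriv (by ring)
      exact (((h0 s).mul ec).add ((h1 s).mul es)).congr_deriv (by ring)
    have main : ∀ φ, -Real.pi ≤ φ → φ ≤ Real.pi → p 0 * Real.cos φ + p1 0 * Real.sin φ ≤ p φ := by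
      intro φ hφ1 hφ2
      set F := fun s => p s * Real.cos (φ - s) + p1 s * Real.sin (φ - s) with hF
      have hF0 : F 0 = p 0 * Real.cos φ + p1 0 * Real.sin φ := by simp [hF]
      have hFφ : F φ = p φ := by simp [hF]
      rw [← hF0, ← hFφ]
      have hFc : Continuous F := continuous_iff_continuousAt.2 fun s => (hd φ s).continuousAt
      rcases le_total 0 φ with h | h
      · apply monotoneOn_of_deriv_nonneg (convex_Icc 0 φ) hFc.continuousOn
          (fun s _ => (hd φ s).differentiableAt.differentiableWithinAt) _ ⟨le_rfl, h⟩ ⟨h, le_rfl⟩ h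
        intro s hs
        rw [interior_Icc] at hs
        rw [(hd φ s).deriv]
        exact mul_nonneg (hpos s).le (Real.sin_nonneg_of_nonneg_of_le_pi (by linarith [hs.2]) (by linarith [hs.1]))
      · apply antitoneOn_of_deriv_nonpos (convex_Icc φ 0) hFc.continuousOn
          (fun s _ => (hd φ s).differentiableAt.differentiableWithinAt) _ ⟨le_rfl, h⟩ ⟨h, le_rfl⟩ h
        intro s hs
        rw [interior_Icc] at hs
        rw [(hd φ s).deriv]
        exact mul_nonpos_of_nonneg_of_nonpos (hpos s).le
          (Real.sin_nonpos_of_nonpos_of_neg_pi_le (by linarith [hs.1]) (by linarith [hs.2]))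
    obtain ⟨n, hn, -⟩ := existsUnique_add_zsmul_mem_Ico (show (0:ℝ) < 2 * Real.pi by linarith) θ (-Real.pi)
    simp only [zsmul_eq_mul] at hn
    have := main _ hn.1 (by linarith [hn.2])
    rw [Real.cos_add_int_mul_two_pi, Real.sin_add_int_mul_two_pi] at this
    have h2 : p (θ + n * (2 * Real.pi)) = p θ := q0.int_mul n θ
    rw [h2] at this
    exact this
  have hpol : ∀ v : EuclideanSpace ℝ (Fin 2), ∃ θ, v 0 = ‖v‖ * Real.cos θ ∧ v 1 = ‖v‖ * Real.sin θ := by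
    intro v
    refine ⟨Complex.arg ⟨v 0, v 1⟩, ?_⟩
    have hn : ‖v‖ = ‖(⟨v 0, v 1⟩ : ℂ)‖ := by
      rw [EuclideanSpace.norm_eq, Fin.sum_univ_two, Complex.norm_eq_sqrt_sq_add_sq]
      simp
    rw [hn, Complex.norm_mul_cos_arg, Complex.norm_mul_sin_arg]
    exact ⟨rfl, rfl⟩
  have hcs : ∀ (v : EuclideanSpace ℝ (Fin 2)) θ, v 0 * Real.cos θ + v 1 * Real.sin θ ≤ ‖v‖ := by
    intro v θ
    obtain ⟨t, ht0, ht1⟩ := hpol v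
    rw [ht0, ht1]
    have : ‖v‖ * Real.cos t * Real.cos θ + ‖v‖ * Real.sin t * Real.sin θ = ‖v‖ * Real.cos (t - θ) := by
      rw [Real.cos_sub]; ring
    rw [this]
    exact mul_le_of_le_one_right (norm_nonneg _) (Real.cos_le_one _)
  have hKR : K ⊆ Metric.closedBall !₂[x, y] R := by
    intro z hz
    rw [hK] at hz
    rw [mem_closedBall_iff_norm]
    obtain ⟨t, ht0, ht1⟩ := hpol (z - !₂[x, y])
    have h3 := (hz t).trans (hR t)
    simp at ht0 ht1
    have e := Real.sin_sq_add_cos_sq t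
    set N := ‖z - !₂[x, y]‖
    have e2 : z 0 = x + N * Real.cos t := by linarith
    have e3 : z 1 = y + N * Real.sin t := by linarith
    rw [e2, e3] at h3
    have h5 : N * (Real.sin t ^ 2 + Real.cos t ^ 2) ≤ R := by linear_combination h3
    rw [e, mul_one] at h5
    exact h5
  have hballK : ∀ a b s : ℝ, (∀ θ, s + a * Real.cos θ + b * Real.sin θ ≤ p θ) →
      Metric.closedBall !₂[a, b] s ⊆ K := by
    intro a b s hs z hz
    rw [mem_closedBall_iff_norm] at hz
    rw [hK]
    intro θ
    have h3 := (hcs (z - !₂[a, b]) θ).trans hz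
    simp at h3
    linarith [hs θ]
  have hR0 : 0 ≤ R := by
    have := hKR hγ
    rw [mem_closedBall_iff_norm] at this
    exact (norm_nonneg _).trans this
  have hle : ∀ s ∈ {r : ℝ | 0 ≤ r ∧ ∃ c, Metric.closedBall c r ⊆ K},
      ∀ S ∈ {r : ℝ | 0 ≤ r ∧ ∃ c, K ⊆ Metric.closedBall c r}, s ≤ S := by
    rintro s ⟨hs, c, hc⟩ S ⟨hS, d, hd⟩
    have hcd := hc.trans hd
    have m1 : c + !₂[s, 0] ∈ Metric.closedBall c s := by
      rw [mem_closedBall_iff_norm]; simp [EuclideanSpace.norm_eq, Real.sqrt_sq hs]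
    have m2 : c - !₂[s, 0] ∈ Metric.closedBall c s := by
      rw [mem_closedBall_iff_norm]; simp [EuclideanSpace.norm_eq, Real.sqrt_sq hs]
    have n1 := hcd m1
    have n2 := hcd m2
    rw [mem_closedBall_iff_norm] at n1 n2
    have k1 := (hcs _ 0).trans n1
    have k2 := (hcs _ Real.pi).trans n2
    simp at k1 k2
    linarith
  have hSe : R ∈ {r : ℝ | 0 ≤ r ∧ ∃ c, K ⊆ Metric.closedBall c r} := ⟨hR0, _, hKR⟩
  have h0i : (0:ℝ) ∈ {r : ℝ | 0 ≤ r ∧ ∃ c, Metric.closedBall c r ⊆ K} := by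
    refine ⟨le_rfl, !₂[p 0, p1 0], ?_⟩
    · rw [Metric.closedBall_zero]; exact Set.singleton_subset_iff.2 hγ
  have hbdd : BddAbove {r : ℝ | 0 ≤ r ∧ ∃ c, Metric.closedBall c r ⊆ K} := ⟨R, fun s hs => hle s hs R hSe⟩
  have hbdd' : BddBelow {r : ℝ | 0 ≤ r ∧ ∃ c, K ⊆ Metric.closedBall c r} := ⟨0, fun s hs => hs.1⟩
  have e1 : ρe ≤ R := by rw [hρe]; exact csInf_le hbdd' hSe
  have e2 : r ≤ ρi := by
    rw [hρi]
    rcases le_total 0 r with h | h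
    · exact le_csSup hbdd ⟨h, _, hballK _ _ _ hr⟩
    · exact h.trans (le_csSup hbdd h0i)
  have e3 : ρi ≤ ρe := by
    rw [hρi, hρe]
    exact csSup_le ⟨0, h0i⟩ fun s hs => le_csInf ⟨R, hSe⟩ fun S hS => hle s hs S hS
  constructor <;> linarith

theorem aux_popov (f : ℝ → ℝ) (hf : Continuous f) (M m : ℝ)
    (hM : M = sSup (f '' Set.Icc (0:ℝ) (2 * Real.pi))) (hm : m = sInf (f '' Set.Icc (0:ℝ) (2 * Real.pi))) :
    2 / Real.pi * ((∫ x in (0:ℝ)..(2 * Real.pi), f x ^ 2) - (∫ x in (0:ℝ)..(2 * Real.pi), f x) ^ 2 / (2 * Real.pi))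
      ≤ (M - m) ^ 2 := by
  have hpi := Real.pi_pos
  have hcomp : IsCompact (f '' Set.Icc (0:ℝ) (2 * Real.pi)) := isCompact_Icc.image hf
  have h1 : ∀ x ∈ Set.Icc (0:ℝ) (2 * Real.pi), f x ≤ M := fun x hx => by
    rw [hM]; exact le_csSup hcomp.bddAbove ⟨x, hx, rfl⟩
  have h2 : ∀ x ∈ Set.Icc (0:ℝ) (2 * Real.pi), m ≤ f x := fun x hx => by
    rw [hm]; exact csInf_le hcomp.bddBelow ⟨x, hx, rfl⟩
  have h3 : 0 ≤ ∫ x in (0:ℝ)..(2 * Real.pi), (M - f x) * (f x - m) :=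
    intervalIntegral.integral_nonneg (by linarith) fun x hx =>
      mul_nonneg (by linarith [h1 x hx]) (by linarith [h2 x hx])
  have e : ∀ x, (M - f x) * (f x - m) = (M + m) * f x - f x ^ 2 - M * m := fun x => by ring
  simp_rw [e] at h3
  rw [intervalIntegral.integral_sub (Continuous.intervalIntegrable (by fun_prop) _ _) (Continuous.intervalIntegrable (by fun_prop) _ _),
    intervalIntegral.integral_sub (Continuous.intervalIntegrable (by fun_prop) _ _) (Continuous.intervalIntegrable (by fun_prop) _ _),
    intervalIntegral.integral_const_mul, intervalIntegral.integral_const] at h3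
  simp only [smul_eq_mul, sub_zero] at h3
  set P := ∫ x in (0:ℝ)..(2 * Real.pi), f x ^ 2
  set Q := ∫ x in (0:ℝ)..(2 * Real.pi), f x
  set q := Q / (2 * Real.pi) with hq
  have hQ : Q = 2 * Real.pi * q := by rw [hq]; field_simp
  have e2 : 2 / Real.pi * (P - Q ^ 2 / (2 * Real.pi)) = 2 / Real.pi * P - 4 * q ^ 2 := by
    rw [hQ]; field_simp; ring
  have e3 : 2 / Real.pi * P ≤ 4 * ((M + m) * q - M * m) := by
    rw [hQ] at h3
    rw [div_mul_eq_mul_div, div_le_iff₀ hpi]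
    linarith
  rw [e2]
  nlinarith [sq_nonneg (M + m - 2 * q)]

theorem aux_h2 (p : ℝ → ℝ) (hp : Continuous p) (L cx cy X Y : ℝ)
    (hL : L = ∫ x in (0:ℝ)..(2 * Real.pi), p x)
    (hX : X = ∫ x in (0:ℝ)..(2 * Real.pi), p x * Real.cos x)
    (hY : Y = ∫ x in (0:ℝ)..(2 * Real.pi), p x * Real.sin x)
    (hcx : cx = (1 / Real.pi) * X) (hcy : cy = (1 / Real.pi) * Y) :
    (∫ θ in (0:ℝ)..(2 * Real.pi), |p θ - (L / (2 * Real.pi) + cx * Real.cos θ + cy * Real.sin θ)| ^ 2) =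
     (∫ x in (0:ℝ)..(2 * Real.pi), p x ^ 2) - L ^ 2 / (2 * Real.pi) - 2 * ((X ^ 2 + Y ^ 2) / (2 * Real.pi)) := by
  have hpi := Real.pi_pos
  set q := L / (2 * Real.pi) with hq
  have e : ∀ θ, |p θ - (q + cx * Real.cos θ + cy * Real.sin θ)| ^ 2 =
      p θ ^ 2 + (-2 * q) * p θ + (-2 * cx) * (p θ * Real.cos θ) + (-2 * cy) * (p θ * Real.sin θ) + q ^ 2
       + 2 * q * cx * Real.cos θ + 2 * q * cy * Real.sin θ + cx ^ 2 * (Real.cos θ ^ 2) + cy ^ 2 * (Real.sin θ ^ 2)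
       + 2 * cx * cy * (Real.sin θ * Real.cos θ) := fun θ => by rw [sq_abs]; ring
  simp_rw [e]
  iterate 9 rw [intervalIntegral.integral_add (Continuous.intervalIntegrable (by fun_prop) _ _) (Continuous.intervalIntegrable (by fun_prop) _ _)]
  simp only [intervalIntegral.integral_const_mul, intervalIntegral.integral_const, smul_eq_mul, sub_zero,
    integral_cos, integral_sin, integral_cos_sq, integral_sin_sq, integral_sin_mul_cos₁, ← hL, ← hX, ← hY]
  simp only [Real.sin_two_pi, Real.cos_two_pi, Real.sin_zero, Real.cos_zero]
  rw [hcx, hcy, hq]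
  field_simp
  ring

theorem aux_parts (f f1 g g1 : ℝ → ℝ) (hf : ∀ x, HasDerivAt f (f1 x) x) (hg : ∀ x, HasDerivAt g (g1 x) x)
    (cf1 : Continuous f1) (cg1 : Continuous g1)
    (pf : Function.Periodic f (2 * Real.pi)) (pg : Function.Periodic g (2 * Real.pi)) :
    ∫ x in (0:ℝ)..(2 * Real.pi), f x * g1 x = - ∫ x in (0:ℝ)..(2 * Real.pi), f1 x * g x := by
  rw [intervalIntegral.integral_mul_deriv_eq_deriv_mul (fun x _ => hf x) (fun x _ => hg x)
    (cf1.intervalIntegrable _ _) (cg1.intervalIntegrable _ _)]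
  have e0 : f (2 * Real.pi) = f 0 := by simpa using pf 0
  have e1 : g (2 * Real.pi) = g 0 := by simpa using pg 0
  rw [e0, e1]; ring

theorem aux_sq (f f1 f2 : ℝ → ℝ) (hf : ∀ x, HasDerivAt f (f1 x) x) (hf1 : ∀ x, HasDerivAt f1 (f2 x) x)
    (c0 : Continuous f) (c1 : Continuous f1) (c2 : Continuous f2)
    (pf : Function.Periodic f (2 * Real.pi)) (pg : Function.Periodic f1 (2 * Real.pi)) :
    ∫ x in (0:ℝ)..(2 * Real.pi), (f x + f2 x) ^ 2 = (∫ x in (0:ℝ)..(2 * Real.pi), f x ^ 2)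
      - 2 * (∫ x in (0:ℝ)..(2 * Real.pi), f1 x ^ 2) + ∫ x in (0:ℝ)..(2 * Real.pi), f2 x ^ 2 := by
  have h := aux_parts f f1 f1 f2 hf hf1 c1 c2 pf pg
  have e : ∀ x, (f x + f2 x) ^ 2 = f x ^ 2 + 2 * (f x * f2 x) + f2 x ^ 2 := fun x => by ring
  simp_rw [e]
  iterate 2 rw [intervalIntegral.integral_add (Continuous.intervalIntegrable (by fun_prop) _ _) (Continuous.intervalIntegrable (by fun_prop) _ _)]
  rw [intervalIntegral.integral_const_mul, h]
  simp_rw [← sq]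
  ring

theorem aux_bonn2 (p p1 p2 : ℝ → ℝ) (h0 : ∀ x, HasDerivAt p (p1 x) x) (h1 : ∀ x, HasDerivAt p1 (p2 x) x)
    (c1 : Continuous p1)
    (q0 : Function.Periodic p (2 * Real.pi)) (q1 : Function.Periodic p1 (2 * Real.pi)) (hpos : ∀ x, 0 < p x + p2 x)
    (K : Set (EuclideanSpace ℝ (Fin 2)))
    (hK : K = {x | ∀ θ : ℝ, x 0 * Real.cos θ + x 1 * Real.sin θ ≤ p θ})
    (ρe ρi : ℝ)
    (hρe : ρe = sInf {r : ℝ | 0 ≤ r ∧ ∃ c, K ⊆ Metric.closedBall c r})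
    (hρi : ρi = sSup {r : ℝ | 0 ≤ r ∧ ∃ c, Metric.closedBall c r ⊆ K}) :
    (ρe - ρi) ^ 2 ≤ 2 / Real.pi * ((∫ x in (0:ℝ)..(2 * Real.pi), p1 x ^ 2) - (∫ x in (0:ℝ)..(2 * Real.pi), p x ^ 2)
      + (∫ x in (0:ℝ)..(2 * Real.pi), p x) ^ 2 / (2 * Real.pi)) := by
  have hpi := Real.pi_pos
  obtain ⟨x, y, R, hR, hR2⟩ := aux_bonn p p1 h0 c1 q0 q1
  obtain ⟨x', y', r, hr, hr2⟩ := aux_bonn (fun x => - p x) (fun x => - p1 x) (fun x => (h0 x).neg) c1.neg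
    (fun x => by simp only [q0 x]) (fun x => by simp only [q1 x])
  obtain ⟨g1, g2⟩ := aux_geo p p1 p2 h0 h1 q0 hpos K hK ρe ρi hρe hρi x y R (-x') (-y') (-r) hR
    (fun θ => by linarith [hr θ])
  simp only [neg_sq, intervalIntegral.integral_neg] at hr2
  set P := ∫ x in (0:ℝ)..(2 * Real.pi), p x ^ 2
  set P1 := ∫ x in (0:ℝ)..(2 * Real.pi), p1 x ^ 2
  set Q := ∫ x in (0:ℝ)..(2 * Real.pi), p x
  set q := Q / (2 * Real.pi) with hq
  have hQ : Q = 2 * Real.pi * q := by rw [hq]; field_simp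
  set E := (P1 - P) / (2 * Real.pi) with hE
  have hE' : P1 - P = 2 * Real.pi * E := by rw [hE]; field_simp
  have e2 : 2 / Real.pi * (P1 - P + Q ^ 2 / (2 * Real.pi)) = 4 * (E + q ^ 2) := by
    rw [hQ, hE']; field_simp; ring
  have k1 : (R - q) ^ 2 ≤ E + q ^ 2 := by
    rw [hQ] at hR2
    have : 2 * Real.pi * (R ^ 2 - 2 * R * q - E) ≤ 0 := by linarith
    have := nonpos_of_mul_nonpos_right this (by positivity)
    linarith
  have k2 : (r + q) ^ 2 ≤ E + q ^ 2 := by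
    rw [hQ] at hr2
    have : 2 * Real.pi * (r ^ 2 + 2 * r * q - E) ≤ 0 := by linarith
    have := nonpos_of_mul_nonpos_right this (by positivity)
    linarith
  rw [e2]
  have k3 : (ρe - ρi) ^ 2 ≤ (R + r) ^ 2 := by
    apply pow_le_pow_left₀ g1; linarith
  nlinarith [sq_nonneg ((R - q) - (r + q))]

theorem stmt5
    (p : ℝ → ℝ)
    (hp : ContDiff ℝ (⊤ : ℕ∞) p)
    (hper : ∀ θ : ℝ, p (θ + 2 * Real.pi) = p θ)
    (ρ : ℝ → ℝ)
    (hρdef : ρ = fun θ => p θ + iteratedDeriv 2 p θ)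
    (hρpos : ∀ θ : ℝ, 0 < ρ θ)
    (L A : ℝ)
    (hL : L = ∫ θ in (0:ℝ)..(2 * Real.pi), ρ θ)
    (hA : A = (1 / 2) * ∫ θ in (0:ℝ)..(2 * Real.pi), (p θ ^ 2 - deriv p θ ^ 2))
    (Atilde : ℝ)
    (hAt : Atilde = (1 / 2) * ∫ θ in (0:ℝ)..(2 * Real.pi), (deriv p θ ^ 2 - iteratedDeriv 2 p θ ^ 2))
    (ρβ : ℝ → ℝ)
    (hρβ : ρβ = fun θ => |deriv p θ + iteratedDeriv 3 p θ|)
    (ρM ρm : ℝ)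
    (hρM : ρM = sSup (ρ '' Set.Icc (0:ℝ) (2 * Real.pi)))
    (hρm : ρm = sInf (ρ '' Set.Icc (0:ℝ) (2 * Real.pi)))
    (K : Set (EuclideanSpace ℝ (Fin 2)))
    (hK : K = {x | ∀ θ : ℝ, x 0 * Real.cos θ + x 1 * Real.sin θ ≤ p θ})
    (ρe ρi : ℝ)
    (hρe : ρe = sInf {r : ℝ | 0 ≤ r ∧ ∃ c, K ⊆ Metric.closedBall c r})
    (hρi : ρi = sSup {r : ℝ | 0 ≤ r ∧ ∃ c, Metric.closedBall c r ⊆ K})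
    (cx cy : ℝ)
    (hcx : cx = (1 / Real.pi) * ∫ θ in (0:ℝ)..(2 * Real.pi), p θ * Real.cos θ)
    (hcy : cy = (1 / Real.pi) * ∫ θ in (0:ℝ)..(2 * Real.pi), p θ * Real.sin θ)
    (pS : ℝ → ℝ)
    (hpS : pS = fun θ => L / (2 * Real.pi) + cx * Real.cos θ + cy * Real.sin θ)
    (α δ μ σ η lam ξ ζ : ℝ)
    (W : ℝ)
    (hW : W = α * (∫ θ in (0:ℝ)..(2 * Real.pi), ρ θ ^ 2) + δ * L ^ 2 + μ * A + σ * |Atilde|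
      + η * (∫ θ in (0:ℝ)..(2 * Real.pi), ρβ θ ^ 2) + lam * (ρe - ρi) ^ 2
      + ξ * (ρM - ρm) ^ 2 + ζ * (∫ θ in (0:ℝ)..(2 * Real.pi), (ρ θ)⁻¹))
    (hη : 0 ≤ η) (hξ : 0 ≤ ξ) (hζ : 0 ≤ ζ) (hlam : lam ≤ 0)
    (hc1 : 0 ≤ 2 * α + 4 * Real.pi * δ + μ - 4 * ζ)
    (hc2 : 0 ≤ 2 * α + σ - 2 * η - 4 * ζ)
    (hD : 0 < (6 * Real.pi * α - Real.pi * μ + 4 * Real.pi * σ + 24 * Real.pi * η + 4 * lam + 4 * ξ - 12 * Real.pi * ζ)) :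
    (∫ θ in (0:ℝ)..(2 * Real.pi), |p θ - pS θ| ^ 2)
      ≤ (2 * Real.pi / (3 * (6 * Real.pi * α - Real.pi * μ + 4 * Real.pi * σ + 24 * Real.pi * η + 4 * lam + 4 * ξ - 12 * Real.pi * ζ))) * W := by
  have hpi := Real.pi_pos
  have d0 : ContDiff ℝ ((⊤ : ℕ∞) + 1) p := hp
  set p1 := deriv p with hp1
  have hit2 : iteratedDeriv 2 p = deriv p1 := by
    rw [iteratedDeriv_succ, iteratedDeriv_one]
  have hit3 : iteratedDeriv 3 p = deriv (deriv p1) := by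
    rw [iteratedDeriv_succ, hit2]
  rw [hit2] at hρdef hAt
  rw [hit3] at hρβ
  set p2 := deriv p1 with hp2
  set p3 := deriv p2 with hp3
  have d1 : ContDiff ℝ (⊤ : ℕ∞) p1 := (contDiff_infty_iff_deriv.1 hp).2
  have d2 : ContDiff ℝ (⊤ : ℕ∞) p2 := (contDiff_infty_iff_deriv.1 d1).2
  have d3 : ContDiff ℝ (⊤ : ℕ∞) p3 := (contDiff_infty_iff_deriv.1 d2).2
  have h0 : ∀ x, HasDerivAt p (p1 x) x := fun x => ((contDiff_infty_iff_deriv.1 hp).1 x).hasDerivAt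
  have h1 : ∀ x, HasDerivAt p1 (p2 x) x := fun x => ((contDiff_infty_iff_deriv.1 d1).1 x).hasDerivAt
  have h2 : ∀ x, HasDerivAt p2 (p3 x) x := fun x => ((contDiff_infty_iff_deriv.1 d2).1 x).hasDerivAt
  have c0 := hp.continuous
  have c1 := d1.continuous
  have c2 := d2.continuous
  have c3 := d3.continuous
  have hdp : ∀ f : ℝ → ℝ, Function.Periodic f (2 * Real.pi) → Function.Periodic (deriv f) (2 * Real.pi) := by
    intro f hf x
    rw [← deriv_comp_add_const]
    congr 1
    funext y; exact hf y
  have q0 : Function.Periodic p (2 * Real.pi) := hper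
  have q1 : Function.Periodic p1 (2 * Real.pi) := hdp p q0
  have q2 : Function.Periodic p2 (2 * Real.pi) := hdp p1 q1
  have hρc : Continuous ρ := by rw [hρdef]; fun_prop
  have hp2int : ∫ x in (0:ℝ)..(2 * Real.pi), p2 x = 0 := by
    rw [intervalIntegral.integral_eq_sub_of_hasDerivAt (fun x _ => h1 x) (c2.intervalIntegrable _ _)]
    have : p1 (2 * Real.pi) = p1 0 := by simpa using q1 0
    rw [this, sub_self]
  have hL' : L = ∫ x in (0:ℝ)..(2 * Real.pi), p x := by
    rw [hL, hρdef, intervalIntegral.integral_add (c0.intervalIntegrable _ _) (c2.intervalIntegrable _ _), hp2int, add_zero]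
  have hρ2 := aux_sq p p1 p2 h0 h1 c0 c1 c2 q0 q1
  have hρe2 : ∀ θ, p θ + p2 θ = ρ θ := fun θ => by rw [hρdef]
  simp_rw [hρe2] at hρ2
  have hρβ2 := aux_sq p1 p2 p3 h1 h2 c1 c2 c3 q1 q2
  have hρβe : ∀ θ, (p1 θ + p3 θ) ^ 2 = ρβ θ ^ 2 := fun θ => by rw [hρβ]; simp only [sq_abs]
  simp_rw [hρβe] at hρβ2
  have i0 : IntervalIntegrable (fun x => p x ^ 2) volume 0 (2 * Real.pi) := (c0.pow 2).intervalIntegrable _ _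
  have i1 : IntervalIntegrable (fun x => p1 x ^ 2) volume 0 (2 * Real.pi) := (c1.pow 2).intervalIntegrable _ _
  have i2 : IntervalIntegrable (fun x => p2 x ^ 2) volume 0 (2 * Real.pi) := (c2.pow 2).intervalIntegrable _ _
  rw [intervalIntegral.integral_sub i0 i1] at hA
  rw [intervalIntegral.integral_sub i1 i2] at hAt
  have hpop := aux_popov ρ hρc ρM ρm hρM hρm
  rw [← hL, hρ2] at hpop
  have hbon := aux_bonn2 p p1 p2 h0 h1 c1 q0 q1 (fun x => by have := hρpos x; rw [hρdef] at this; exact this)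
    K hK ρe ρi hρe hρi
  rw [← hL'] at hbon
  have hh := aux_h2 p c0 L cx cy _ _ hL' rfl rfl hcx hcy
  obtain ⟨w1, w2, w3, w4⟩ := aux_wirts p p1 p2 p3 h0 h1 h2 c0 c1 c2 c3 q0 q1 q2 _ _ _ _ _ _ _ rfl rfl rfl rfl rfl rfl rfl
  rw [← hL'] at w2 w3 w4
  have hZ : 0 ≤ ∫ θ in (0:ℝ)..(2 * Real.pi), (ρ θ)⁻¹ :=
    intervalIntegral.integral_nonneg (by linarith) fun x _ => (inv_pos.2 (hρpos x)).le
  have hLT : L ^ 2 = 2 * Real.pi * (L ^ 2 / (2 * Real.pi)) := by field_simp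
  have hT0 : 0 ≤ L ^ 2 / (2 * Real.pi) := by positivity
  have hS0 : 0 ≤ ((∫ x in (0:ℝ)..(2 * Real.pi), p x * Real.cos x) ^ 2 + (∫ x in (0:ℝ)..(2 * Real.pi), p x * Real.sin x) ^ 2)
      / (2 * Real.pi) := by positivity
  rw [hpS, hh]
  have hH0 : 0 ≤ ∫ θ in (0:ℝ)..(2 * Real.pi), |p θ - (L / (2 * Real.pi) + cx * Real.cos θ + cy * Real.sin θ)| ^ 2 :=
    intervalIntegral.integral_nonneg (by linarith) fun x _ => by positivity
  rw [hh] at hH0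
  rw [hρ2, hρβ2, hLT] at hW
  clear hh hρ2 hρβ2 hLT hL'
  generalize (∫ x in (0:ℝ)..(2 * Real.pi), p x ^ 2) = J0 at *
  generalize (∫ x in (0:ℝ)..(2 * Real.pi), p1 x ^ 2) = J1 at *
  generalize (∫ x in (0:ℝ)..(2 * Real.pi), p2 x ^ 2) = J2 at *
  generalize (∫ x in (0:ℝ)..(2 * Real.pi), p3 x ^ 2) = J3 at *
  generalize ((∫ x in (0:ℝ)..(2 * Real.pi), p x * Real.cos x) ^ 2 + (∫ x in (0:ℝ)..(2 * Real.pi), p x * Real.sin x) ^ 2)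
      / (2 * Real.pi) = S at *
  generalize (∫ θ in (0:ℝ)..(2 * Real.pi), (ρ θ)⁻¹) = Z at *
  generalize L ^ 2 / (2 * Real.pi) = T at *
  generalize (ρe - ρi) ^ 2 = d at *
  generalize (ρM - ρm) ^ 2 = w at *
  rw [hAt, abs_of_nonpos (by linarith), hA] at hW
  generalize hDD : 6 * Real.pi * α - Real.pi * μ + 4 * Real.pi * σ + 24 * Real.pi * η + 4 * lam + 4 * ξ - 12 * Real.pi * ζ = D at *
  rw [div_mul_eq_mul_div, le_div_iff₀ (by positivity)]
  have hE : 3 * (J0 - T - 2 * S) ≤ J1 - J0 + T := by linarith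
  have hw : 2 / Real.pi * (J1 - J0 + T) ≤ w := by
    refine le_trans ?_ hpop
    apply mul_le_mul_of_nonneg_left _ (by positivity)
    linarith
  have t1 := mul_nonneg hc1 hT0
  have t2 := mul_nonneg hc2 w2
  have t3 := mul_nonneg hη w3
  have t4 := mul_nonneg hξ (sub_nonneg.2 hw)
  have t5 := mul_nonneg (neg_nonneg.2 hlam) (sub_nonneg.2 hbon)
  have t6 := mul_nonneg hζ hZ
  have t7 := mul_nonneg hζ hT0
  have t8 := mul_nonneg hζ w2
  have t9 := mul_le_mul_of_nonneg_left hE hD.le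
  have t10 : 0 ≤ ζ * (J1 - J0 + T) := mul_nonneg hζ (by linarith)
  have key : 2 * Real.pi * W = Real.pi * ((2 * α + 4 * Real.pi * δ + μ - 4 * ζ) * T) + 4 * Real.pi * (ζ * T)
      + D * (J1 - J0 + T) + 12 * Real.pi * (ζ * (J1 - J0 + T))
      + Real.pi * ((2 * α + σ - 2 * η - 4 * ζ) * (J2 - 5 * J1 + 4 * J0 - 4 * T))
      + 4 * Real.pi * (ζ * (J2 - 5 * J1 + 4 * J0 - 4 * T))
      + 2 * Real.pi * (η * (J3 - J2 - 16 * J1 + 16 * J0 - 16 * T))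
      + 2 * Real.pi * (-lam * (2 / Real.pi * (J1 - J0 + T) - d)) + 2 * Real.pi * (ξ * (w - 2 / Real.pi * (J1 - J0 + T)))
      + 2 * Real.pi * (ζ * Z) := by
    rw [hW, ← hDD]
    field_simp
    ring
  have hpos' : 0 ≤ 2 * Real.pi * W - D * (J1 - J0 + T) := by
    rw [key]
    have : ∀ x : ℝ, 0 ≤ x → 0 ≤ Real.pi * x := fun x hx => mul_nonneg hpi.le hx
    linarith [this _ t1, this _ t2, this _ t3, this _ t4, this _ t5, this _ t6, this _ t7, this _ t8, this _ t10]
  linarith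
end
end

section
/- Let real parameters (α, δ, μ, σ, η, λ, ξ, ζ) satisfy η ≥ 0, ξ ≥ 0, ζ ≥ 0, λ ≤ 0, 2α + 4πδ + μ − 4ζ ≥ 0, 2α + σ − 2η − 4ζ ≥ 0, D := 6πα − πμ + 4πσ + 24πη + 4λ + 4ξ − 12πζ > 0, and λ² + ξ² + ζ² > 0. If equality holds in the L² stability estimate, i.e. ∫₀^{2π} |p(θ) − p_S(θ)|² dθ = (2π/(3D)) · W, where W = α∫₀^{2π}ρ(θ)²dθ + δL² + μA + σ|Ã| + η∫₀^{2π}ρ_β(θ)²dθ + λ(ρ_e − ρ_i)² + ξ(ρ_M − ρ_m)² + ζ∫₀^{2π}ρ(θ)⁻¹dθ, then K is a disk, i.e. there exist real numbers a₀, a₁, b₁ with p(θ) = a₀ + a₁ cos θ + b₁ sin θ for all θ. -/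
open MeasureTheory
noncomputable section

lemma cv_coeff_deriv (h : (0:ℝ) < 2 * Real.pi) (f f' : ℝ → ℝ) (hf : ∀ x, HasDerivAt f (f' x) x) (hc : Continuous f')
    (hper : f (2 * Real.pi) = f 0) (n : ℤ) :
    ‖fourierCoeffOn h (fun x => (f' x : ℂ)) n‖ ^ 2 = (n:ℝ) ^ 2 * ‖fourierCoeffOn h (fun x => (f x : ℂ)) n‖ ^ 2 := by
  by_cases hn : n = 0
  · subst hn
    rw [fourierCoeffOn_eq_integral]
    have : ∫ x in (0:ℝ)..(2 * Real.pi), f' x = 0 := by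
      rw [intervalIntegral.integral_eq_sub_of_hasDerivAt (fun x _ => hf x) (hc.intervalIntegrable _ _), hper, sub_self]
    have h2 : ∫ x in (0:ℝ)..(2 * Real.pi), (f' x : ℂ) = 0 := by
      rw [intervalIntegral.integral_ofReal, this]; simp
    simp [h2]
  · have := fourierCoeffOn_of_hasDerivAt h (f := fun x => (f x : ℂ)) (f' := fun x => (f' x : ℂ)) hn
      (fun x _ => (hf x).ofReal_comp) ((Complex.continuous_ofReal.comp hc).intervalIntegrable _ _)
    have hn' : (n:ℂ) ≠ 0 := by exact_mod_cast hn
    have hpi : (Real.pi : ℂ) ≠ 0 := by exact_mod_cast Real.pi_ne_zero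
    have e : fourierCoeffOn h (fun x => (f' x : ℂ)) n = Complex.I * n * fourierCoeffOn h (fun x => (f x : ℂ)) n := by
      rw [this]
      simp only [hper]
      push_cast
      field_simp
      ring
    rw [e, norm_mul, norm_mul, mul_pow, mul_pow]
    simp

lemma cv_parseval (h : (0:ℝ) < 2 * Real.pi) (f : ℝ → ℝ) (hc : Continuous f) :
    HasSum (fun n : ℤ => ‖fourierCoeffOn h (fun x => (f x : ℂ)) n‖ ^ 2)
      ((2 * Real.pi)⁻¹ * ∫ x in (0:ℝ)..(2 * Real.pi), f x ^ 2) := by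
  have hcc : Continuous (fun x => (f x : ℂ)) := Complex.continuous_ofReal.comp hc
  have hm : MemLp (fun x => (f x : ℂ)) 2 (volume.restrict (Set.Ioc 0 (2 * Real.pi))) := by
    rw [memLp_two_iff_integrable_sq_norm hcc.aestronglyMeasurable]
    have : Continuous (fun x => ‖(f x : ℂ)‖ ^ 2) := by fun_prop
    exact (this.intervalIntegrable 0 (2 * Real.pi)).1
  have := hasSum_sq_fourierCoeffOn h hm
  simpa using this

lemma cv_coeff_low (h : (0:ℝ) < 2 * Real.pi) (f : ℝ → ℝ) (hc : Continuous f)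
    (h0 : ∫ x in (0:ℝ)..(2 * Real.pi), f x = 0)
    (h1 : ∫ x in (0:ℝ)..(2 * Real.pi), f x * Real.cos x = 0)
    (h2 : ∫ x in (0:ℝ)..(2 * Real.pi), f x * Real.sin x = 0) (n : ℤ) (hn : n ^ 2 < 4) :
    fourierCoeffOn h (fun x => (f x : ℂ)) n = 0 := by
  have k0 : ∫ x in (0:ℝ)..(2 * Real.pi), (f x : ℂ) = 0 := by
    rw [intervalIntegral.integral_ofReal, h0]; simp
  have k1 : ∫ x in (0:ℝ)..(2 * Real.pi), (f x : ℂ) * Complex.cos x = 0 := by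
    have : ∀ x : ℝ, (f x : ℂ) * Complex.cos x = ((f x * Real.cos x : ℝ) : ℂ) := by intro x; simp
    simp only [this]
    rw [intervalIntegral.integral_ofReal, h1]; simp
  have k2 : ∫ x in (0:ℝ)..(2 * Real.pi), (f x : ℂ) * Complex.sin x = 0 := by
    have : ∀ x : ℝ, (f x : ℂ) * Complex.sin x = ((f x * Real.sin x : ℝ) : ℂ) := by intro x; simp
    simp only [this]
    rw [intervalIntegral.integral_ofReal, h2]; simp
  have hpi : (Real.pi : ℂ) ≠ 0 := by exact_mod_cast Real.pi_ne_zero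
  have hcc : Continuous (fun x => (f x : ℂ)) := Complex.continuous_ofReal.comp hc
  have key : ∀ s : ℂ, ∫ x in (0:ℝ)..(2 * Real.pi), ((f x : ℂ) * Complex.cos x + s * ((f x : ℂ) * Complex.sin x)) = 0 := by
    intro s
    rw [intervalIntegral.integral_add, intervalIntegral.integral_const_mul, k1, k2]; simp
    · apply Continuous.intervalIntegrable; fun_prop
    · apply Continuous.intervalIntegrable; fun_prop
  have hb : n = 0 ∨ n = 1 ∨ n = -1 := by
    have : n < 2 := by nlinarith
    have : -2 < n := by nlinarith
    omega
  rw [fourierCoeffOn_eq_integral]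
  rcases hb with rfl | rfl | rfl
  · simp [k0]
  · have := key (-Complex.I)
    rw [smul_eq_zero]; right
    rw [← this]
    apply intervalIntegral.integral_congr
    intro x _
    simp only [fourier_coe_apply, smul_eq_mul]
    have e : 2 * (Real.pi:ℂ) * Complex.I * ((-1 : ℤ) : ℂ) * x / ((2 * Real.pi - 0 : ℝ) : ℂ) = (-x : ℂ) * Complex.I := by
      push_cast; field_simp; ring
    rw [e, Complex.exp_mul_I, Complex.cos_neg, Complex.sin_neg]; ring
  · have := key (Complex.I)
    rw [smul_eq_zero]; right
    rw [← this]
    apply intervalIntegral.integral_congr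
    intro x _
    simp only [fourier_coe_apply, smul_eq_mul]
    have e : 2 * (Real.pi:ℂ) * Complex.I * ((- -1 : ℤ) : ℂ) * x / ((2 * Real.pi - 0 : ℝ) : ℂ) = (x : ℂ) * Complex.I := by
      push_cast; field_simp; ring
    rw [e, Complex.exp_mul_I]; ring

/-- all Fourier inequalities needed -/
lemma cv_fourier (q0 q1 q2 q3 : ℝ → ℝ) (hq0 : ∀ x, HasDerivAt q0 (q1 x) x) (hq1 : ∀ x, HasDerivAt q1 (q2 x) x)
    (hq2 : ∀ x, HasDerivAt q2 (q3 x) x) (hc3 : Continuous q3)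
    (e0 : q0 (2 * Real.pi) = q0 0) (e1 : q1 (2 * Real.pi) = q1 0) (e2 : q2 (2 * Real.pi) = q2 0)
    (h0 : ∫ x in (0:ℝ)..(2 * Real.pi), q0 x = 0)
    (h1 : ∫ x in (0:ℝ)..(2 * Real.pi), q0 x * Real.cos x = 0)
    (h2 : ∫ x in (0:ℝ)..(2 * Real.pi), q0 x * Real.sin x = 0)
    (I0 I1 I2 I3 : ℝ) (d0 : I0 = ∫ x in (0:ℝ)..(2 * Real.pi), q0 x ^ 2)
    (d1 : I1 = ∫ x in (0:ℝ)..(2 * Real.pi), q1 x ^ 2)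
    (d2 : I2 = ∫ x in (0:ℝ)..(2 * Real.pi), q2 x ^ 2)
    (d3 : I3 = ∫ x in (0:ℝ)..(2 * Real.pi), q3 x ^ 2) :
    0 ≤ I1 - 4 * I0 ∧ 0 ≤ I2 - I1 ∧ 0 ≤ I2 - 5 * I1 + 4 * I0 ∧ 0 ≤ I3 - 2 * I2 - 11 * I1 + 12 * I0 ∧
    (I1 - 4 * I0 = 0 → I2 - 8 * I1 + 16 * I0 = 0) := by
  have h : (0:ℝ) < 2 * Real.pi := by positivity
  have c0 : Continuous q0 := continuous_iff_continuousAt.2 fun x => (hq0 x).continuousAt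
  have c1 : Continuous q1 := continuous_iff_continuousAt.2 fun x => (hq1 x).continuousAt
  have c2 : Continuous q2 := continuous_iff_continuousAt.2 fun x => (hq2 x).continuousAt
  have s0 := cv_parseval h q0 c0
  have s1 := cv_parseval h q1 c1
  have s2 := cv_parseval h q2 c2
  have s3 := cv_parseval h q3 hc3
  simp only [cv_coeff_deriv h q2 q3 hq2 hc3 e2] at s3
  simp only [cv_coeff_deriv h q1 q2 hq1 c2 e1] at s3 s2
  simp only [cv_coeff_deriv h q0 q1 hq0 c1 e0] at s3 s2 s1
  rw [← d0] at s0
  rw [← d1] at s1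
  rw [← d2] at s2
  rw [← d3] at s3
  have low := cv_coeff_low h q0 c0 h0 h1 h2
  obtain ⟨c, hcdef⟩ : ∃ c : ℤ → ℝ, c = fun n => ‖fourierCoeffOn h (fun x => (q0 x : ℂ)) n‖ ^ 2 := ⟨_, rfl⟩
  have hcn : ∀ n, 0 ≤ c n := by intro n; rw [hcdef]; positivity
  have hcl : ∀ n : ℤ, c n = 0 ∨ (4:ℝ) ≤ (n:ℝ)^2 := by
    intro n
    by_cases hn : n ^ 2 < 4
    · left; rw [hcdef]; simp [low n hn]
    · right; push Not at hn; exact_mod_cast hn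
  have hce : ∀ n, ‖fourierCoeffOn h (fun x => (q0 x : ℂ)) n‖ ^ 2 = c n := by intro n; rw [hcdef]
  simp only [hce] at s0 s1 s2 s3
  have hi : 0 < (2 * Real.pi)⁻¹ := by positivity
  have fin : ∀ X : ℝ, 0 ≤ (2 * Real.pi)⁻¹ * X → 0 ≤ X := fun X hX => nonneg_of_mul_nonneg_right hX hi
  have t1 := s1.sub (s0.mul_left 4)
  refine ⟨fin _ ?_, fin _ ?_, fin _ ?_, fin _ ?_, ?_⟩
  · have := t1.nonneg (fun n => by
      rcases hcl n with h | h
      · simp [h]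
      · nlinarith [hcn n])
    linarith
  · have := (s2.sub s1).nonneg (fun n => by
      rcases hcl n with h | h
      · simp [h]
      · have : 0 ≤ (n:ℝ)^2 * c n := mul_nonneg (by positivity) (hcn n)
        nlinarith [hcn n])
    linarith
  · have := ((s2.sub (s1.mul_left 5)).add (s0.mul_left 4)).nonneg (fun n => by
      rcases hcl n with h | h
      · simp [h]
      · have : 0 ≤ (((n:ℝ)^2 - 1) * ((n:ℝ)^2 - 4)) * c n := mul_nonneg (mul_nonneg (by linarith) (by linarith)) (hcn n)
        linarith)
    linarith
  · have := (((s3.sub (s2.mul_left 2)).sub (s1.mul_left 11)).add (s0.mul_left 12)).nonneg (fun n => by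
      rcases hcl n with h | h
      · simp [h]
      · have : 0 ≤ (((n:ℝ)^2 - 1) * ((n:ℝ)^2 - 4) * ((n:ℝ)^2 + 3)) * c n := mul_nonneg (mul_nonneg (mul_nonneg (by linarith) (by linarith)) (by linarith)) (hcn n)
        linarith)
    linarith
  · intro hz
    have t1' : HasSum (fun n : ℤ => (n:ℝ)^2 * c n - 4 * c n) 0 := by
      have e : (2 * Real.pi)⁻¹ * I1 - 4 * ((2 * Real.pi)⁻¹ * I0) = 0 := by
        linear_combination ((2 * Real.pi)⁻¹) * hz
      rwa [e] at t1
    have z := (hasSum_zero_iff_of_nonneg (fun n => by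
      show 0 ≤ (n:ℝ)^2 * c n - 4 * c n
      rcases hcl n with h | h
      · simp [h]
      · nlinarith [hcn n])).1 t1'
    have t2 := (s2.sub (s1.mul_left 8)).add (s0.mul_left 16)
    have zz : (fun n : ℤ => (n:ℝ)^2 * ((n:ℝ)^2 * c n) - 8 * ((n:ℝ)^2 * c n) + 16 * c n) = fun _ => 0 := by
      funext n
      have := congrFun z n
      simp only [Pi.zero_apply] at this
      linear_combination ((n:ℝ)^2 - 4) * this
    rw [zz] at t2
    have := t2.unique hasSum_zero
    have h3 : (2 * Real.pi)⁻¹ * (I2 - 8 * I1 + 16 * I0) = 0 := by linarith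
    exact (mul_eq_zero.1 h3).resolve_left hi.ne'

lemma cv_dirichlet_k (g g' : ℝ → ℝ) (hg : ∀ x, HasDerivAt g (g' x) x) (hc : Continuous g') (a b : ℝ) (hab : a ≤ b)
    (hl : b - a ≤ Real.pi) (ga : g a = 0) (gb : g b = 0) (k : ℝ) (hk0 : 0 < k) (hk1 : k < 1) :
    k ^ 2 * (∫ x in a..b, g x ^ 2) ≤ ∫ x in a..b, g' x ^ 2 := by
  have cg : Continuous g := continuous_iff_continuousAt.2 fun x => (hg x).continuousAt
  set m := (a + b) / 2 with hm
  have hcos : ∀ x ∈ Set.uIcc a b, 0 < Real.cos (k * (x - m)) := by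
    intro x hx
    rw [Set.uIcc_of_le hab] at hx
    have hpi := Real.pi_pos
    have h1 : |x - m| ≤ Real.pi / 2 := by rw [abs_le]; constructor <;> linarith [hx.1, hx.2]
    have h2 : |k * (x - m)| < Real.pi / 2 := by
      rw [abs_mul, abs_of_pos hk0]; nlinarith [abs_nonneg (x - m)]
    rw [abs_lt] at h2
    exact Real.cos_pos_of_mem_Ioo ⟨h2.1, h2.2⟩
  set w : ℝ → ℝ := fun x => -k * Real.sin (k * (x - m)) / Real.cos (k * (x - m)) with hw
  have cw : ContinuousOn w (Set.uIcc a b) := by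
    apply ContinuousOn.div
    · fun_prop
    · fun_prop
    · intro x hx; exact (hcos x hx).ne'
  have hd : ∀ x ∈ Set.uIcc a b, HasDerivAt (fun x => g x ^ 2 * w x) (2 * g x * g' x * w x + g x ^ 2 * (-k^2 - w x ^ 2)) x := by
    intro x hx
    have hne := (hcos x hx).ne'
    have hlin : HasDerivAt (fun x => k * (x - m)) k x := by
      simpa using ((hasDerivAt_id x).sub_const m).const_mul k
    have hs := (hlin.sin).const_mul (-k)
    have hcs := hlin.cos
    have := ((hg x).pow 2).mul (hs.div hcs hne)
    refine HasDerivAt.congr_deriv this ?_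
    simp only [hw, Pi.div_apply, Pi.pow_apply]
    push_cast
    field_simp
  have hint : ContinuousOn (fun x => 2 * g x * g' x * w x + g x ^ 2 * (-k^2 - w x ^ 2)) (Set.uIcc a b) := by
    fun_prop
  have hz := intervalIntegral.integral_eq_sub_of_hasDerivAt hd hint.intervalIntegrable
  simp only [ga, gb] at hz
  have : 0 ≤ ∫ x in a..b, (g' x - g x * w x) ^ 2 := intervalIntegral.integral_nonneg hab (fun x _ => sq_nonneg _)
  have e : ∫ x in a..b, (g' x - g x * w x) ^ 2 = (∫ x in a..b, (g' x ^ 2 - k ^ 2 * g x ^ 2)) - ∫ x in a..b, (2 * g x * g' x * w x + g x ^ 2 * (-k^2 - w x ^ 2)) := by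
    rw [← intervalIntegral.integral_sub]
    · congr 1; funext x; ring
    · apply Continuous.intervalIntegrable; fun_prop
    · exact hint.intervalIntegrable
  rw [intervalIntegral.integral_sub, intervalIntegral.integral_const_mul] at e
  · linarith
  · apply Continuous.intervalIntegrable; fun_prop
  · apply Continuous.intervalIntegrable; fun_prop

lemma cv_dirichlet (g g' : ℝ → ℝ) (hg : ∀ x, HasDerivAt g (g' x) x) (hc : Continuous g') (a b : ℝ) (hab : a ≤ b)
    (hl : b - a ≤ Real.pi) (ga : g a = 0) (gb : g b = 0) :
    (∫ x in a..b, g x ^ 2) ≤ ∫ x in a..b, g' x ^ 2 := by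
  have ht : Filter.Tendsto (fun k : ℝ => k ^ 2 * (∫ x in a..b, g x ^ 2)) (nhdsWithin 1 (Set.Iio 1)) (nhds (1 ^ 2 * (∫ x in a..b, g x ^ 2))) := by
    apply Filter.Tendsto.mono_left _ nhdsWithin_le_nhds
    apply Continuous.tendsto; fun_prop
  rw [one_pow, one_mul] at ht
  refine le_of_tendsto ht ?_
  have : Set.Ioo (0:ℝ) 1 ∈ nhdsWithin (1:ℝ) (Set.Iio 1) := Ioo_mem_nhdsLT (by norm_num)
  filter_upwards [this] with k hk
  exact cv_dirichlet_k g g' hg hc a b hab hl ga gb k hk.1 hk.2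

lemma cv_gap (g g' : ℝ → ℝ) (hg : ∀ x, HasDerivAt g (g' x) x) (hc : Continuous g')
    (hp : Function.Periodic g (2 * Real.pi)) (hp' : Function.Periodic g' (2 * Real.pi))
    (hz : ∀ φ, ∃ θ ∈ Set.Icc φ (φ + Real.pi), g θ = 0) :
    (∫ x in (0:ℝ)..(2 * Real.pi), g x ^ 2) ≤ ∫ x in (0:ℝ)..(2 * Real.pi), g' x ^ 2 := by
  have cg : Continuous g := continuous_iff_continuousAt.2 fun x => (hg x).continuousAt
  have hpi := Real.pi_pos
  obtain ⟨z, -, gz⟩ := hz 0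
  have hpp : Function.Periodic (fun x => g x ^ 2) (2 * Real.pi) := fun x => by simp only [hp x]
  have hpp' : Function.Periodic (fun x => g' x ^ 2) (2 * Real.pi) := fun x => by simp only [hp' x]
  have r1 := hpp.intervalIntegral_add_eq 0 z
  have r2 := hpp'.intervalIntegral_add_eq 0 z
  rw [zero_add] at r1 r2
  rw [r1, r2]
  have clz : IsClosed {x | g x = 0} := isClosed_eq cg continuous_const
  obtain ⟨a, ⟨haI, ha0⟩, hamax⟩ := (isCompact_Icc (a := z) (b := z + Real.pi)).inter_right clz |>.exists_isGreatest ⟨z, ⟨by constructor <;> linarith, gz⟩⟩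
  have gz2 : g (z + 2 * Real.pi) = 0 := by rw [hp z, gz]
  obtain ⟨b, ⟨hbI, hb0⟩, hbmin⟩ := (isCompact_Icc (a := z + Real.pi) (b := z + 2 * Real.pi)).inter_right clz |>.exists_isLeast ⟨z + 2 * Real.pi, ⟨by constructor <;> linarith, gz2⟩⟩
  have hba : b - a ≤ Real.pi := by
    by_contra hcon
    push Not at hcon
    obtain ⟨θ, ⟨h1, h2⟩, h3⟩ := hz (a + (b - a - Real.pi) / 2)
    rcases le_total θ (z + Real.pi) with h | h
    · have := hamax ⟨⟨by linarith [haI.1], h⟩, h3⟩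
      linarith
    · have := hbmin ⟨⟨h, by linarith [hbI.2]⟩, h3⟩
      linarith
  have i : ∀ (f : ℝ → ℝ) (hf : Continuous f), ∫ x in z..(z + 2 * Real.pi), f x ^ 2 = (∫ x in z..a, f x ^ 2) + (∫ x in a..b, f x ^ 2) + ∫ x in b..(z + 2 * Real.pi), f x ^ 2 := by
    intro f hf
    have hi : ∀ u v, IntervalIntegrable (fun x => f x ^ 2) volume u v := fun u v => (hf.pow 2).intervalIntegrable _ _
    rw [intervalIntegral.integral_add_adjacent_intervals (hi _ _) (hi _ _), intervalIntegral.integral_add_adjacent_intervals (hi _ _) (hi _ _)]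
  rw [i g cg, i g' hc]
  have := cv_dirichlet g g' hg hc z a haI.1 (by linarith [haI.2]) gz ha0
  have := cv_dirichlet g g' hg hc a b (by linarith [haI.2, hbI.1]) hba ha0 hb0
  have := cv_dirichlet g g' hg hc b (z + 2 * Real.pi) hbI.2 (by linarith [hbI.1]) hb0 gz2
  linarith

lemma cv_opt (p : ℝ → ℝ) (hc : Continuous p) (hp : Function.Periodic p (2 * Real.pi)) :
    ∃ c0 c1 r : ℝ, (∀ θ, r ≤ p θ - c0 * Real.cos θ - c1 * Real.sin θ) ∧
      ∀ φ, ∃ θ ∈ Set.Icc φ (φ + Real.pi), p θ - c0 * Real.cos θ - c1 * Real.sin θ = r := by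
  have hpi := Real.pi_pos
  obtain ⟨B, hB⟩ : ∃ B, ∀ θ, |p θ| ≤ B := by
    obtain ⟨B, hB⟩ := (isCompact_Icc (a := (0:ℝ)) (b := 2 * Real.pi)).exists_bound_of_continuousOn hc.continuousOn
    refine ⟨B, fun θ => ?_⟩
    obtain ⟨y, hy, hy'⟩ := hp.exists_mem_Ico₀ (by positivity) θ
    rw [hy']; exact hB y ⟨hy.1, hy.2.le⟩
  set S : Set (ℝ × ℝ × ℝ) := {v | -B ≤ v.2.2 ∧ ∀ θ, v.2.2 ≤ p θ - v.1 * Real.cos θ - v.2.1 * Real.sin θ} with hS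
  have hcl : IsClosed S := by
    rw [hS, Set.ofPred_and, Set.ofPred_forall]
    apply IsClosed.inter
    · exact isClosed_le (by fun_prop) (by fun_prop)
    · exact isClosed_iInter fun θ => isClosed_le (by fun_prop) (by fun_prop)
  have hsub : S ⊆ Set.Icc (-(2*B), -(2*B), -B) (2*B, 2*B, B) := by
    rintro ⟨x, y, r⟩ ⟨h1, h2⟩
    simp only at h1 h2
    have a1 := h2 0
    have a2 := h2 Real.pi
    have a3 := h2 (Real.pi / 2)
    have a4 := h2 (-(Real.pi / 2))
    simp at a1 a2 a3 a4
    have b1 := abs_le.1 (hB 0)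
    have b2 := abs_le.1 (hB Real.pi)
    have b3 := abs_le.1 (hB (Real.pi/2))
    have b4 := abs_le.1 (hB (-(Real.pi/2)))
    refine ⟨⟨?_, ?_, ?_⟩, ⟨?_, ?_, ?_⟩⟩ <;> simp only <;> linarith
  have hcomp : IsCompact S := isCompact_Icc.of_isClosed_subset hcl hsub
  have hne : S.Nonempty := ⟨(0, 0, -B), le_rfl, fun θ => by simpa using (abs_le.1 (hB θ)).1⟩
  obtain ⟨⟨c0, c1, r⟩, ⟨hm1, hm2⟩, hmax⟩ := hcomp.exists_isMaxOn hne (f := fun v => v.2.2) (by fun_prop)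
  simp only at hm1 hm2
  refine ⟨c0, c1, r, hm2, ?_⟩
  by_contra hcon
  push Not at hcon
  obtain ⟨φ, hφ⟩ := hcon
  set g : ℝ → ℝ := fun θ => p θ - c0 * Real.cos θ - c1 * Real.sin θ - r with hgdef
  have hgc : Continuous g := by fun_prop
  have hgp : ∀ θ, g (θ + 2 * Real.pi) = g θ := by intro θ; simp only [hgdef, hp θ, Real.cos_add_two_pi, Real.sin_add_two_pi]
  have hgn : ∀ θ, 0 ≤ g θ := fun θ => by have := hm2 θ; simp only [hgdef]; linarith
  obtain ⟨x0, hx0, hmin⟩ := (isCompact_Icc (a := φ) (b := φ + Real.pi)).exists_isMinOn ⟨φ, by constructor <;> linarith⟩ hgc.continuousOn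
  have hε : 0 < g x0 := lt_of_le_of_ne (hgn x0) (fun h => hφ x0 hx0 (by simp only [hgdef] at h; linarith))
  set t := g x0 / 2 with ht
  set G : ℝ → ℝ := fun θ => g θ - t * Real.sin (θ - φ) with hG
  have hGc : Continuous G := by fun_prop
  have hGp : Function.Periodic G (2 * Real.pi) := by
    intro θ
    have : θ + 2 * Real.pi - φ = θ - φ + 2 * Real.pi := by ring
    simp only [hG, hgp, this, Real.sin_add_two_pi]
  have hGpos : ∀ θ, 0 < G θ := by
    intro θ
    obtain ⟨y, hy, hy'⟩ := hGp.exists_mem_Ico (by positivity) θ φ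
    rw [hy']
    rcases le_or_gt y (φ + Real.pi) with h | h
    · have h1 := hmin (show y ∈ Set.Icc φ (φ + Real.pi) from ⟨hy.1, h⟩)
      have h2 := Real.sin_le_one (y - φ)
      simp only [hG, Set.mem_ofPred_eq] at h1 ⊢
      nlinarith
    · have : Real.sin (y - φ) < 0 := by
        have e : Real.sin (y - φ) = - Real.sin (y - φ - Real.pi) := by rw [Real.sin_sub_pi]; ring
        rw [e]
        have := Real.sin_pos_of_pos_of_lt_pi (x := y - φ - Real.pi) (by linarith) (by linarith [hy.2])
        linarith
      have h1 := hgn y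
      simp only [hG]
      nlinarith
  obtain ⟨x1, -, hmin1⟩ := (isCompact_Icc (a := (0:ℝ)) (b := 2 * Real.pi)).exists_isMinOn ⟨0, by constructor <;> linarith⟩ hGc.continuousOn
  have hG1 : ∀ θ, G x1 ≤ G θ := by
    intro θ
    obtain ⟨y, hy, hy'⟩ := hGp.exists_mem_Ico₀ (by positivity) θ
    rw [hy']; exact hmin1 ⟨hy.1, hy.2.le⟩
  have := hmax (show (c0 - t * Real.sin φ, c1 + t * Real.cos φ, r + G x1) ∈ S from by
    refine ⟨by simp only; linarith [hGpos x1], fun θ => ?_⟩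
    have := hG1 θ
    simp only [hG, hgdef, Real.sin_sub] at this ⊢
    linarith)
  simp only [Set.mem_ofPred_eq] at this
  linarith [hGpos x1]

lemma cv_td (F f g : ℝ → ℝ) (a b : ℝ) (hf : Continuous f) (hg : Continuous g) (hF : ∀ x, HasDerivAt F (f x - g x) x)
    (hab : F b = F a) : ∫ x in a..b, f x = ∫ x in a..b, g x := by
  have := intervalIntegral.integral_eq_sub_of_hasDerivAt (a := a) (b := b) (fun x _ => hF x) ((hf.sub hg).intervalIntegrable _ _)
  rw [intervalIntegral.integral_sub (hf.intervalIntegrable _ _) (hg.intervalIntegrable _ _), hab, sub_self] at this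
  linarith

lemma cv_D (p p1 : ℝ → ℝ) (hp : ∀ x, HasDerivAt p (p1 x) x) (hc : Continuous p1)
    (per : Function.Periodic p (2 * Real.pi)) (per1 : Function.Periodic p1 (2 * Real.pi)) :
    ∃ c0 c1 r : ℝ, (∀ θ, r + c0 * Real.cos θ + c1 * Real.sin θ ≤ p θ) ∧
      Real.pi * r ^ 2 - r * (∫ x in (0:ℝ)..(2 * Real.pi), p x) + (1 / 2) * (∫ x in (0:ℝ)..(2 * Real.pi), (p x ^ 2 - p1 x ^ 2)) ≤ 0 := by
  have cp : Continuous p := continuous_iff_continuousAt.2 fun x => (hp x).continuousAt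
  obtain ⟨c0, c1, r, h1, h2⟩ := cv_opt p cp per
  refine ⟨c0, c1, r, fun θ => by linarith [h1 θ], ?_⟩
  have he : ∀ x, HasDerivAt (fun x => c0 * Real.cos x + c1 * Real.sin x) (-c0 * Real.sin x + c1 * Real.cos x) x := by
    intro x
    exact (((Real.hasDerivAt_cos x).const_mul c0).add ((Real.hasDerivAt_sin x).const_mul c1)).congr_deriv (by ring)
  have he' : ∀ x, HasDerivAt (fun x => -c0 * Real.sin x + c1 * Real.cos x) (-(c0 * Real.cos x + c1 * Real.sin x)) x := by
    intro x
    exact (((Real.hasDerivAt_sin x).const_mul (-c0)).add ((Real.hasDerivAt_cos x).const_mul c1)).congr_deriv (by ring)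
  have hgap := cv_gap (fun x => p x - (c0 * Real.cos x + c1 * Real.sin x) - r) (fun x => p1 x - (-c0 * Real.sin x + c1 * Real.cos x))
    (fun x => ((hp x).sub (he x)).sub_const r) (by fun_prop)
    (fun x => by simp only [per x, Real.cos_add_two_pi, Real.sin_add_two_pi])
    (fun x => by simp only [per1 x, Real.cos_add_two_pi, Real.sin_add_two_pi])
    (fun φ => by
      obtain ⟨θ, a, b⟩ := h2 φ
      exact ⟨θ, a, by linarith⟩)
  have e := cv_td (fun x => -((c0 * Real.cos x + c1 * Real.sin x) * (-c0 * Real.sin x + c1 * Real.cos x))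
      + (-c0 * Real.sin x + c1 * Real.cos x) * (2 * p x - 2 * r))
    (fun x => (p x - (c0 * Real.cos x + c1 * Real.sin x) - r) ^ 2 - (p1 x - (-c0 * Real.sin x + c1 * Real.cos x)) ^ 2)
    (fun x => (p x ^ 2 - p1 x ^ 2) - 2 * r * p x + r ^ 2) 0 (2 * Real.pi) (by fun_prop) (by fun_prop)
    (fun x => (((he x).mul (he' x)).neg.add ((he' x).mul (((hp x).const_mul 2).sub_const (2 * r)))).congr_deriv (by ring))
    (by have := per 0; simp at this; simp [this])
  rw [intervalIntegral.integral_sub (by apply Continuous.intervalIntegrable; fun_prop) (by apply Continuous.intervalIntegrable; fun_prop),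
    intervalIntegral.integral_add (by apply Continuous.intervalIntegrable; fun_prop) (by apply Continuous.intervalIntegrable; fun_prop),
    intervalIntegral.integral_sub (by apply Continuous.intervalIntegrable; fun_prop) (by apply Continuous.intervalIntegrable; fun_prop),
    intervalIntegral.integral_const_mul, intervalIntegral.integral_const] at e
  simp only [smul_eq_mul] at e
  linarith

lemma cv_geom (p : ℝ → ℝ) (K : Set (EuclideanSpace ℝ (Fin 2)))
    (hK : K = {x | ∀ θ : ℝ, x 0 * Real.cos θ + x 1 * Real.sin θ ≤ p θ})
    (ρe ρi : ℝ)
    (hρe : ρe = sInf {r : ℝ | 0 ≤ r ∧ ∃ c, K ⊆ Metric.closedBall c r})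
    (hρi : ρi = sSup {r : ℝ | 0 ≤ r ∧ ∃ c, Metric.closedBall c r ⊆ K})
    (c0 c1 r d0 d1 R : ℝ) (h1 : ∀ θ, r + c0 * Real.cos θ + c1 * Real.sin θ ≤ p θ)
    (h2 : ∀ θ, p θ ≤ R + d0 * Real.cos θ + d1 * Real.sin θ) :
    (ρe - ρi) ^ 2 ≤ (R - r) ^ 2 := by
  have nrm : ∀ x : EuclideanSpace ℝ (Fin 2), ∀ s : ℝ, (∀ θ : ℝ, x 0 * Real.cos θ + x 1 * Real.sin θ ≤ s) → ‖x‖ ≤ s := by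
    intro x s h
    have := h (Complex.arg ⟨x 0, x 1⟩)
    have a1 := Complex.norm_mul_cos_arg ⟨x 0, x 1⟩
    have a2 := Complex.norm_mul_sin_arg ⟨x 0, x 1⟩
    have a3 : ‖x‖ = ‖(⟨x 0, x 1⟩ : ℂ)‖ := by
      rw [EuclideanSpace.norm_eq, Complex.norm_eq_sqrt_sq_add_sq, Fin.sum_univ_two]
      simp
    rw [a3]
    set n := ‖(⟨x 0, x 1⟩ : ℂ)‖
    set t := Complex.arg ⟨x 0, x 1⟩
    simp only at a1 a2
    have := Real.sin_sq_add_cos_sq t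
    calc n = n * Real.cos t * Real.cos t + n * Real.sin t * Real.sin t := by linear_combination (-n) * this
      _ ≤ s := by rw [a1, a2]; assumption
  have nrm' : ∀ x : EuclideanSpace ℝ (Fin 2), ∀ s : ℝ, ‖x‖ ≤ s → ∀ θ : ℝ, x 0 * Real.cos θ + x 1 * Real.sin θ ≤ s := by
    intro x s h θ
    rw [EuclideanSpace.norm_eq, Fin.sum_univ_two] at h
    refine le_trans ?_ h
    apply Real.le_sqrt_of_sq_le
    simp only [Real.norm_eq_abs, sq_abs]
    have := Real.sin_sq_add_cos_sq θ
    nlinarith [sq_nonneg (x 0 * Real.sin θ - x 1 * Real.cos θ)]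
  set Se := {r : ℝ | 0 ≤ r ∧ ∃ c, K ⊆ Metric.closedBall c r} with hSe
  set Si := {r : ℝ | 0 ≤ r ∧ ∃ c, Metric.closedBall c r ⊆ K} with hSi
  have bot : BddBelow Se := ⟨0, fun x hx => hx.1⟩
  rcases Set.eq_empty_or_nonempty K with hE | ⟨x, hx⟩
  · have e1 : ρe = 0 := by
      rw [hρe]
      apply le_antisymm
      · exact csInf_le bot ⟨le_rfl, 0, by simp [hE]⟩
      · exact Real.sInf_nonneg fun x hx => hx.1
    have e2 : ρi = 0 := by
      have : Si = ∅ := by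
        apply Set.eq_empty_of_forall_notMem
        rintro s ⟨hs, c, hc⟩
        rw [hE] at hc
        exact hc (Metric.mem_closedBall_self hs)
      rw [hρi, this, Real.sSup_empty]
    rw [e1, e2]; simpa using sq_nonneg (R - r)
  · have hRsub : K ⊆ Metric.closedBall !₂[d0, d1] R := by
      intro y hy
      rw [hK] at hy
      rw [mem_closedBall_iff_norm]
      apply nrm
      intro θ
      have := hy θ
      have := h2 θ
      simp
      linarith
    have hR0 : 0 ≤ R := Metric.nonempty_closedBall.1 ⟨x, hRsub hx⟩
    have hRS : R ∈ Se := ⟨hR0, _, hRsub⟩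
    have heR : ρe ≤ R := by rw [hρe]; exact csInf_le bot hRS
    have hst : ∀ s ∈ Si, ∀ t ∈ Se, s ≤ t := by
      rintro s ⟨hs, c, hc⟩ t ⟨ht, d, hd⟩
      have m1 : c + !₂[s, 0] ∈ Metric.closedBall c s := by
        rw [mem_closedBall_iff_norm, add_sub_cancel_left, EuclideanSpace.norm_eq]
        simp [Real.sqrt_sq hs]
      have m2 : c + !₂[-s, 0] ∈ Metric.closedBall c s := by
        rw [mem_closedBall_iff_norm, add_sub_cancel_left, EuclideanSpace.norm_eq]
        simp [Real.sqrt_sq hs]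
      have k1 := nrm' _ _ (mem_closedBall_iff_norm.1 (hd (hc m1))) 0
      have k2 := nrm' _ _ (mem_closedBall_iff_norm.1 (hd (hc m2))) Real.pi
      simp at k1 k2
      linarith
    have hiS : (0:ℝ) ∈ Si := ⟨le_rfl, x, by simpa using hx⟩
    have hie : ρi ≤ ρe := by
      rw [hρi, hρe]
      exact csSup_le ⟨0, hiS⟩ fun s hs => le_csInf ⟨R, hRS⟩ fun t ht => hst s hs t ht
    have hri : r ≤ ρi := by
      rw [hρi]
      have bdd : BddAbove Si := ⟨R, fun s hs => hst s hs R hRS⟩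
      rcases le_or_gt 0 r with h | h
      · refine le_csSup bdd ⟨h, !₂[c0, c1], ?_⟩
        intro y hy
        rw [hK]
        intro θ
        have := nrm' _ _ (mem_closedBall_iff_norm.1 hy) θ
        have := h1 θ
        simp at *
        linarith
      · exact h.le.trans (le_csSup bdd hiS)
    apply pow_le_pow_left₀ <;> linarith

lemma cv_bonnesen (p p1 : ℝ → ℝ) (hp : ∀ x, HasDerivAt p (p1 x) x) (hc : Continuous p1)
    (per : Function.Periodic p (2 * Real.pi)) (per1 : Function.Periodic p1 (2 * Real.pi))
    (K : Set (EuclideanSpace ℝ (Fin 2)))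
    (hK : K = {x | ∀ θ : ℝ, x 0 * Real.cos θ + x 1 * Real.sin θ ≤ p θ})
    (ρe ρi : ℝ)
    (hρe : ρe = sInf {r : ℝ | 0 ≤ r ∧ ∃ c, K ⊆ Metric.closedBall c r})
    (hρi : ρi = sSup {r : ℝ | 0 ≤ r ∧ ∃ c, Metric.closedBall c r ⊆ K}) :
    Real.pi ^ 2 * (ρe - ρi) ^ 2 ≤ (∫ x in (0:ℝ)..(2 * Real.pi), p x) ^ 2 - 
      2 * Real.pi * (∫ x in (0:ℝ)..(2 * Real.pi), (p x ^ 2 - p1 x ^ 2)) := by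
  obtain ⟨c0, c1, r, h1, h2⟩ := cv_D p p1 hp hc per per1
  obtain ⟨d0, d1, R, k1, k2⟩ := cv_D (fun x => - p x) (fun x => - p1 x) (fun x => (hp x).neg) hc.neg
    (fun x => by simp only [per x]) (fun x => by simp only [per1 x])
  have := cv_geom p K hK ρe ρi hρe hρi c0 c1 r (-d0) (-d1) (-R) h1 (fun θ => by linarith [k1 θ])
  simp only [neg_sq, intervalIntegral.integral_neg] at k2
  set L := ∫ x in (0:ℝ)..(2 * Real.pi), p x
  set A := ∫ x in (0:ℝ)..(2 * Real.pi), (p x ^ 2 - p1 x ^ 2)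
  have hpi := Real.pi_pos
  have a1 : (2 * Real.pi * r - L) ^ 2 ≤ L ^ 2 - 2 * Real.pi * A := by nlinarith
  have a2 : (-2 * Real.pi * R - L) ^ 2 ≤ L ^ 2 - 2 * Real.pi * A := by nlinarith
  have a3 : Real.pi ^ 2 * (-R - r) ^ 2 ≤ L ^ 2 - 2 * Real.pi * A := by
    nlinarith [sq_nonneg ((2 * Real.pi * r - L) + (-2 * Real.pi * R - L))]
  refine le_trans ?_ a3
  exact mul_le_mul_of_nonneg_left this (by positivity)

lemma cv_zero (f : ℝ → ℝ) (hc : Continuous f) (hp : Function.Periodic f (2 * Real.pi))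
    (h : ∫ x in (0:ℝ)..(2 * Real.pi), f x ^ 2 = 0) : ∀ x, f x = 0 := by
  intro x
  by_contra hx
  obtain ⟨y, hy, hy'⟩ := hp.exists_mem_Ico₀ (by positivity) x
  rw [hy'] at hx
  have := intervalIntegral.integral_pos (a := 0) (b := 2 * Real.pi) (f := fun x => f x ^ 2) (by positivity) (by fun_prop)
    (fun x _ => sq_nonneg _) ⟨y, ⟨hy.1, hy.2.le⟩, by positivity⟩
  linarith

lemma cv_lin (q0 q1 q2 q3 : ℝ → ℝ) (h0 : Continuous q0) (h1 : Continuous q1) (h2 : Continuous q2) (h3 : Continuous q3)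
    (c kq k0 k1 k2 k3 : ℝ) :
    ∫ x in (0:ℝ)..(2 * Real.pi), (c + kq * q0 x + k0 * q0 x ^ 2 + k1 * q1 x ^ 2 + k2 * q2 x ^ 2 + k3 * q3 x ^ 2)
     = 2 * Real.pi * c + kq * (∫ x in (0:ℝ)..(2 * Real.pi), q0 x) + k0 * (∫ x in (0:ℝ)..(2 * Real.pi), q0 x ^ 2)
      + k1 * (∫ x in (0:ℝ)..(2 * Real.pi), q1 x ^ 2) + k2 * (∫ x in (0:ℝ)..(2 * Real.pi), q2 x ^ 2)
      + k3 * (∫ x in (0:ℝ)..(2 * Real.pi), q3 x ^ 2) := by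
  rw [intervalIntegral.integral_add (by apply Continuous.intervalIntegrable; fun_prop) (by apply Continuous.intervalIntegrable; fun_prop),
    intervalIntegral.integral_add (by apply Continuous.intervalIntegrable; fun_prop) (by apply Continuous.intervalIntegrable; fun_prop),
    intervalIntegral.integral_add (by apply Continuous.intervalIntegrable; fun_prop) (by apply Continuous.intervalIntegrable; fun_prop),
    intervalIntegral.integral_add (by apply Continuous.intervalIntegrable; fun_prop) (by apply Continuous.intervalIntegrable; fun_prop),
    intervalIntegral.integral_add (by apply Continuous.intervalIntegrable; fun_prop) (by apply Continuous.intervalIntegrable; fun_prop)]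
  simp only [intervalIntegral.integral_const_mul, intervalIntegral.integral_const, smul_eq_mul, sub_zero]

lemma cv_mode2 (q0 q1 q2 : ℝ → ℝ) (hq0 : ∀ x, HasDerivAt q0 (q1 x) x) (hq1 : ∀ x, HasDerivAt q1 (q2 x) x)
    (hc2 : Continuous q2) (per0 : Function.Periodic q0 (2 * Real.pi)) (per1 : Function.Periodic q1 (2 * Real.pi))
    (per2 : Function.Periodic q2 (2 * Real.pi))
    (I0 I1 I2 : ℝ) (d0 : I0 = ∫ x in (0:ℝ)..(2 * Real.pi), q0 x ^ 2)
    (d1 : I1 = ∫ x in (0:ℝ)..(2 * Real.pi), q1 x ^ 2)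
    (d2 : I2 = ∫ x in (0:ℝ)..(2 * Real.pi), q2 x ^ 2)
    (h1 : I1 - 4 * I0 = 0) (h2 : I2 - 8 * I1 + 16 * I0 = 0) : ∀ x, q0 x ^ 2 ≤ I0 / Real.pi := by
  have c0 : Continuous q0 := continuous_iff_continuousAt.2 fun x => (hq0 x).continuousAt
  have c1 : Continuous q1 := continuous_iff_continuousAt.2 fun x => (hq1 x).continuousAt
  have hpi := Real.pi_pos
  have b0 : q0 (2 * Real.pi) = q0 0 := by simpa using per0 0
  have b1 : q1 (2 * Real.pi) = q1 0 := by simpa using per1 0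
  have e := cv_td (fun x => 8 * (q0 x * q1 x)) (fun x => (q2 x + 4 * q0 x) ^ 2)
    (fun x => 0 + 0 * q0 x + 16 * q0 x ^ 2 + (-8) * q1 x ^ 2 + 1 * q2 x ^ 2 + 0 * q2 x ^ 2) 0 (2 * Real.pi) (by fun_prop) (by fun_prop)
    (fun x => (((hq0 x).mul (hq1 x)).const_mul 8).congr_deriv (by ring)) (by simp only [b0, b1])
  rw [cv_lin q0 q1 q2 q2 c0 c1 hc2 hc2, ← d0, ← d1, ← d2] at e
  have z := cv_zero (fun x => q2 x + 4 * q0 x) (by fun_prop) (fun x => by simp only [per0 x, per2 x])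
    (by rw [e]; linarith)
  have hd : ∀ x, HasDerivAt (fun x => q0 x ^ 2 + q1 x ^ 2 / 4) 0 x := fun x =>
    (((hq0 x).fun_pow 2).add (((hq1 x).fun_pow 2).div_const 4)).congr_deriv (by
      have := z x
      push_cast
      linear_combination (q1 x / 2) * this)
  have hcst := is_const_of_deriv_eq_zero (fun x => (hd x).differentiableAt) (fun x => (hd x).deriv)
  intro x
  have l := cv_lin q0 q1 q2 q2 c0 c1 hc2 hc2 0 0 1 (1/4) 0 0
  have l2 : ∫ y in (0:ℝ)..(2 * Real.pi), (0 + 0 * q0 y + 1 * q0 y ^ 2 + (1/4) * q1 y ^ 2 + 0 * q2 y ^ 2 + 0 * q2 y ^ 2)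
     = ∫ y in (0:ℝ)..(2 * Real.pi), (q0 x ^ 2 + q1 x ^ 2 / 4) := by
    congr 1; funext y
    have : q0 x ^ 2 + q1 x ^ 2 / 4 = q0 y ^ 2 + q1 y ^ 2 / 4 := hcst x y
    linarith
  rw [l2, intervalIntegral.integral_const, ← d0, ← d1, ← d2] at l
  simp only [smul_eq_mul, sub_zero] at l
  rw [le_div_iff₀ hpi]
  nlinarith [sq_nonneg (q1 x)]

set_option maxHeartbeats 4000000 in
lemma cv_core (p p1 p2 p3 : ℝ → ℝ) (hp0 : ∀ x, HasDerivAt p (p1 x) x) (hp1 : ∀ x, HasDerivAt p1 (p2 x) x)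
    (hp2 : ∀ x, HasDerivAt p2 (p3 x) x) (cp3 : Continuous p3)
    (per0 : Function.Periodic p (2 * Real.pi)) (per1 : Function.Periodic p1 (2 * Real.pi))
    (per2 : Function.Periodic p2 (2 * Real.pi))
    (hρpos : ∀ θ : ℝ, 0 < p θ + p2 θ)
    (L A : ℝ)
    (hL : L = ∫ θ in (0:ℝ)..(2 * Real.pi), (p θ + p2 θ))
    (hA : A = (1 / 2) * ∫ θ in (0:ℝ)..(2 * Real.pi), (p θ ^ 2 - p1 θ ^ 2))
    (Atilde : ℝ)
    (hAt : Atilde = (1 / 2) * ∫ θ in (0:ℝ)..(2 * Real.pi), (p1 θ ^ 2 - p2 θ ^ 2))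
    (ρM ρm : ℝ) (hρM : ∀ θ ∈ Set.Icc (0:ℝ) (2 * Real.pi), p θ + p2 θ ≤ ρM)
    (hρm : ∀ θ ∈ Set.Icc (0:ℝ) (2 * Real.pi), ρm ≤ p θ + p2 θ)
    (K : Set (EuclideanSpace ℝ (Fin 2)))
    (hK : K = {x | ∀ θ : ℝ, x 0 * Real.cos θ + x 1 * Real.sin θ ≤ p θ})
    (ρe ρi : ℝ)
    (hρe : ρe = sInf {r : ℝ | 0 ≤ r ∧ ∃ c, K ⊆ Metric.closedBall c r})
    (hρi : ρi = sSup {r : ℝ | 0 ≤ r ∧ ∃ c, Metric.closedBall c r ⊆ K})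
    (cx cy : ℝ)
    (hcx : cx = (1 / Real.pi) * ∫ θ in (0:ℝ)..(2 * Real.pi), p θ * Real.cos θ)
    (hcy : cy = (1 / Real.pi) * ∫ θ in (0:ℝ)..(2 * Real.pi), p θ * Real.sin θ)
    (α δ μ σ η lam ξ ζ : ℝ)
    (W : ℝ)
    (hW : W = α * (∫ θ in (0:ℝ)..(2 * Real.pi), (p θ + p2 θ) ^ 2) + δ * L ^ 2 + μ * A + σ * |Atilde|
      + η * (∫ θ in (0:ℝ)..(2 * Real.pi), (p1 θ + p3 θ) ^ 2) + lam * (ρe - ρi) ^ 2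
      + ξ * (ρM - ρm) ^ 2 + ζ * (∫ θ in (0:ℝ)..(2 * Real.pi), (p θ + p2 θ)⁻¹))
    (hη : 0 ≤ η) (hξ : 0 ≤ ξ) (hζ : 0 ≤ ζ) (hlam : lam ≤ 0)
    (hc1 : 0 ≤ 2 * α + 4 * Real.pi * δ + μ - 4 * ζ)
    (hc2 : 0 ≤ 2 * α + σ - 2 * η - 4 * ζ)
    (D : ℝ) (hDd : D = (6 * Real.pi * α - Real.pi * μ + 4 * Real.pi * σ + 24 * Real.pi * η + 4 * lam + 4 * ξ - 12 * Real.pi * ζ))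
    (hD : 0 < D)
    (hnz : 0 < lam ^ 2 + ξ ^ 2 + ζ ^ 2)
    (heq : (∫ θ in (0:ℝ)..(2 * Real.pi), (p θ - (L / (2 * Real.pi) + (cx * Real.cos θ + cy * Real.sin θ))) ^ 2)
      = (2 * Real.pi / (3 * D)) * W) :
    ∀ θ, p θ = L / (2 * Real.pi) + (cx * Real.cos θ + cy * Real.sin θ) := by
  have hpi := Real.pi_pos
  have cp0 : Continuous p := continuous_iff_continuousAt.2 fun x => (hp0 x).continuousAt
  have cp1 : Continuous p1 := continuous_iff_continuousAt.2 fun x => (hp1 x).continuousAt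
  have cp2 : Continuous p2 := continuous_iff_continuousAt.2 fun x => (hp2 x).continuousAt
  have b1 : p1 (2 * Real.pi) = p1 0 := by simpa using per1 0
  have b0 : p (2 * Real.pi) = p 0 := by simpa using per0 0
  have b2 : p2 (2 * Real.pi) = p2 0 := by simpa using per2 0
  set a := L / (2 * Real.pi) with ha
  have haL : L = 2 * Real.pi * a := by rw [ha]; field_simp
  have hLp : L = ∫ θ in (0:ℝ)..(2 * Real.pi), p θ := by
    rw [hL]
    exact cv_td p1 _ _ 0 (2 * Real.pi) (by fun_prop) cp0 (fun x => (hp1 x).congr_deriv (by ring)) b1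
  obtain ⟨e, hedef⟩ : ∃ e : ℝ → ℝ, e = fun x => cx * Real.cos x + cy * Real.sin x := ⟨_, rfl⟩
  obtain ⟨e', hedef'⟩ : ∃ e : ℝ → ℝ, e = fun x => -cx * Real.sin x + cy * Real.cos x := ⟨_, rfl⟩
  have he : ∀ x, HasDerivAt e (e' x) x := by
    intro x
    rw [hedef, hedef']
    exact (((Real.hasDerivAt_cos x).const_mul cx).add ((Real.hasDerivAt_sin x).const_mul cy)).congr_deriv (by ring)
  have he' : ∀ x, HasDerivAt e' (-e x) x := by
    intro x
    rw [hedef, hedef']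
    exact (((Real.hasDerivAt_sin x).const_mul (-cx)).add ((Real.hasDerivAt_cos x).const_mul cy)).congr_deriv (by ring)
  have ce : Continuous e := by rw [hedef]; fun_prop
  have ce' : Continuous e' := by rw [hedef']; fun_prop
  have pe : Function.Periodic e (2 * Real.pi) := fun x => by simp only [hedef, Real.cos_add_two_pi, Real.sin_add_two_pi]
  have pe' : Function.Periodic e' (2 * Real.pi) := fun x => by simp only [hedef', Real.cos_add_two_pi, Real.sin_add_two_pi]
  have be : e (2 * Real.pi) = e 0 := by simpa using pe 0
  have be' : e' (2 * Real.pi) = e' 0 := by simpa using pe' 0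
  have hee : ∀ x, cx * Real.cos x + cy * Real.sin x = e x := fun x => by rw [hedef]
  simp only [hee] at heq ⊢
  obtain ⟨q0, hq0d⟩ : ∃ q : ℝ → ℝ, q = fun x => p x - a - e x := ⟨_, rfl⟩
  obtain ⟨q1, hq1d⟩ : ∃ q : ℝ → ℝ, q = fun x => p1 x - e' x := ⟨_, rfl⟩
  obtain ⟨q2, hq2d⟩ : ∃ q : ℝ → ℝ, q = fun x => p2 x + e x := ⟨_, rfl⟩
  obtain ⟨q3, hq3d⟩ : ∃ q : ℝ → ℝ, q = fun x => p3 x + e' x := ⟨_, rfl⟩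
  have hq0 : ∀ x, HasDerivAt q0 (q1 x) x := fun x => by
    rw [hq0d, hq1d]; exact ((hp0 x).sub_const a).sub (he x)
  have hq1 : ∀ x, HasDerivAt q1 (q2 x) x := fun x => by
    rw [hq1d, hq2d]; exact ((hp1 x).sub (he' x)).congr_deriv (by ring)
  have hq2 : ∀ x, HasDerivAt q2 (q3 x) x := fun x => by
    rw [hq2d, hq3d]; exact (hp2 x).add (he x)
  have cq0 : Continuous q0 := by rw [hq0d]; fun_prop
  have cq1 : Continuous q1 := by rw [hq1d]; fun_prop
  have cq2 : Continuous q2 := by rw [hq2d]; fun_prop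
  have cq3 : Continuous q3 := by rw [hq3d]; fun_prop
  have pq0 : Function.Periodic q0 (2 * Real.pi) := fun x => by simp only [hq0d, per0 x, pe x]
  have pq1 : Function.Periodic q1 (2 * Real.pi) := fun x => by simp only [hq1d, per1 x, pe' x]
  have pq2 : Function.Periodic q2 (2 * Real.pi) := fun x => by simp only [hq2d, per2 x, pe x]
  have bq0 : q0 (2 * Real.pi) = q0 0 := by simpa using pq0 0
  have bq1 : q1 (2 * Real.pi) = q1 0 := by simpa using pq1 0
  have bq2 : q2 (2 * Real.pi) = q2 0 := by simpa using pq2 0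
  have ep0 : ∀ x, p x = a + e x + q0 x := fun x => by rw [hq0d]; ring
  have ep1 : ∀ x, p1 x = e' x + q1 x := fun x => by rw [hq1d]; ring
  have ep2 : ∀ x, p2 x = - e x + q2 x := fun x => by rw [hq2d]; ring
  have ep3 : ∀ x, p3 x = - e' x + q3 x := fun x => by rw [hq3d]; ring
  -- orthogonality
  have o0 : ∫ x in (0:ℝ)..(2 * Real.pi), q0 x = 0 := by
    have := cv_td e' q0 (fun x => p x - a) 0 (2 * Real.pi) cq0 (by fun_prop)
      (fun x => (he' x).congr_deriv (by rw [ep0]; ring)) be'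
    rw [this, intervalIntegral.integral_sub (cp0.intervalIntegrable _ _) (by apply Continuous.intervalIntegrable; fun_prop), ← hLp,
      intervalIntegral.integral_const, smul_eq_mul, haL]
    ring
  have o1 : ∫ x in (0:ℝ)..(2 * Real.pi), q0 x * Real.cos x = 0 := by
    have := cv_td (fun x => -(a * Real.sin x + cx / 2 * (Real.sin x * Real.cos x) + cy / 2 * Real.sin x ^ 2))
      (fun x => q0 x * Real.cos x) (fun x => p x * Real.cos x - cx / 2) 0 (2 * Real.pi) (by fun_prop) (by fun_prop)
      (fun x => ((((Real.hasDerivAt_sin x).const_mul a).add (((Real.hasDerivAt_sin x).mul (Real.hasDerivAt_cos x)).const_mul (cx/2))).add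
        (((Real.hasDerivAt_sin x).fun_pow 2).const_mul (cy/2))).neg.congr_deriv (by
          rw [ep0, ← hee]
          push_cast
          linear_combination (cx/2) * Real.sin_sq_add_cos_sq x)) (by simp)
    rw [this, intervalIntegral.integral_sub (by apply Continuous.intervalIntegrable; fun_prop) (by apply Continuous.intervalIntegrable; fun_prop),
      intervalIntegral.integral_const, smul_eq_mul, hcx]
    field_simp
    ring
  have o2 : ∫ x in (0:ℝ)..(2 * Real.pi), q0 x * Real.sin x = 0 := by
    have := cv_td (fun x => -(-a * Real.cos x + cx / 2 * Real.sin x ^ 2 - cy / 2 * (Real.sin x * Real.cos x)))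
      (fun x => q0 x * Real.sin x) (fun x => p x * Real.sin x - cy / 2) 0 (2 * Real.pi) (by fun_prop) (by fun_prop)
      (fun x => ((((Real.hasDerivAt_cos x).const_mul (-a)).add (((Real.hasDerivAt_sin x).fun_pow 2).const_mul (cx/2))).sub
        (((Real.hasDerivAt_sin x).mul (Real.hasDerivAt_cos x)).const_mul (cy/2))).neg.congr_deriv (by
          rw [ep0, ← hee]
          push_cast
          linear_combination (cy/2) * Real.sin_sq_add_cos_sq x)) (by simp)
    rw [this, intervalIntegral.integral_sub (by apply Continuous.intervalIntegrable; fun_prop) (by apply Continuous.intervalIntegrable; fun_prop),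
      intervalIntegral.integral_const, smul_eq_mul, hcy]
    field_simp
    ring
  obtain ⟨I0, d0⟩ : ∃ I, I = ∫ x in (0:ℝ)..(2 * Real.pi), q0 x ^ 2 := ⟨_, rfl⟩
  obtain ⟨I1, d1⟩ : ∃ I, I = ∫ x in (0:ℝ)..(2 * Real.pi), q1 x ^ 2 := ⟨_, rfl⟩
  obtain ⟨I2, d2⟩ : ∃ I, I = ∫ x in (0:ℝ)..(2 * Real.pi), q2 x ^ 2 := ⟨_, rfl⟩
  obtain ⟨I3, d3⟩ : ∃ I, I = ∫ x in (0:ℝ)..(2 * Real.pi), q3 x ^ 2 := ⟨_, rfl⟩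
  have I0n : 0 ≤ I0 := by
    rw [d0]; exact intervalIntegral.integral_nonneg (by positivity) fun x _ => sq_nonneg _
  obtain ⟨f1, f2, f3, f4, f5⟩ := cv_fourier q0 q1 q2 q3 hq0 hq1 hq2 cq3 bq0 bq1 bq2 o0 o1 o2 I0 I1 I2 I3 d0 d1 d2 d3
  have lin := cv_lin q0 q1 q2 q3 cq0 cq1 cq2 cq3
  simp only [← d0, ← d1, ← d2, ← d3, o0] at lin
  -- integrals
  have J1 : ∫ θ in (0:ℝ)..(2 * Real.pi), (p θ + p2 θ) ^ 2 = 2 * Real.pi * a ^ 2 + (I0 - 2 * I1 + I2) := by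
    have := cv_td (fun x => 2 * a * q1 x + 2 * (q0 x * q1 x)) (fun θ => (p θ + p2 θ) ^ 2)
      (fun x => a ^ 2 + (2 * a) * q0 x + 1 * q0 x ^ 2 + (-2) * q1 x ^ 2 + 1 * q2 x ^ 2 + 0 * q3 x ^ 2) 0 (2 * Real.pi)
      (by fun_prop) (by fun_prop)
      (fun x => (((hq1 x).const_mul (2 * a)).add (((hq0 x).mul (hq1 x)).const_mul 2)).congr_deriv (by rw [ep0, ep2]; ring))
      (by simp only [bq0, bq1])
    rw [this, lin]; ring
  have J2 : ∫ θ in (0:ℝ)..(2 * Real.pi), (p θ ^ 2 - p1 θ ^ 2) = 2 * Real.pi * a ^ 2 + (I0 - I1) := by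
    have := cv_td (fun x => -(2 * a) * e' x - e x * e' x - 2 * (e' x * q0 x)) (fun θ => (p θ ^ 2 - p1 θ ^ 2))
      (fun x => a ^ 2 + (2 * a) * q0 x + 1 * q0 x ^ 2 + (-1) * q1 x ^ 2 + 0 * q2 x ^ 2 + 0 * q3 x ^ 2) 0 (2 * Real.pi)
      (by fun_prop) (by fun_prop)
      (fun x => ((((he' x).const_mul (-(2 * a))).sub ((he x).mul (he' x))).sub (((he' x).mul (hq0 x)).const_mul 2)).congr_deriv (by rw [ep0, ep1]; ring))
      (by simp only [bq0, be, be'])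
    rw [this, lin]; ring
  have J3 : ∫ θ in (0:ℝ)..(2 * Real.pi), (p1 θ ^ 2 - p2 θ ^ 2) = I1 - I2 := by
    have := cv_td (fun x => e x * e' x + 2 * (e x * q1 x)) (fun θ => (p1 θ ^ 2 - p2 θ ^ 2))
      (fun x => 0 + 0 * q0 x + 0 * q0 x ^ 2 + 1 * q1 x ^ 2 + (-1) * q2 x ^ 2 + 0 * q3 x ^ 2) 0 (2 * Real.pi)
      (by fun_prop) (by fun_prop)
      (fun x => (((he x).mul (he' x)).add (((he x).mul (hq1 x)).const_mul 2)).congr_deriv (by rw [ep1, ep2]; ring))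
      (by simp only [bq1, be, be'])
    rw [this, lin]; ring
  have J4 : ∫ θ in (0:ℝ)..(2 * Real.pi), (p1 θ + p3 θ) ^ 2 = I1 - 2 * I2 + I3 := by
    have := cv_td (fun x => 2 * (q1 x * q2 x)) (fun θ => (p1 θ + p3 θ) ^ 2)
      (fun x => 0 + 0 * q0 x + 0 * q0 x ^ 2 + 1 * q1 x ^ 2 + (-2) * q2 x ^ 2 + 1 * q3 x ^ 2) 0 (2 * Real.pi)
      (by fun_prop) (by fun_prop)
      (fun x => (((hq1 x).mul (hq2 x)).const_mul 2).congr_deriv (by rw [ep1, ep3]; ring))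
      (by simp only [bq1, bq2])
    rw [this, lin]; ring
  have J5 : (∫ θ in (0:ℝ)..(2 * Real.pi), (p θ - (a + e θ)) ^ 2) = I0 := by
    rw [d0]; congr 1; funext x; rw [ep0]; ring
  -- Popoviciu
  have Y : I0 - 2 * I1 + I2 ≤ Real.pi / 2 * (ρM - ρm) ^ 2 := by
    have h0 : 0 ≤ ∫ θ in (0:ℝ)..(2 * Real.pi), ((ρM - (p θ + p2 θ)) * ((p θ + p2 θ) - ρm)) :=
      intervalIntegral.integral_nonneg (by positivity) fun x hx => mul_nonneg (by linarith [hρM x hx]) (by linarith [hρm x hx])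
    have h1 : ∫ θ in (0:ℝ)..(2 * Real.pi), ((ρM - (p θ + p2 θ)) * ((p θ + p2 θ) - ρm))
        = ∫ θ in (0:ℝ)..(2 * Real.pi), (((ρM + ρm) * (p θ + p2 θ) - (p θ + p2 θ) ^ 2) - ρM * ρm) := by
      congr 1; funext x; ring
    rw [h1, intervalIntegral.integral_sub (by apply Continuous.intervalIntegrable; fun_prop) (by apply Continuous.intervalIntegrable; fun_prop),
      intervalIntegral.integral_sub (by apply Continuous.intervalIntegrable; fun_prop) (by apply Continuous.intervalIntegrable; fun_prop),
      intervalIntegral.integral_const_mul, intervalIntegral.integral_const, J1, ← hL, haL, smul_eq_mul] at h0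
    linarith [mul_nonneg hpi.le (sq_nonneg (ρM + ρm - 2 * a))]
  -- positivity of the reciprocal term
  have Z : 0 < ∫ θ in (0:ℝ)..(2 * Real.pi), (p θ + p2 θ)⁻¹ := by
    apply intervalIntegral.intervalIntegral_pos_of_pos
    · apply Continuous.intervalIntegrable
      exact (cp0.add cp2).inv₀ fun x => (hρpos x).ne'
    · intro x; exact inv_pos.2 (hρpos x)
    · positivity
  have J1n : 0 ≤ 2 * Real.pi * a ^ 2 + (I0 - 2 * I1 + I2) := by
    rw [← J1]; exact intervalIntegral.integral_nonneg (by positivity) fun x _ => sq_nonneg _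
  -- Bonnesen
  have X := cv_bonnesen p p1 hp0 cp1 per0 per1 K hK ρe ρi hρe hρi
  rw [← hLp, J2, haL] at X
  have X' : Real.pi * (ρe - ρi) ^ 2 ≤ 2 * (I1 - I0) := by
    have : Real.pi * (Real.pi * (ρe - ρi) ^ 2) ≤ Real.pi * (2 * (I1 - I0)) := by linarith
    exact le_of_mul_le_mul_left this hpi
  have hAt' : |Atilde| = (I2 - I1) / 2 := by
    rw [hAt, J3, abs_of_nonpos (by linarith)]; ring
  rw [J5] at heq
  rw [J1, J4, hAt', hA, J2, haL] at hW
  have hWI : 3 * D * I0 = 2 * Real.pi * W := by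
    rw [heq]; field_simp
  set Zi := ∫ θ in (0:ℝ)..(2 * Real.pi), (p θ + p2 θ)⁻¹ with hZi
  have t1 : 0 ≤ D * (I1 - 4 * I0) := mul_nonneg hD.le f1
  have t2 : 0 ≤ 2 * Real.pi ^ 2 * (2 * α + 4 * Real.pi * δ + μ - 4 * ζ) * a ^ 2 := by positivity
  have t3 : 0 ≤ Real.pi * (2 * α + σ - 2 * η - 4 * ζ) * (I2 - 5 * I1 + 4 * I0) := by positivity
  have t4 : 0 ≤ 2 * Real.pi * η * ((I3 - 2 * I2 - 11 * I1 + 12 * I0) + (I2 - 5 * I1 + 4 * I0)) := by positivity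
  have t5 : 0 ≤ 2 * (-lam) * (2 * (I1 - I0) - Real.pi * (ρe - ρi) ^ 2) :=
    mul_nonneg (by linarith) (by linarith)
  have t6 : 0 ≤ 2 * ξ * (Real.pi * (ρM - ρm) ^ 2 - 2 * (I1 - I0)) := mul_nonneg (by linarith) (by linarith)
  have t7 : 0 ≤ 2 * Real.pi * ζ * (Zi + 2 * (2 * Real.pi * a ^ 2 + (I0 - 2 * I1 + I2))) := by positivity
  have tot : D * (I1 - 4 * I0) + 2 * Real.pi ^ 2 * (2 * α + 4 * Real.pi * δ + μ - 4 * ζ) * a ^ 2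
     + Real.pi * (2 * α + σ - 2 * η - 4 * ζ) * (I2 - 5 * I1 + 4 * I0)
     + 2 * Real.pi * η * ((I3 - 2 * I2 - 11 * I1 + 12 * I0) + (I2 - 5 * I1 + 4 * I0))
     + 2 * (-lam) * (2 * (I1 - I0) - Real.pi * (ρe - ρi) ^ 2)
     + 2 * ξ * (Real.pi * (ρM - ρm) ^ 2 - 2 * (I1 - I0))
     + 2 * Real.pi * ζ * (Zi + 2 * (2 * Real.pi * a ^ 2 + (I0 - 2 * I1 + I2))) = 0 := by
    rw [hW] at hWI
    rw [hDd] at hWI ⊢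
    linear_combination -hWI
  have z1 : D * (I1 - 4 * I0) = 0 := by linarith
  have z5 : 2 * (-lam) * (2 * (I1 - I0) - Real.pi * (ρe - ρi) ^ 2) = 0 := by linarith
  have z6 : 2 * ξ * (Real.pi * (ρM - ρm) ^ 2 - 2 * (I1 - I0)) = 0 := by linarith
  have z7 : 2 * Real.pi * ζ * (Zi + 2 * (2 * Real.pi * a ^ 2 + (I0 - 2 * I1 + I2))) = 0 := by linarith
  have z1' : I1 - 4 * I0 = 0 := (mul_eq_zero.1 z1).resolve_left hD.ne'
  have hI0 : I0 = 0 := by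
    by_cases hζ0 : ζ = 0
    · by_cases hξ0 : ξ = 0
      · have hl0 : lam ≠ 0 := by
          rintro rfl
          simp [hζ0, hξ0] at hnz
        have z5' := (mul_eq_zero.1 z5).resolve_left (by simpa using hl0)
        have hm := cv_mode2 q0 q1 q2 hq0 hq1 cq2 pq0 pq1 pq2 I0 I1 I2 d0 d1 d2 z1' (f5 z1')
        have hab : ∀ x, |q0 x| ≤ √(I0 / Real.pi) := fun x => Real.abs_le_sqrt (hm x)
        have := cv_geom p K hK ρe ρi hρe hρi cx cy (a - √(I0 / Real.pi)) cx cy (a + √(I0 / Real.pi))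
          (fun θ => by
            have := (abs_le.1 (hab θ)).1
            rw [ep0, ← hee]; linarith)
          (fun θ => by
            have := (abs_le.1 (hab θ)).2
            rw [ep0, ← hee]; linarith)
        have hs : √(I0 / Real.pi) ^ 2 = I0 / Real.pi := Real.sq_sqrt (by positivity)
        have h4 : (ρe - ρi) ^ 2 ≤ 4 * (I0 / Real.pi) := by rw [← hs]; linarith
        have h5 : Real.pi * (ρe - ρi) ^ 2 ≤ 4 * I0 := by
          calc Real.pi * (ρe - ρi) ^ 2 ≤ Real.pi * (4 * (I0 / Real.pi)) := mul_le_mul_of_nonneg_left h4 hpi.le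
            _ = 4 * I0 := by field_simp
        linarith
      · have := (mul_eq_zero.1 z6).resolve_left (by simpa using hξ0)
        linarith
    · exfalso
      have : 0 < ζ := lt_of_le_of_ne hζ (Ne.symm hζ0)
      have : 0 < 2 * Real.pi * ζ * (Zi + 2 * (2 * Real.pi * a ^ 2 + (I0 - 2 * I1 + I2))) := by positivity
      linarith
  have hz := cv_zero q0 cq0 pq0 (by rw [← d0, hI0])
  intro θ
  rw [ep0, hz θ, add_zero]

theorem stmt7
    (p : ℝ → ℝ)
    (hp : ContDiff ℝ (⊤ : ℕ∞) p)
    (hper : ∀ θ : ℝ, p (θ + 2 * Real.pi) = p θ)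
    (ρ : ℝ → ℝ)
    (hρdef : ρ = fun θ => p θ + iteratedDeriv 2 p θ)
    (hρpos : ∀ θ : ℝ, 0 < ρ θ)
    (L A : ℝ)
    (hL : L = ∫ θ in (0:ℝ)..(2 * Real.pi), ρ θ)
    (hA : A = (1 / 2) * ∫ θ in (0:ℝ)..(2 * Real.pi), (p θ ^ 2 - deriv p θ ^ 2))
    (Atilde : ℝ)
    (hAt : Atilde = (1 / 2) * ∫ θ in (0:ℝ)..(2 * Real.pi), (deriv p θ ^ 2 - iteratedDeriv 2 p θ ^ 2))
    (ρβ : ℝ → ℝ)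
    (hρβ : ρβ = fun θ => |deriv p θ + iteratedDeriv 3 p θ|)
    (ρM ρm : ℝ)
    (hρM : ρM = sSup (ρ '' Set.Icc (0:ℝ) (2 * Real.pi)))
    (hρm : ρm = sInf (ρ '' Set.Icc (0:ℝ) (2 * Real.pi)))
    (K : Set (EuclideanSpace ℝ (Fin 2)))
    (hK : K = {x | ∀ θ : ℝ, x 0 * Real.cos θ + x 1 * Real.sin θ ≤ p θ})
    (ρe ρi : ℝ)
    (hρe : ρe = sInf {r : ℝ | 0 ≤ r ∧ ∃ c, K ⊆ Metric.closedBall c r})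
    (hρi : ρi = sSup {r : ℝ | 0 ≤ r ∧ ∃ c, Metric.closedBall c r ⊆ K})
    (cx cy : ℝ)
    (hcx : cx = (1 / Real.pi) * ∫ θ in (0:ℝ)..(2 * Real.pi), p θ * Real.cos θ)
    (hcy : cy = (1 / Real.pi) * ∫ θ in (0:ℝ)..(2 * Real.pi), p θ * Real.sin θ)
    (pS : ℝ → ℝ)
    (hpS : pS = fun θ => L / (2 * Real.pi) + cx * Real.cos θ + cy * Real.sin θ)
    (α δ μ σ η lam ξ ζ : ℝ)
    (W : ℝ)
    (hW : W = α * (∫ θ in (0:ℝ)..(2 * Real.pi), ρ θ ^ 2) + δ * L ^ 2 + μ * A + σ * |Atilde|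
      + η * (∫ θ in (0:ℝ)..(2 * Real.pi), ρβ θ ^ 2) + lam * (ρe - ρi) ^ 2
      + ξ * (ρM - ρm) ^ 2 + ζ * (∫ θ in (0:ℝ)..(2 * Real.pi), (ρ θ)⁻¹))
    (hη : 0 ≤ η) (hξ : 0 ≤ ξ) (hζ : 0 ≤ ζ) (hlam : lam ≤ 0)
    (hc1 : 0 ≤ 2 * α + 4 * Real.pi * δ + μ - 4 * ζ)
    (hc2 : 0 ≤ 2 * α + σ - 2 * η - 4 * ζ)
    (hD : 0 < (6 * Real.pi * α - Real.pi * μ + 4 * Real.pi * σ + 24 * Real.pi * η + 4 * lam + 4 * ξ - 12 * Real.pi * ζ))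
    (hnz : 0 < lam ^ 2 + ξ ^ 2 + ζ ^ 2)
    (heq : (∫ θ in (0:ℝ)..(2 * Real.pi), |p θ - pS θ| ^ 2)
      = (2 * Real.pi / (3 * (6 * Real.pi * α - Real.pi * μ + 4 * Real.pi * σ + 24 * Real.pi * η + 4 * lam + 4 * ξ - 12 * Real.pi * ζ))) * W) :
    ∃ a₀ a₁ b₁ : ℝ, ∀ θ : ℝ, p θ = a₀ + a₁ * Real.cos θ + b₁ * Real.sin θ := by
  have hs : ∀ n : ℕ, ∀ x, HasDerivAt (iteratedDeriv n p) (iteratedDeriv (n + 1) p x) x := by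
    intro n x
    rw [iteratedDeriv_succ]
    have : Differentiable ℝ (iteratedDeriv n p) :=
      hp.differentiable_iteratedDeriv n (by exact_mod_cast WithTop.coe_lt_top n)
    exact (this x).hasDerivAt
  have hcn : ∀ n : ℕ, Continuous (iteratedDeriv n p) := fun n =>
    continuous_iff_continuousAt.2 fun x => (hs n x).continuousAt
  have hpn : ∀ n : ℕ, Function.Periodic (iteratedDeriv n p) (2 * Real.pi) := by
    intro n
    induction n with
    | zero => intro x; simpa using hper x
    | succ n ih =>
      intro x
      rw [iteratedDeriv_succ, ← deriv_comp_add_const]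
      congr 1
      funext y
      exact ih y
  have h0 : ∀ x, HasDerivAt p (deriv p x) x := fun x => by simpa using hs 0 x
  have h1 : ∀ x, HasDerivAt (deriv p) (iteratedDeriv 2 p x) x := fun x => by simpa using hs 1 x
  have per1 : Function.Periodic (deriv p) (2 * Real.pi) := by simpa using hpn 1
  subst hρdef
  have cρ : Continuous (fun θ => p θ + iteratedDeriv 2 p θ) := hp.continuous.add (hcn 2)
  have hcomp := (isCompact_Icc (a := (0:ℝ)) (b := 2 * Real.pi)).image cρ
  have e1 : ∀ θ, |p θ - pS θ| ^ 2 = (p θ - (L / (2 * Real.pi) + (cx * Real.cos θ + cy * Real.sin θ))) ^ 2 := by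
    intro θ; rw [sq_abs, hpS]; ring
  have e2 : ∀ θ, ρβ θ ^ 2 = (deriv p θ + iteratedDeriv 3 p θ) ^ 2 := by
    intro θ; rw [hρβ]; simp only [sq_abs]
  simp only [e1] at heq
  simp only [e2] at hW
  have := cv_core p (deriv p) (iteratedDeriv 2 p) (iteratedDeriv 3 p) h0 h1 (hs 2) (hcn 3) hper per1 (hpn 2) hρpos
    L A hL hA Atilde hAt ρM ρm
    (fun θ hθ => by rw [hρM]; exact le_csSup hcomp.bddAbove ⟨θ, hθ, rfl⟩)
    (fun θ hθ => by rw [hρm]; exact csInf_le hcomp.bddBelow ⟨θ, hθ, rfl⟩)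
    K hK ρe ρi hρe hρi cx cy hcx hcy α δ μ σ η lam ξ ζ W hW hη hξ hζ hlam hc1 hc2 _ rfl hD hnz heq
  exact ⟨L / (2 * Real.pi), cx, cy, fun θ => by rw [this θ]; ring⟩
end
end

section
/- One has L = 2πa₀ (hence L² = 4π²a₀²), the family n ↦ (n² − 1)(aₙ² + bₙ²) is summable over integers n ≥ 2, and A = πa₀² − (π/2)·∑_{n=2}^{∞} (n² − 1)(aₙ² + bₙ²). -/
open MeasureTheory

noncomputable section

lemma aux_coeff (f : ℝ → ℝ) (hf : Continuous f) (n : ℤ) (h : (0:ℝ) < 2 * Real.pi) :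
    ‖fourierCoeffOn h (fun x => (f x : ℂ)) n‖ ^ 2 = (1 / (2 * Real.pi)) ^ 2 *
      ((∫ θ in (0:ℝ)..(2 * Real.pi), f θ * Real.cos (n * θ)) ^ 2 +
       (∫ θ in (0:ℝ)..(2 * Real.pi), f θ * Real.sin (n * θ)) ^ 2) := by
  have hpi : (Real.pi : ℂ) ≠ 0 := by exact_mod_cast Real.pi_ne_zero
  have key : (∫ x in (0:ℝ)..(2 * Real.pi),
      fourier (-n) (x : AddCircle (2 * Real.pi - 0)) • (f x : ℂ)) =
      ((∫ θ in (0:ℝ)..(2 * Real.pi), f θ * Real.cos (n * θ) : ℝ) : ℂ) -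
      ((∫ θ in (0:ℝ)..(2 * Real.pi), f θ * Real.sin (n * θ) : ℝ) : ℂ) * Complex.I := by
    rw [← intervalIntegral.integral_ofReal, ← intervalIntegral.integral_ofReal,
      ← intervalIntegral.integral_mul_const, ← intervalIntegral.integral_sub]
    · refine intervalIntegral.integral_congr fun x _ => ?_
      simp only [fourier_coe_apply, smul_eq_mul]
      have : 2 * (Real.pi : ℂ) * Complex.I * ((-n : ℤ) : ℂ) * (x : ℂ) / ((2 * Real.pi - 0 : ℝ) : ℂ)
          = ((-(n * x) : ℝ) : ℂ) * Complex.I := by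
        push_cast
        field_simp
        ring
      rw [this, Complex.exp_mul_I, ← Complex.ofReal_cos, ← Complex.ofReal_sin, Real.cos_neg,
        Real.sin_neg]
      push_cast
      ring
    · exact Continuous.intervalIntegrable (by fun_prop) _ _
    · exact Continuous.intervalIntegrable (by fun_prop) _ _
  rw [fourierCoeffOn_eq_integral, key, norm_smul, mul_pow, ← Complex.normSq_eq_norm_sq,
    Complex.normSq_apply]
  simp [abs_of_pos Real.pi_pos]
  ring

lemma aux_parseval (f : ℝ → ℝ) (hf : Continuous f) :
    HasSum (fun n : ℕ => 2 * ((∫ θ in (0:ℝ)..(2 * Real.pi), f θ * Real.cos (n * θ)) ^ 2 +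
       (∫ θ in (0:ℝ)..(2 * Real.pi), f θ * Real.sin (n * θ)) ^ 2))
      (2 * Real.pi * (∫ θ in (0:ℝ)..(2 * Real.pi), f θ ^ 2) +
        (∫ θ in (0:ℝ)..(2 * Real.pi), f θ) ^ 2) := by
  have h : (0:ℝ) < 2 * Real.pi := by positivity
  have hL2 : MemLp (fun x => (f x : ℂ)) 2 (volume.restrict (Set.Ioc 0 (2 * Real.pi))) := by
    have hc : Continuous (fun x => (f x : ℂ)) := by fun_prop
    obtain ⟨C, hC⟩ := (isCompact_Icc (a := (0:ℝ)) (b := 2 * Real.pi)).exists_bound_of_continuousOn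
      hc.continuousOn
    refine MemLp.of_bound hc.aestronglyMeasurable C ?_
    filter_upwards [ae_restrict_mem measurableSet_Ioc] with x hx
    exact hC x (Set.Ioc_subset_Icc_self hx)
  have h1 := (hasSum_sq_fourierCoeffOn h hL2).nat_add_neg.mul_left ((2 * Real.pi) ^ 2)
  simp only [aux_coeff f hf] at h1
  convert h1 using 1
  · rfl
  · funext n
    simp
    field_simp
    ring
  · simp
    field_simp

lemma aux_deriv (p : ℝ → ℝ) (hp : ContDiff ℝ (⊤ : ℕ∞) p)
    (hper : ∀ θ : ℝ, p (θ + 2 * Real.pi) = p θ) (n : ℕ) :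
    (∫ θ in (0:ℝ)..(2 * Real.pi), deriv p θ * Real.cos (n * θ)) =
      n * (∫ θ in (0:ℝ)..(2 * Real.pi), p θ * Real.sin (n * θ)) ∧
    (∫ θ in (0:ℝ)..(2 * Real.pi), deriv p θ * Real.sin (n * θ)) =
      -(n * (∫ θ in (0:ℝ)..(2 * Real.pi), p θ * Real.cos (n * θ))) := by
  have hd : ∀ x, HasDerivAt p (deriv p x) x := fun x =>
    (hp.differentiable (by simp) x).hasDerivAt
  have hc : Continuous (deriv p) := hp.continuous_deriv (by simp)
  have hp0 : p (2 * Real.pi) = p 0 := by simpa using hper 0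
  have hl : ∀ x : ℝ, HasDerivAt (fun x : ℝ => (n:ℝ) * x) n x := fun x => by
    simpa using (hasDerivAt_id x).const_mul (n:ℝ)
  have hcp : Continuous p := hp.continuous
  have c1 : Real.cos (n * (2 * Real.pi)) = 1 := Real.cos_nat_mul_two_pi n
  have s1 : Real.sin (n * (2 * Real.pi)) = 0 := by
    have := Real.sin_nat_mul_pi (2 * n)
    push_cast at this
    rw [← this]; ring_nf
  constructor
  · have := intervalIntegral.integral_mul_deriv_eq_deriv_mul (a := 0) (b := 2 * Real.pi)
      (fun x _ => (hl x).cos) (fun x _ => hd x)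
      (Continuous.intervalIntegrable (by fun_prop) _ _) (hc.intervalIntegrable _ _)
    simp only [mul_comm (deriv p _)]
    rw [this, c1, hp0, ← intervalIntegral.integral_const_mul]
    simp only [mul_zero, Real.cos_zero, sub_self, zero_sub]
    rw [← intervalIntegral.integral_neg]
    congr 1; funext x; ring
  · have := intervalIntegral.integral_mul_deriv_eq_deriv_mul (a := 0) (b := 2 * Real.pi)
      (fun x _ => (hl x).sin) (fun x _ => hd x)
      (Continuous.intervalIntegrable (by fun_prop) _ _) (hc.intervalIntegrable _ _)
    simp only [mul_comm (deriv p _)]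
    rw [this, s1, hp0, ← intervalIntegral.integral_const_mul]
    simp only [mul_zero, Real.sin_zero, sub_self, zero_sub, zero_mul]
    congr 2; funext x; ring

theorem stmt10
    (p : ℝ → ℝ)
    (hp : ContDiff ℝ (⊤ : ℕ∞) p)
    (hper : ∀ θ : ℝ, p (θ + 2 * Real.pi) = p θ)
    (ρ : ℝ → ℝ)
    (hρdef : ρ = fun θ => p θ + iteratedDeriv 2 p θ)
    (hρpos : ∀ θ : ℝ, 0 < ρ θ)
    (L A : ℝ)
    (hL : L = ∫ θ in (0:ℝ)..(2 * Real.pi), ρ θ)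
    (hA : A = (1 / 2) * ∫ θ in (0:ℝ)..(2 * Real.pi), (p θ ^ 2 - deriv p θ ^ 2))
    (a b : ℕ → ℝ)
    (ha0 : a 0 = (1 / (2 * Real.pi)) * ∫ θ in (0:ℝ)..(2 * Real.pi), p θ)
    (ha : ∀ n : ℕ, 1 ≤ n → a n = (1 / Real.pi) * ∫ θ in (0:ℝ)..(2 * Real.pi), p θ * Real.cos (n * θ))
    (hb : ∀ n : ℕ, 1 ≤ n → b n = (1 / Real.pi) * ∫ θ in (0:ℝ)..(2 * Real.pi), p θ * Real.sin (n * θ))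
    :
    L = 2 * Real.pi * a 0 ∧
      L ^ 2 = 4 * Real.pi ^ 2 * a 0 ^ 2 ∧
      Summable (fun n : ℕ => (((n:ℝ) + 2) ^ 2 - 1) * (a (n + 2) ^ 2 + b (n + 2) ^ 2)) ∧
      A = Real.pi * a 0 ^ 2
          - (Real.pi / 2) * ∑' n : ℕ, (((n:ℝ) + 2) ^ 2 - 1) * (a (n + 2) ^ 2 + b (n + 2) ^ 2) := by
  have hpi : Real.pi ≠ 0 := Real.pi_ne_zero
  have hcp : Continuous p := hp.continuous
  have hc : Continuous (deriv p) := hp.continuous_deriv (by simp)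
  have hp' : ContDiff ℝ (⊤ : ℕ∞) (deriv p) := by
    have := (contDiff_infty_iff_deriv (f := p)).1 hp
    exact this.2
  have hper' : ∀ θ : ℝ, deriv p (θ + 2 * Real.pi) = deriv p θ := fun θ => by
    rw [← deriv_comp_add_const]
    congr 1
    funext x; exact hper x
  have hc2 : Continuous (deriv (deriv p)) := hp'.continuous_deriv (by simp)
  have hint2 : ∫ θ in (0:ℝ)..(2 * Real.pi), deriv (deriv p) θ = 0 := by
    simpa using (aux_deriv (deriv p) hp' hper' 0).1
  have hint1 : ∫ θ in (0:ℝ)..(2 * Real.pi), deriv p θ = 0 := by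
    simpa using (aux_deriv p hp hper 0).1
  have hL' : L = 2 * Real.pi * a 0 := by
    rw [hL, hρdef, ha0]
    simp only [iteratedDeriv_succ, iteratedDeriv_zero]
    rw [intervalIntegral.integral_add (hcp.intervalIntegrable _ _) (hc2.intervalIntegrable _ _),
      hint2]
    field_simp
    ring
  have hs := (aux_parseval (deriv p) hc).sub (aux_parseval p hcp)
  simp only [(aux_deriv p hp hper _).1, (aux_deriv p hp hper _).2, hint1] at hs
  have hI : ∫ θ in (0:ℝ)..(2 * Real.pi), p θ = 2 * Real.pi * a 0 := by
    rw [ha0]; field_simp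
  have hA' : 2 * A = (∫ θ in (0:ℝ)..(2 * Real.pi), p θ ^ 2) -
      ∫ θ in (0:ℝ)..(2 * Real.pi), deriv p θ ^ 2 := by
    rw [hA, intervalIntegral.integral_sub
      (Continuous.intervalIntegrable (by fun_prop) _ _)
      (Continuous.intervalIntegrable (by fun_prop) _ _)]
    ring
  have hs2 := ((hasSum_nat_add_iff' 2).2 hs).mul_left (1 / (2 * Real.pi ^ 2))
  have hs3 : HasSum (fun n : ℕ => (((n:ℝ) + 2) ^ 2 - 1) * (a (n + 2) ^ 2 + b (n + 2) ^ 2))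
      (2 / Real.pi * (Real.pi * a 0 ^ 2 - A)) := by
    convert hs2 using 1
    · rfl
    · funext n
      rw [ha (n + 2) (by omega), hb (n + 2) (by omega)]
      push_cast
      field_simp
      ring
    · simp only [Finset.sum_range_succ, Finset.sum_range_zero, Nat.cast_zero, zero_mul,
        Real.cos_zero, Real.sin_zero, mul_one, mul_zero, intervalIntegral.integral_zero,
        Nat.cast_one, one_mul, hI]
      have : (∫ θ in (0:ℝ)..(2 * Real.pi), p θ ^ 2) = 2 * A +
        ∫ θ in (0:ℝ)..(2 * Real.pi), deriv p θ ^ 2 := by linarith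
      rw [this]
      field_simp
      ring
  refine ⟨hL', by rw [hL']; ring, hs3.summable, ?_⟩
  rw [hs3.tsum_eq]
  field_simp
  ring
end
end

section
/- Let real parameters (α, δ, μ, σ, η, λ, ξ, ζ) satisfy η ≥ 0, ξ ≥ 0, λ ≤ 0, λ² + ξ² > 0, ζ = 0, 2α + 4πδ + μ = 0, 2α + σ − 2η ≥ 0, and 6πα − πμ + 4πσ + 24πη + 4λ + 4ξ ≥ 0. Then W = 0 if and only if K is a disk, i.e. there exist real numbers a₀, a₁, b₁ with p(θ) = a₀ + a₁ cos θ + b₁ sin θ for all θ; here W = α∫₀^{2π}ρ(θ)²dθ + δL² + μA + σ|Ã| + η∫₀^{2π}ρ_β(θ)²dθ + λ(ρ_e − ρ_i)² + ξ(ρ_M − ρ_m)². -/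
open MeasureTheory
noncomputable section

lemma aux_ii {g : ℝ → ℝ} (hg : Continuous g) (a b : ℝ) : IntervalIntegrable g volume a b :=
  hg.intervalIntegrable a b

lemma wirt_k {g g' : ℝ → ℝ} (hg : ∀ x, HasDerivAt g (g' x) x) (hg' : Continuous g')
    {a b k : ℝ} (hab : a ≤ b) (hπ : b - a ≤ Real.pi) (hk0 : 0 < k) (hk : k < 1)
    (ha : g a = 0) (hb : g b = 0) :
    k ^ 2 * (∫ s in a..b, g s ^ 2) ≤ ∫ s in a..b, g' s ^ 2 := by
  have hgc : Continuous g := continuous_iff_continuousAt.2 fun x => (hg x).continuousAt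
  set t : ℝ → ℝ := fun s => k * Real.tan (k * (s - (a + b) / 2)) with ht
  have hcos : ∀ s ∈ Set.uIcc a b, Real.cos (k * (s - (a + b) / 2)) ≠ 0 := by
    intro s hs
    rw [Set.uIcc_of_le hab] at hs
    apply ne_of_gt
    apply Real.cos_pos_of_mem_Ioo
    have hpi := Real.pi_pos
    have h1 : |s - (a + b) / 2| ≤ Real.pi / 2 := by
      rw [abs_le]; constructor <;> linarith [hs.1, hs.2]
    have h2 : |k * (s - (a + b) / 2)| < Real.pi / 2 := by
      rw [abs_mul, abs_of_pos hk0]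
      nlinarith [abs_nonneg (s - (a + b) / 2)]
    rw [abs_lt] at h2
    exact ⟨by linarith [h2.1], h2.2⟩
  have htd : ∀ s ∈ Set.uIcc a b, HasDerivAt t (k ^ 2 + t s ^ 2) s := by
    intro s hs
    have h1 : HasDerivAt (fun s => k * (s - (a + b) / 2)) k s := by
      simpa using ((hasDerivAt_id s).sub_const ((a + b) / 2)).const_mul k
    have h2 := ((Real.hasDerivAt_tan (hcos s hs)).comp s h1).const_mul k
    refine h2.congr_deriv ?_
    have h3 := Real.inv_one_add_tan_sq (hcos s hs)
    have h4 : 1 / Real.cos (k * (s - (a + b) / 2)) ^ 2 = 1 + Real.tan (k * (s - (a + b) / 2)) ^ 2 := by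
      rw [← h3]; simp
    rw [h4, ht]; ring
  have htc : ContinuousOn t (Set.uIcc a b) := fun s hs => (htd s hs).continuousAt.continuousWithinAt
  have hF : ∀ s ∈ Set.uIcc a b, HasDerivAt (fun s => g s ^ 2 * t s)
      (2 * g s * g' s * t s + g s ^ 2 * (k ^ 2 + t s ^ 2)) s := by
    intro s hs
    refine (((hg s).pow 2).mul (htd s hs)).congr_deriv ?_
    simp
  have hFi : IntervalIntegrable (fun s => 2 * g s * g' s * t s + g s ^ 2 * (k ^ 2 + t s ^ 2)) volume a b := by
    apply ContinuousOn.intervalIntegrable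
    fun_prop
  have h1 := intervalIntegral.integral_eq_sub_of_hasDerivAt hF hFi
  rw [ha, hb] at h1
  have h2 : 0 ≤ ∫ s in a..b, (g' s + g s * t s) ^ 2 :=
    intervalIntegral.integral_nonneg_of_forall hab (fun u => sq_nonneg _)
  have h3 : ∫ s in a..b, (g' s + g s * t s) ^ 2 = ∫ s in a..b, ((g' s ^ 2 - k ^ 2 * g s ^ 2) +
      (2 * g s * g' s * t s + g s ^ 2 * (k ^ 2 + t s ^ 2))) := by
    congr 1; ext s; ring
  rw [h3, intervalIntegral.integral_add (aux_ii (by fun_prop) _ _) hFi, h1,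
    intervalIntegral.integral_sub (aux_ii (by fun_prop) _ _) (aux_ii (by fun_prop) _ _),
    intervalIntegral.integral_const_mul] at h2
  linarith

lemma wirt {g g' : ℝ → ℝ} (hg : ∀ x, HasDerivAt g (g' x) x) (hg' : Continuous g')
    {a b : ℝ} (hab : a ≤ b) (hπ : b - a ≤ Real.pi) 
    (ha : g a = 0) (hb : g b = 0) :
    (∫ s in a..b, g s ^ 2) ≤ ∫ s in a..b, g' s ^ 2 := by
  have h : Filter.Tendsto (fun k : ℝ => k ^ 2 * (∫ s in a..b, g s ^ 2)) (nhdsWithin 1 (Set.Iio 1))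
      (nhds (1 ^ 2 * (∫ s in a..b, g s ^ 2))) :=
    (Continuous.tendsto (by fun_prop) 1).mono_left nhdsWithin_le_nhds
  rw [one_pow, one_mul] at h
  refine le_of_tendsto h ?_
  filter_upwards [Ioo_mem_nhdsLT (show (0:ℝ) < 1 by norm_num)] with k hk
  exact wirt_k hg hg' hab hπ hk.1 hk.2 ha hb

lemma quad_zero {B C : ℝ} (h : ∀ e : ℝ, 0 ≤ 2 * e * B + e ^ 2 * C) : B = 0 := by
  by_contra hB
  have hB2 : 0 < B ^ 2 := by positivity
  have hC : 0 < |C| + 1 := by positivity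
  have h1 := h (-(B / (|C| + 1)))
  have h2 : 2 * -(B / (|C| + 1)) * B + (-(B / (|C| + 1))) ^ 2 * C
      = (B ^ 2 / (|C| + 1) ^ 2) * (C - 2 * (|C| + 1)) := by
    field_simp; ring
  rw [h2] at h1
  have h3 : 0 < B ^ 2 / (|C| + 1) ^ 2 := by positivity
  nlinarith [le_abs_self C, abs_nonneg C]

lemma wirt_eq {q : ℝ → ℝ} (hq : ContDiff ℝ (⊤ : ℕ∞) q)
    {a b : ℝ} (hab : a ≤ b) (hπ : b - a ≤ Real.pi) 
    (ha : q a = 0) (hb : q b = 0) (ha' : deriv q a = 0)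
    (heq : (∫ s in a..b, deriv q s ^ 2) ≤ ∫ s in a..b, q s ^ 2) :
    ∀ s ∈ Set.Icc a b, q s = 0 := by
  have hq1 : ContDiff ℝ (⊤ : ℕ∞) (deriv q) := (contDiff_infty_iff_deriv.1 hq).2
  have hq2 : ContDiff ℝ (⊤ : ℕ∞) (deriv (deriv q)) := (contDiff_infty_iff_deriv.1 hq1).2
  have hd : ∀ x, HasDerivAt q (deriv q x) x := fun x => (hq.differentiable (by simp) x).hasDerivAt
  have hd1 : ∀ x, HasDerivAt (deriv q) (deriv (deriv q) x) x :=
    fun x => (hq1.differentiable (by simp) x).hasDerivAt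
  set φ : ℝ → ℝ := fun s => (deriv (deriv q) s + q s) * ((s - a) * (b - s)) with hφ
  have hφs : ContDiff ℝ (⊤ : ℕ∞) φ := by
    have h1 : ContDiff ℝ (⊤ : ℕ∞) (fun s : ℝ => (s - a) * (b - s)) := by fun_prop
    exact (hq2.add hq).mul h1
  have hφ1 : ContDiff ℝ (⊤ : ℕ∞) (deriv φ) := (contDiff_infty_iff_deriv.1 hφs).2
  have hdφ : ∀ x, HasDerivAt φ (deriv φ x) x := fun x => (hφs.differentiable (by simp) x).hasDerivAt
  have hφa : φ a = 0 := by simp [hφ]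
  have hφb : φ b = 0 := by simp [hφ]
  have c0 := hq.continuous
  have c1 := hq1.continuous
  have c2 := hq2.continuous
  have c3 := hφs.continuous
  have c4 := hφ1.continuous
  have hB : ∫ s in a..b, (deriv q s * deriv φ s - q s * φ s) = 0 := by
    apply quad_zero (C := ∫ s in a..b, (deriv φ s ^ 2 - φ s ^ 2))
    intro e
    have h1 := wirt (g := fun s => q s + e * φ s) (g' := fun s => deriv q s + e * deriv φ s)
      (fun x => (hd x).add ((hdφ x).const_mul e)) (by fun_prop) hab hπ (by simp [ha, hφa])
      (by simp [hb, hφb])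
    have h2 : (∫ s in a..b, (deriv q s + e * deriv φ s) ^ 2) - (∫ s in a..b, (q s + e * φ s) ^ 2)
      = ((∫ s in a..b, deriv q s ^ 2) - ∫ s in a..b, q s ^ 2)
        + 2 * e * (∫ s in a..b, (deriv q s * deriv φ s - q s * φ s)) 
        + e ^ 2 * ∫ s in a..b, (deriv φ s ^ 2 - φ s ^ 2) := by
      rw [← intervalIntegral.integral_const_mul, ← intervalIntegral.integral_const_mul,
        ← intervalIntegral.integral_sub (aux_ii (by fun_prop) _ _) (aux_ii (by fun_prop) _ _),
        ← intervalIntegral.integral_sub (aux_ii (by fun_prop) _ _) (aux_ii (by fun_prop) _ _),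
        ← intervalIntegral.integral_add (aux_ii (by fun_prop) _ _) (aux_ii (by fun_prop) _ _),
        ← intervalIntegral.integral_add (aux_ii (by fun_prop) _ _) (aux_ii (by fun_prop) _ _)]
      congr 1; ext s; ring
    linarith
  have hparts : ∫ s in a..b, (deriv (deriv q) s * φ s + deriv q s * deriv φ s) = 0 := by
    rw [intervalIntegral.integral_eq_sub_of_hasDerivAt (f := fun s => deriv q s * φ s)
      (fun s _ => (hd1 s).mul (hdφ s)) (aux_ii (by fun_prop) _ _)]
    simp [hφa, hφb]
  have hz : ∫ s in a..b, (deriv (deriv q) s + q s) ^ 2 * ((s - a) * (b - s)) = 0 := by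
    have : ∫ s in a..b, (deriv (deriv q) s + q s) ^ 2 * ((s - a) * (b - s)) =
       (∫ s in a..b, (deriv (deriv q) s * φ s + deriv q s * deriv φ s)) -
        ∫ s in a..b, (deriv q s * deriv φ s - q s * φ s) := by
      rw [← intervalIntegral.integral_sub (aux_ii (by fun_prop) _ _) (aux_ii (by fun_prop) _ _)]
      congr 1; ext s; simp only [hφ]; ring
    rw [this, hB, hparts]; simp
  have hode : ∀ s ∈ Set.Ioo a b, deriv (deriv q) s + q s = 0 := by
    intro s hs
    by_contra hne
    have h1 : a < b := hs.1.trans hs.2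
    have := intervalIntegral.integral_pos h1
      (f := fun s => (deriv (deriv q) s + q s) ^ 2 * ((s - a) * (b - s)))
      (by fun_prop) (fun x hx => mul_nonneg (sq_nonneg _)
        (mul_nonneg (by linarith [hx.1]) (by linarith [hx.2])))
      ⟨s, ⟨hs.1.le, hs.2.le⟩, mul_pos (by positivity)
        (mul_pos (by linarith [hs.1]) (by linarith [hs.2]))⟩
    linarith
  have hE : ∀ s ∈ Set.Icc a b, q s ^ 2 + deriv q s ^ 2 = q a ^ 2 + deriv q a ^ 2 := by
    have hanti : AntitoneOn (fun s => q s ^ 2 + deriv q s ^ 2) (Set.Icc a b) := by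
      apply antitoneOn_of_hasDerivWithinAt_nonpos (convex_Icc a b) (by fun_prop)
        (f' := fun s => 2 * q s * deriv q s + 2 * deriv q s * deriv (deriv q) s)
      · intro x hx
        refine HasDerivAt.hasDerivWithinAt ?_
        refine (((hd x).pow 2).add ((hd1 x).pow 2)).congr_deriv ?_
        simp
      · intro x hx
        rw [interior_Icc] at hx
        have := hode x hx
        have h2 : deriv (deriv q) x = - q x := by linarith
        rw [h2]; linarith
    intro s hs
    have h1 := hanti ⟨le_refl a, hs.1.trans hs.2⟩ hs hs.1
    simp only [ha, ha'] at h1 ⊢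
    nlinarith [sq_nonneg (q s), sq_nonneg (deriv q s)]
  intro s hs
  have h1 := hE s hs
  rw [ha, ha'] at h1
  have : q s ^ 2 = 0 := by nlinarith [sq_nonneg (q s), sq_nonneg (deriv q s)]
  exact pow_eq_zero_iff (two_ne_zero) |>.1 this

lemma gaps {q : ℝ → ℝ} (hq : ContDiff ℝ (⊤ : ℕ∞) q) (hper : ∀ s, q (s + 2 * Real.pi) = q s)
    (hle : ∀ s, q s ≤ 0) (hz : ∀ φ, ∃ z ∈ Set.Icc φ (φ + Real.pi), q z = 0) :
    (∫ s in (0:ℝ)..(2 * Real.pi), (q s ^ 2 - deriv q s ^ 2)) ≤ 0 ∧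
    ((∫ s in (0:ℝ)..(2 * Real.pi), (q s ^ 2 - deriv q s ^ 2)) = 0 → ∀ s, q s = 0) := by
  have hpi := Real.pi_pos
  have hq1 : ContDiff ℝ (⊤ : ℕ∞) (deriv q) := (contDiff_infty_iff_deriv.1 hq).2
  have hd : ∀ x, HasDerivAt q (deriv q x) x := fun x => (hq.differentiable (by simp) x).hasDerivAt
  have c0 := hq.continuous
  have c1 := hq1.continuous
  have hper1 : ∀ s, deriv q (s + 2 * Real.pi) = deriv q s := by
    intro s
    rw [← deriv_comp_add_const]
    congr 1; ext s; exact hper s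
  have hcrit : ∀ z, q z = 0 → deriv q z = 0 := by
    intro z h
    apply IsLocalMax.deriv_eq_zero
    exact Filter.Eventually.of_forall fun x => by rw [h]; exact hle x
  obtain ⟨z0, -, h0⟩ := hz 0
  have h3 : q (z0 + 2 * Real.pi) = 0 := by rw [hper, h0]
  have hclosed : IsClosed {s | q s = 0} := isClosed_eq c0 continuous_const
  obtain ⟨z1, hz1, hz1'⟩ := (isCompact_Icc.inter_right hclosed :
    IsCompact (Set.Icc z0 (z0 + Real.pi) ∩ {s | q s = 0})).exists_isGreatest
      ⟨z0, ⟨le_refl _, by linarith⟩, h0⟩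
  obtain ⟨z2, hz2, hz2'⟩ := (isCompact_Icc.inter_right hclosed :
    IsCompact (Set.Icc (z0 + Real.pi) (z0 + 2 * Real.pi) ∩ {s | q s = 0})).exists_isLeast
      ⟨z0 + 2 * Real.pi, ⟨by linarith, le_refl _⟩, h3⟩
  have h12 : z2 - z1 ≤ Real.pi := by
    by_contra hcon
    push Not at hcon
    obtain ⟨z, hz, hzz⟩ := hz ((z1 + z2 - Real.pi) / 2)
    have e1 : z1 < z := by linarith [hz.1]
    have e2 : z < z2 := by linarith [hz.2]
    rcases le_total z (z0 + Real.pi) with h | h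
    · have := hz1' ⟨⟨by linarith [hz1.1.1], h⟩, hzz⟩
      linarith
    · have := hz2' ⟨⟨h, by linarith [hz2.1.2]⟩, hzz⟩
      linarith
  have l01 : z0 ≤ z1 := hz1.1.1
  have l12 : z1 ≤ z2 := hz1.1.2.trans hz2.1.1
  have l23 : z2 ≤ z0 + 2 * Real.pi := hz2.1.2
  have p01 : z1 - z0 ≤ Real.pi := by linarith [hz1.1.2]
  have p23 : z0 + 2 * Real.pi - z2 ≤ Real.pi := by linarith [hz2.1.1]
  have w1 := wirt hd c1 l01 p01 h0 hz1.2
  have w2 := wirt hd c1 l12 h12 hz1.2 hz2.2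
  have w3 := wirt hd c1 l23 p23 hz2.2 h3
  have hP : Function.Periodic (fun s => q s ^ 2 - deriv q s ^ 2) (2 * Real.pi) := by
    intro s; simp only [hper, hper1]
  have hI : (∫ s in (0:ℝ)..(2 * Real.pi), (q s ^ 2 - deriv q s ^ 2)) =
     ((∫ s in z0..z1, q s ^ 2) - ∫ s in z0..z1, deriv q s ^ 2) +
     ((∫ s in z1..z2, q s ^ 2) - ∫ s in z1..z2, deriv q s ^ 2) +
     ((∫ s in z2..(z0 + 2 * Real.pi), q s ^ 2) - ∫ s in z2..(z0 + 2 * Real.pi), deriv q s ^ 2) := by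
    have h := hP.intervalIntegral_add_eq 0 z0
    rw [zero_add] at h
    have ii : ∀ a b, IntervalIntegrable (fun s => q s ^ 2 - deriv q s ^ 2) volume a b :=
      fun a b => aux_ii (by fun_prop) _ _
    rw [h, ← intervalIntegral.integral_add_adjacent_intervals (ii z0 z2) (ii z2 _),
      ← intervalIntegral.integral_add_adjacent_intervals (ii z0 z1) (ii z1 _)]
    rw [intervalIntegral.integral_sub (aux_ii (by fun_prop) _ _) (aux_ii (by fun_prop) _ _),
      intervalIntegral.integral_sub (aux_ii (by fun_prop) _ _) (aux_ii (by fun_prop) _ _),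
      intervalIntegral.integral_sub (aux_ii (by fun_prop) _ _) (aux_ii (by fun_prop) _ _)]
  refine ⟨by linarith, fun hzero => ?_⟩
  have v1 := wirt_eq hq l01 p01 h0 hz1.2 (hcrit _ h0) (by linarith)
  have v2 := wirt_eq hq l12 h12 hz1.2 hz2.2 (hcrit _ hz1.2) (by linarith)
  have v3 := wirt_eq hq l23 p23 hz2.2 h3 (hcrit _ hz2.2) (by linarith)
  intro s
  obtain ⟨y, hy, hys⟩ := Function.Periodic.exists_mem_Ico (f := q) (c := 2 * Real.pi) hper
    (by linarith) s z0
  rw [hys]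
  rcases le_total y z1 with h | h
  · exact v1 y ⟨hy.1, h⟩
  rcases le_total y z2 with h' | h'
  · exact v2 y ⟨h, h'⟩
  · exact v3 y ⟨h', hy.2.le⟩
lemma per_max {h : ℝ → ℝ} (hc : Continuous h) (hper : ∀ s, h (s + 2 * Real.pi) = h s) :
    ∃ x0, ∀ x, h x ≤ h x0 := by
  have hpi := Real.pi_pos
  obtain ⟨x0, -, hx0⟩ := (isCompact_Icc : IsCompact (Set.Icc (0:ℝ) (2 * Real.pi))).exists_isMaxOn
    ⟨0, le_refl _, by linarith⟩ hc.continuousOn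
  refine ⟨x0, fun x => ?_⟩
  obtain ⟨y, hy, hys⟩ := Function.Periodic.exists_mem_Ico (f := h) (c := 2 * Real.pi) hper
    (by linarith) x 0
  rw [hys]
  rw [zero_add] at hy
  exact hx0 ⟨hy.1, hy.2.le⟩

lemma center {f : ℝ → ℝ} (hc : Continuous f) (hper : ∀ s, f (s + 2 * Real.pi) = f s) :
    ∃ c1 c2 R : ℝ, (∀ θ, f θ - (c1 * Real.cos θ + c2 * Real.sin θ) ≤ R) ∧
      (∀ d1 d2 r : ℝ, (∀ θ, f θ - (d1 * Real.cos θ + d2 * Real.sin θ) ≤ r) → R ≤ r) ∧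
      (∀ φ, ∃ z ∈ Set.Icc φ (φ + Real.pi), f z - (c1 * Real.cos z + c2 * Real.sin z) = R) := by
  have hpi := Real.pi_pos
  obtain ⟨M, hM⟩ : ∃ M, ∀ x, |f x| ≤ M := by
    obtain ⟨x0, hx0⟩ := per_max (h := fun x => |f x|) (by fun_prop) (by intro s; simp only [hper])
    exact ⟨_, hx0⟩
  set T : Set (ℝ × ℝ × ℝ) := {x | ∀ θ, f θ - (x.1 * Real.cos θ + x.2.1 * Real.sin θ) ≤ x.2.2} with hT
  have hTc : IsClosed T := by
    rw [hT, Set.ofPred_forall]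
    exact isClosed_iInter fun θ => isClosed_le (by fun_prop) (by fun_prop)
  have hbox : ∀ x ∈ T, x.2.2 ≤ M → x ∈ Set.Icc ((-(2 * M), -(2 * M), -M) : ℝ × ℝ × ℝ) (2 * M, 2 * M, M) := by
    rintro ⟨c1, c2, r⟩ hx hr
    simp only [hT, Set.mem_ofPred_eq] at hx hr
    have a1 := hx 0
    have a2 := hx Real.pi
    have a3 := hx (Real.pi / 2)
    have a4 := hx (-(Real.pi / 2))
    simp at a1 a2 a3 a4
    have b1 := abs_le.1 (hM 0)
    have b2 := abs_le.1 (hM Real.pi)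
    have b3 := abs_le.1 (hM (Real.pi / 2))
    have b4 := abs_le.1 (hM (-(Real.pi / 2)))
    refine ⟨⟨?_, ?_, ?_⟩, ⟨?_, ?_, ?_⟩⟩ <;> simp only <;> linarith [b1.1, b2.1, b3.1, b4.1]
  have hcomp : IsCompact (Set.Icc ((-(2 * M), -(2 * M), -M) : ℝ × ℝ × ℝ) (2 * M, 2 * M, M) ∩ T) :=
    isCompact_Icc.inter_right hTc
  have hmem : ((0, 0, M) : ℝ × ℝ × ℝ) ∈ T := by
    intro θ; simp; exact (abs_le.1 (hM θ)).2
  obtain ⟨⟨c1, c2, R⟩, hx, hmin⟩ := hcomp.exists_isMinOn ⟨_, hbox _ hmem le_rfl, hmem⟩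
    (f := fun x => x.2.2) (by fun_prop)
  have hmin' : ∀ d1 d2 r : ℝ, (∀ θ, f θ - (d1 * Real.cos θ + d2 * Real.sin θ) ≤ r) → R ≤ r := by
    intro d1 d2 r h
    rcases le_total r M with hr | hr
    · have hm : ((d1, d2, r) : ℝ × ℝ × ℝ) ∈ T := h
      exact hmin ⟨hbox _ hm hr, hm⟩
    · exact hx.1.2.2.2.trans hr
  have hxT : ∀ θ, f θ - (c1 * Real.cos θ + c2 * Real.sin θ) ≤ R := hx.2
  refine ⟨c1, c2, R, hxT, hmin', ?_⟩
  intro φ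
  by_contra hcon
  push Not at hcon
  obtain ⟨x1, hx1, hx1max⟩ := (isCompact_Icc : IsCompact (Set.Icc φ (φ + Real.pi))).exists_isMaxOn
    ⟨φ, le_refl _, by linarith⟩ (f := fun z => f z - (c1 * Real.cos z + c2 * Real.sin z)) (by fun_prop)
  have hlt : f x1 - (c1 * Real.cos x1 + c2 * Real.sin x1) < R := lt_of_le_of_ne (hxT x1) (hcon x1 hx1)
  obtain ⟨ε, hε⟩ : ∃ ε, ε = (R - (f x1 - (c1 * Real.cos x1 + c2 * Real.sin x1))) / 2 := ⟨_, rfl⟩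
  have hε0 : 0 < ε := by rw [hε]; linarith
  set φ0 := φ + Real.pi / 2 with hφ0
  set h : ℝ → ℝ := fun θ => f θ - ((c1 - ε * Real.cos φ0) * Real.cos θ + (c2 - ε * Real.sin φ0) * Real.sin θ) with hh
  have hhe : ∀ θ, h θ = f θ - (c1 * Real.cos θ + c2 * Real.sin θ) + ε * Real.cos (θ - φ0) := by
    intro θ; simp only [hh, Real.cos_sub]; ring
  have hhper : ∀ s, h (s + 2 * Real.pi) = h s := by
    intro s; simp only [hh, hper, Real.cos_add_two_pi, Real.sin_add_two_pi]
  have hhlt : ∀ θ, h θ < R := by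
    intro θ
    obtain ⟨y, hy, hys⟩ := Function.Periodic.exists_mem_Ico (f := h) (c := 2 * Real.pi) hhper
      (by linarith) θ φ
    rw [hys, hhe]
    rcases le_or_gt y (φ + Real.pi) with h1 | h1
    · have h2 : f y - (c1 * Real.cos y + c2 * Real.sin y) ≤ f x1 - (c1 * Real.cos x1 + c2 * Real.sin x1) :=
        hx1max ⟨hy.1, h1⟩
      have h3 : ε * Real.cos (y - φ0) ≤ ε * 1 := mul_le_mul_of_nonneg_left (Real.cos_le_one _) hε0.le
      linarith
    · have h2 : Real.cos (y - φ0) < 0 := by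
        apply Real.cos_neg_of_pi_div_two_lt_of_lt <;> linarith [hy.2]
      have h3 := hxT y
      have := mul_neg_of_pos_of_neg hε0 h2
      linarith
  obtain ⟨x2, hx2⟩ := per_max (h := h) (by fun_prop) hhper
  have := hmin' _ _ _ hx2
  linarith [hhlt x2]

lemma key {f : ℝ → ℝ} (hf : ContDiff ℝ (⊤ : ℕ∞) f) (hper : ∀ s, f (s + 2 * Real.pi) = f s) :
    ∃ c1 c2 R : ℝ, (∀ θ, f θ - (c1 * Real.cos θ + c2 * Real.sin θ) ≤ R) ∧
      (∀ d1 d2 r : ℝ, (∀ θ, f θ - (d1 * Real.cos θ + d2 * Real.sin θ) ≤ r) → R ≤ r) ∧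
      ((∫ s in (0:ℝ)..(2 * Real.pi), (f s ^ 2 - deriv f s ^ 2)) -
        2 * R * (∫ s in (0:ℝ)..(2 * Real.pi), f s) + 2 * Real.pi * R ^ 2 ≤ 0) ∧
      ((∫ s in (0:ℝ)..(2 * Real.pi), (f s ^ 2 - deriv f s ^ 2)) -
        2 * R * (∫ s in (0:ℝ)..(2 * Real.pi), f s) + 2 * Real.pi * R ^ 2 = 0 →
        ∀ θ, f θ = R + c1 * Real.cos θ + c2 * Real.sin θ) := by
  obtain ⟨c1, c2, R, h1, h2, h3⟩ := center hf.continuous hper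
  refine ⟨c1, c2, R, h1, h2, ?_⟩
  have hf1 : ContDiff ℝ (⊤ : ℕ∞) (deriv f) := (contDiff_infty_iff_deriv.1 hf).2
  have hd : ∀ x, HasDerivAt f (deriv f x) x := fun x => (hf.differentiable (by simp) x).hasDerivAt
  have c0 := hf.continuous
  have c1' := hf1.continuous
  set u : ℝ → ℝ := fun θ => c1 * Real.cos θ + c2 * Real.sin θ with hu
  set v : ℝ → ℝ := fun θ => -(c1 * Real.sin θ) + c2 * Real.cos θ with hv
  have hud : ∀ x, HasDerivAt u (v x) x := by
    intro x
    refine (((Real.hasDerivAt_cos x).const_mul c1).add ((Real.hasDerivAt_sin x).const_mul c2)).congr_deriv ?_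
    simp only [hv]; ring
  have hvd : ∀ x, HasDerivAt v (-u x) x := by
    intro x
    refine (((Real.hasDerivAt_sin x).const_mul c1).neg.add ((Real.hasDerivAt_cos x).const_mul c2)).congr_deriv ?_
    simp only [hu]; ring
  have huc : Continuous u := by fun_prop
  have hvc : Continuous v := by fun_prop
  have hus : ContDiff ℝ (⊤ : ℕ∞) u :=
    (contDiff_const.mul Real.contDiff_cos).add (contDiff_const.mul Real.contDiff_sin)
  set q : ℝ → ℝ := fun θ => f θ - u θ - R with hq
  have hqd : ∀ x, HasDerivAt q (deriv f x - v x) x := fun x => ((hd x).sub (hud x)).sub_const R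
  have hqd' : deriv q = fun x => deriv f x - v x := funext fun x => (hqd x).deriv
  have hqs : ContDiff ℝ (⊤ : ℕ∞) q := (hf.sub hus).sub contDiff_const
  have hg := gaps hqs (by intro s; simp only [hq, hu, hper, Real.cos_add_two_pi, Real.sin_add_two_pi])
    (fun s => by have := h1 s; simp only [hq, hu]; linarith)
    (fun φ => by
      obtain ⟨z, hz, hzz⟩ := h3 φ
      exact ⟨z, hz, by simp only [hq, hu]; linarith⟩)
  have hI : (∫ s in (0:ℝ)..(2 * Real.pi), (q s ^ 2 - deriv q s ^ 2)) = 
      (∫ s in (0:ℝ)..(2 * Real.pi), (f s ^ 2 - deriv f s ^ 2)) -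
        2 * R * (∫ s in (0:ℝ)..(2 * Real.pi), f s) + 2 * Real.pi * R ^ 2 := by
    have hG : ∫ s in (0:ℝ)..(2 * Real.pi), (-(v s * v s + u s * (-u s)) + 2 * (deriv f s * v s + f s * (-u s)) - 2 * R * (-u s)) = 0 := by
      rw [intervalIntegral.integral_eq_sub_of_hasDerivAt
        (f := fun s => -(u s * v s) + 2 * (f s * v s) - 2 * R * v s)
        (fun s _ => (((hud s).mul (hvd s)).neg.add (((hd s).mul (hvd s)).const_mul 2)).sub
          ((hvd s).const_mul (2 * R))) (aux_ii (by fun_prop) _ _)]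
      have := hper 0
      rw [zero_add] at this
      simp [hu, hv, this]
    have hR : ∫ s in (0:ℝ)..(2 * Real.pi), R ^ 2 = 2 * Real.pi * R ^ 2 := by simp
    rw [← hR, ← intervalIntegral.integral_const_mul,
      ← intervalIntegral.integral_sub (aux_ii (by fun_prop) _ _) (aux_ii (by fun_prop) _ _),
      ← intervalIntegral.integral_add (aux_ii (by fun_prop) _ _) (aux_ii (by fun_prop) _ _),
      ← sub_eq_zero, 
      ← intervalIntegral.integral_sub (aux_ii (by rw [hqd']; fun_prop) _ _) (aux_ii (by fun_prop) _ _)]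
    rw [← hG]
    congr 1; ext s; rw [hqd']; simp only [hq]; ring
  rw [hI] at hg
  refine ⟨hg.1, fun h θ => ?_⟩
  have := hg.2 h θ
  simp only [hq, hu] at this
  linarith

lemma supp {p : ℝ → ℝ} (hp : ContDiff ℝ (⊤ : ℕ∞) p) (hper : ∀ s, p (s + 2 * Real.pi) = p s)
    (hpos : ∀ s, 0 < p s + deriv (deriv p) s) (θ φ : ℝ) :
    p θ * Real.cos (φ - θ) + deriv p θ * Real.sin (φ - θ) ≤ p φ := by
  have hpi := Real.pi_pos
  have hq1 : ContDiff ℝ (⊤ : ℕ∞) (deriv p) := (contDiff_infty_iff_deriv.1 hp).2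
  have hd : ∀ x, HasDerivAt p (deriv p x) x := fun x => (hp.differentiable (by simp) x).hasDerivAt
  have hd1 : ∀ x, HasDerivAt (deriv p) (deriv (deriv p) x) x :=
    fun x => (hq1.differentiable (by simp) x).hasDerivAt
  have c0 := hp.continuous
  have c1 := hq1.continuous
  have main : ∀ φ ∈ Set.Icc (θ - Real.pi) (θ + Real.pi),
      p θ * Real.cos (φ - θ) + deriv p θ * Real.sin (φ - θ) ≤ p φ := by
    intro φ hφ
    set h : ℝ → ℝ := fun s => deriv p s * Real.sin (φ - s) + p s * Real.cos (φ - s) with hh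
    have hsub : ∀ s, HasDerivAt (fun s : ℝ => φ - s) (-1) s := fun s => by
      simpa using (hasDerivAt_id s).const_sub φ
    have hhd : ∀ s, HasDerivAt h ((p s + deriv (deriv p) s) * Real.sin (φ - s)) s := by
      intro s
      refine (((hd1 s).mul (hsub s).sin).add ((hd s).mul (hsub s).cos)).congr_deriv ?_
      ring
    have hhc : Continuous h := by fun_prop
    have e1 : h φ = p φ := by simp [hh]
    have e2 : h θ = p θ * Real.cos (φ - θ) + deriv p θ * Real.sin (φ - θ) := by simp only [hh]; ring
    rw [← e1, ← e2]
    rcases le_total θ φ with hle | hle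
    · have : MonotoneOn h (Set.Icc θ φ) := by
        apply monotoneOn_of_hasDerivWithinAt_nonneg (convex_Icc _ _) hhc.continuousOn
          (fun x _ => (hhd x).hasDerivWithinAt)
        intro x hx
        rw [interior_Icc] at hx
        exact mul_nonneg (hpos x).le (Real.sin_nonneg_of_nonneg_of_le_pi (by linarith [hx.2])
          (by linarith [hx.1, hφ.2]))
      exact this ⟨le_refl _, hle⟩ ⟨hle, le_refl _⟩ hle
    · have : AntitoneOn h (Set.Icc φ θ) := by
        apply antitoneOn_of_hasDerivWithinAt_nonpos (convex_Icc _ _) hhc.continuousOn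
          (fun x _ => (hhd x).hasDerivWithinAt)
        intro x hx
        rw [interior_Icc] at hx
        exact mul_nonpos_of_nonneg_of_nonpos (hpos x).le 
          (Real.sin_nonpos_of_nonpos_of_neg_pi_le (by linarith [hx.1])
          (by linarith [hx.2, hφ.1]))
      exact this ⟨le_refl _, hle⟩ ⟨hle, le_refl _⟩ hle
  obtain ⟨y, hy, hys⟩ := Function.Periodic.exists_mem_Ico (c := 2 * Real.pi)
    (f := fun φ => p φ - (p θ * Real.cos (φ - θ) + deriv p θ * Real.sin (φ - θ))) 
    (by intro s
        have : s + 2 * Real.pi - θ = (s - θ) + 2 * Real.pi := by ring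
        simp only [hper, this, Real.cos_add_two_pi, Real.sin_add_two_pi])
    (by linarith) φ (θ - Real.pi)
  have := main y ⟨hy.1, by linarith [hy.2]⟩
  linarith

lemma parseval {f : ℝ → ℝ} (hf : Continuous f) (hab : (0:ℝ) < 2 * Real.pi) :
    HasSum (fun n => ‖fourierCoeffOn hab (fun x => (f x : ℂ)) n‖ ^ 2)
      ((2 * Real.pi)⁻¹ * ∫ x in (0:ℝ)..(2 * Real.pi), f x ^ 2) := by
  have hc : Continuous (fun x => (f x : ℂ)) := by fun_prop
  have hm : MemLp (fun x => (f x : ℂ)) 2 (volume.restrict (Set.Ioc 0 (2 * Real.pi))) := by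
    obtain ⟨C, hC⟩ := (isCompact_Icc : IsCompact (Set.Icc (0:ℝ) (2 * Real.pi))).exists_bound_of_continuousOn
      hc.continuousOn
    refine MemLp.of_bound hc.aestronglyMeasurable C ?_
    rw [ae_restrict_iff' measurableSet_Ioc]
    exact Filter.Eventually.of_forall fun x hx => hC x (Set.Ioc_subset_Icc_self hx)
  have := hasSum_sq_fourierCoeffOn hab hm
  simpa using this

lemma coeff_deriv {f f' : ℝ → ℝ} (hf : ∀ x, HasDerivAt f (f' x) x) (hf' : Continuous f')
    (hper : f (2 * Real.pi) = f 0) (hab : (0:ℝ) < 2 * Real.pi) (n : ℤ) :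
    ‖fourierCoeffOn hab (fun x => (f' x : ℂ)) n‖ ^ 2 = 
      (n : ℝ) ^ 2 * ‖fourierCoeffOn hab (fun x => (f x : ℂ)) n‖ ^ 2 := by
  have hd : ∀ x, HasDerivAt (fun x => (f x : ℂ)) (f' x : ℂ) x := fun x => (hf x).ofReal_comp
  have hi : IntervalIntegrable (fun x => (f' x : ℂ)) volume 0 (2 * Real.pi) :=
    Continuous.intervalIntegrable (by fun_prop) _ _
  rcases eq_or_ne n 0 with rfl | hn
  · rw [fourierCoeffOn_eq_integral]
    have : ∫ x in (0:ℝ)..(2 * Real.pi), (f' x : ℂ) = 0 := by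
      rw [intervalIntegral.integral_eq_sub_of_hasDerivAt (fun x _ => hd x) hi, hper]; simp
    simp [this]
  · have h := fourierCoeffOn_of_hasDerivAt hab hn (fun x _ => hd x) hi
    simp only [hper, sub_self, mul_zero, zero_sub] at h
    have hpi : (Real.pi : ℂ) ≠ 0 := by exact_mod_cast Real.pi_ne_zero
    have hn' : (n : ℂ) ≠ 0 := by exact_mod_cast hn
    have h2 : fourierCoeffOn hab (fun x => (f' x : ℂ)) n =
        Complex.I * n * fourierCoeffOn hab (fun x => (f x : ℂ)) n := by
      rw [h]; push_cast; field_simp; ring_nf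
    rw [h2, norm_mul, norm_mul]
    simp [mul_pow]

lemma four {p p1 p2 : ℝ → ℝ} (h0 : ∀ x, HasDerivAt p (p1 x) x) (h1 : ∀ x, HasDerivAt p1 (p2 x) x)
    (hc : Continuous p2) (e0 : p (2 * Real.pi) = p 0) (e1 : p1 (2 * Real.pi) = p1 0) :
    0 ≤ (∫ x in (0:ℝ)..(2 * Real.pi), p2 x ^ 2) - 5 * (∫ x in (0:ℝ)..(2 * Real.pi), p1 x ^ 2)
      + 4 * ∫ x in (0:ℝ)..(2 * Real.pi), p x ^ 2 := by
  have hab : (0:ℝ) < 2 * Real.pi := by linarith [Real.pi_pos]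
  have c0 : Continuous p := continuous_iff_continuousAt.2 fun x => (h0 x).continuousAt
  have c1 : Continuous p1 := continuous_iff_continuousAt.2 fun x => (h1 x).continuousAt
  have s0 := parseval c0 hab
  have s1 := parseval c1 hab
  have s2 := parseval hc hab
  have s := (s2.sub (s1.mul_left 5)).add (s0.mul_left 4)
  have hs := s.nonneg (fun n => by
    simp only [coeff_deriv h1 hc e1 hab, coeff_deriv h0 c1 e0 hab]
    have : (0:ℝ) ≤ ((n:ℝ) ^ 2 - 1) * ((n : ℝ) ^ 2 - 4) := by
      have h : (0:ℤ) ≤ (n ^ 2 - 1) * (n ^ 2 - 4) := by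
        rcases le_or_gt (|n|) 1 with h | h
        · have : n ^ 2 ≤ 1 := by rw [← sq_abs]; nlinarith [abs_nonneg n]
          nlinarith
        · have : 4 ≤ n ^ 2 := by rw [← sq_abs]; nlinarith [abs_nonneg n]
          nlinarith
      exact_mod_cast h
    have h2 := mul_nonneg this (sq_nonneg ‖fourierCoeffOn hab (fun x => (p x : ℂ)) n‖)
    nlinarith)
  have : (2 * Real.pi)⁻¹ * ((∫ x in (0:ℝ)..(2 * Real.pi), p2 x ^ 2) - 5 * (∫ x in (0:ℝ)..(2 * Real.pi), p1 x ^ 2)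
      + 4 * ∫ x in (0:ℝ)..(2 * Real.pi), p x ^ 2) ≥ 0 := by linarith
  exact nonneg_of_mul_nonneg_right this (by positivity)
lemma mem_ball_iff' (x c : EuclideanSpace ℝ (Fin 2)) {r : ℝ} (hr : 0 ≤ r) :
    x ∈ Metric.closedBall c r ↔
      ∀ θ : ℝ, (x 0 - c 0) * Real.cos θ + (x 1 - c 1) * Real.sin θ ≤ r := by
  rw [Metric.mem_closedBall, EuclideanSpace.dist_eq, Fin.sum_univ_two, Real.dist_eq, Real.dist_eq,
    sq_abs, sq_abs]
  obtain ⟨a, ha⟩ : ∃ a, a = x 0 - c 0 := ⟨_, rfl⟩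
  obtain ⟨b, hb⟩ : ∃ b, b = x 1 - c 1 := ⟨_, rfl⟩
  rw [← ha, ← hb]
  constructor
  · intro h θ
    refine le_trans ?_ h
    apply Real.le_sqrt_of_sq_le
    nlinarith [Real.sin_sq_add_cos_sq θ, sq_nonneg (a * Real.sin θ - b * Real.cos θ)]
  · intro h
    have h1 := h (Complex.arg ⟨a, b⟩)
    have h2 := Complex.norm_mul_cos_arg ⟨a, b⟩
    have h3 := Complex.norm_mul_sin_arg ⟨a, b⟩
    have h4 : ‖(⟨a, b⟩ : ℂ)‖ = Real.sqrt (a ^ 2 + b ^ 2) := by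
      rw [Complex.norm_eq_sqrt_sq_add_sq]
    simp only at h2 h3
    rw [← h4]
    have h5 := Real.sin_sq_add_cos_sq (Complex.arg ⟨a, b⟩)
    obtain ⟨N, hN⟩ : ∃ N, N = ‖(⟨a, b⟩ : ℂ)‖ := ⟨_, rfl⟩
    rw [← hN] at h2 h3 ⊢
    have : a * Real.cos (Complex.arg ⟨a, b⟩) + b * Real.sin (Complex.arg ⟨a, b⟩) = N := by
      calc _ = (N * Real.cos (Complex.arg ⟨a, b⟩)) * Real.cos (Complex.arg ⟨a, b⟩) +
          (N * Real.sin (Complex.arg ⟨a, b⟩)) * Real.sin (Complex.arg ⟨a, b⟩) := by rw [h2, h3]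
        _ = N * (Real.sin (Complex.arg ⟨a, b⟩) ^ 2 + Real.cos (Complex.arg ⟨a, b⟩) ^ 2) := by ring
        _ = N := by rw [h5, mul_one]
    linarith

lemma alg {π X Y Z e i h L α μ σ η lam ξ : ℝ} (hπ : 0 < π)
    (he : (2 * π * e - L) ^ 2 ≤ 2 * π * X) (hi : (2 * π * i - L) ^ 2 ≤ 2 * π * X)
    (hY : 4 * X ≤ Y) (hZ : 4 * Y ≤ Z) (hh : Y - X ≤ π / 2 * h ^ 2)
    (hη : 0 ≤ η) (hξ : 0 ≤ ξ) (hlam : lam ≤ 0) (hnz : 0 < lam ^ 2 + ξ ^ 2)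
    (hc2 : 0 ≤ 2 * α + σ - 2 * η)
    (hc3 : 0 ≤ (6 * π * α - π * μ + 4 * π * σ + 24 * π * η + 4 * lam + 4 * ξ))
    (hW : α * (Y - X) - μ * X / 2 + σ * (Y / 2) + η * (Z - Y) + lam * (e - i) ^ 2 + ξ * h ^ 2 = 0) :
    (2 * π * e - L) ^ 2 = 2 * π * X := by
  have hX : 0 ≤ X := by
    have : 0 ≤ 2 * π * X := le_trans (sq_nonneg _) he
    exact nonneg_of_mul_nonneg_right this (by positivity)
  have h1 : 0 ≤ 2 * X - π * (e - i) ^ 2 := by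
    have : 0 ≤ (4 * π) * (2 * X - π * (e - i) ^ 2) := by
      have hid : 4 * π * (2 * X - π * (e - i) ^ 2) = 8 * π * X - 2 * (2 * π * e - L) ^ 2
        - 2 * (2 * π * i - L) ^ 2 + ((2 * π * e - L) + (2 * π * i - L)) ^ 2 := by ring
      have hsq := sq_nonneg ((2 * π * e - L) + (2 * π * i - L))
      linarith
    exact nonneg_of_mul_nonneg_right this (by positivity)
  have h2 : 6 * X ≤ π * h ^ 2 := by linarith
  have g1 : (3 * α + 2 * σ + 12 * η - μ / 2) * X ≤
      α * (Y - X) - μ * X / 2 + σ * (Y / 2) + η * (Z - Y) := by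
    nlinarith [mul_nonneg hη (sub_nonneg.2 hZ), mul_nonneg hη (sub_nonneg.2 hY),
      mul_nonneg hc2 (sub_nonneg.2 hY)]
  have g2 : 0 ≤ (6 * π * α - π * μ + 4 * π * σ + 24 * π * η + 4 * lam + 4 * ξ) * X :=
    mul_nonneg hc3 hX
  have g3 := mul_le_mul_of_nonneg_left g1 hπ.le
  have k1 : 0 ≤ (-lam) * (2 * X - π * (e - i) ^ 2) := mul_nonneg (by linarith) h1
  have k2 : 0 ≤ ξ * (π * h ^ 2 - 6 * X) := mul_nonneg hξ (by linarith)
  have k3 : 0 ≤ ξ * X := mul_nonneg hξ hX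
  have hW' : π * (α * (Y - X) - μ * X / 2 + σ * (Y / 2) + η * (Z - Y)) =
      - (π * (lam * (e - i) ^ 2 + ξ * h ^ 2)) := by
    have : α * (Y - X) - μ * X / 2 + σ * (Y / 2) + η * (Z - Y) =
      - (lam * (e - i) ^ 2 + ξ * h ^ 2) := by linarith
    rw [this]; ring
  have tot : (-lam) * (2 * X - π * (e - i) ^ 2) + ξ * (π * h ^ 2 - 6 * X) + 4 * (ξ * X) ≤ 0 := by
    nlinarith
  rcases eq_or_lt_of_le hξ with hx0 | hx0
  · have hl : lam < 0 := by
      rcases eq_or_lt_of_le hlam with h | h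
      · rw [h, ← hx0] at hnz; norm_num at hnz
      · exact h
    have k0 : (-lam) * (2 * X - π * (e - i) ^ 2) = 0 := by linarith
    have : 2 * X - π * (e - i) ^ 2 = 0 := by
      rcases mul_eq_zero.1 k0 with h | h
      · linarith
      · exact h
    have : 4 * π * (2 * X - π * (e - i) ^ 2) = 0 := by rw [this, mul_zero]
    have hid : 4 * π * (2 * X - π * (e - i) ^ 2) = 8 * π * X - 2 * (2 * π * e - L) ^ 2
        - 2 * (2 * π * i - L) ^ 2 + ((2 * π * e - L) + (2 * π * i - L)) ^ 2 := by ring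
    have hsq := sq_nonneg ((2 * π * e - L) + (2 * π * i - L))
    apply le_antisymm he
    linarith
  · have k0 : ξ * X = 0 := by linarith
    have : X = 0 := by
      rcases mul_eq_zero.1 k0 with h | h
      · linarith
      · exact h
    rw [this, mul_zero] at he ⊢
    exact le_antisymm he (sq_nonneg _)

theorem stmt14
    (p : ℝ → ℝ)
    (hp : ContDiff ℝ (⊤ : ℕ∞) p)
    (hper : ∀ θ : ℝ, p (θ + 2 * Real.pi) = p θ)
    (ρ : ℝ → ℝ)
    (hρdef : ρ = fun θ => p θ + iteratedDeriv 2 p θ)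
    (hρpos : ∀ θ : ℝ, 0 < ρ θ)
    (L A : ℝ)
    (hL : L = ∫ θ in (0:ℝ)..(2 * Real.pi), ρ θ)
    (hA : A = (1 / 2) * ∫ θ in (0:ℝ)..(2 * Real.pi), (p θ ^ 2 - deriv p θ ^ 2))
    (Atilde : ℝ)
    (hAt : Atilde = (1 / 2) * ∫ θ in (0:ℝ)..(2 * Real.pi), (deriv p θ ^ 2 - iteratedDeriv 2 p θ ^ 2))
    (ρβ : ℝ → ℝ)
    (hρβ : ρβ = fun θ => |deriv p θ + iteratedDeriv 3 p θ|)
    (ρM ρm : ℝ)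
    (hρM : ρM = sSup (ρ '' Set.Icc (0:ℝ) (2 * Real.pi)))
    (hρm : ρm = sInf (ρ '' Set.Icc (0:ℝ) (2 * Real.pi)))
    (K : Set (EuclideanSpace ℝ (Fin 2)))
    (hK : K = {x | ∀ θ : ℝ, x 0 * Real.cos θ + x 1 * Real.sin θ ≤ p θ})
    (ρe ρi : ℝ)
    (hρe : ρe = sInf {r : ℝ | 0 ≤ r ∧ ∃ c, K ⊆ Metric.closedBall c r})
    (hρi : ρi = sSup {r : ℝ | 0 ≤ r ∧ ∃ c, Metric.closedBall c r ⊆ K})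
    (α δ μ σ η lam ξ ζ : ℝ)
    (W : ℝ)
    (hW : W = α * (∫ θ in (0:ℝ)..(2 * Real.pi), ρ θ ^ 2) + δ * L ^ 2 + μ * A + σ * |Atilde|
      + η * (∫ θ in (0:ℝ)..(2 * Real.pi), ρβ θ ^ 2) + lam * (ρe - ρi) ^ 2
      + ξ * (ρM - ρm) ^ 2)
    (hη : 0 ≤ η) (hξ : 0 ≤ ξ) (hlam : lam ≤ 0)
    (hnz : 0 < lam ^ 2 + ξ ^ 2)
    (hζ : ζ = 0)
    (hc1 : 2 * α + 4 * Real.pi * δ + μ = 0)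
    (hc2 : 0 ≤ 2 * α + σ - 2 * η)
    (hc3 : 0 ≤ (6 * Real.pi * α - Real.pi * μ + 4 * Real.pi * σ + 24 * Real.pi * η + 4 * lam + 4 * ξ)) :
    W = 0 ↔ (∃ a₀ a₁ b₁ : ℝ, ∀ θ : ℝ, p θ = a₀ + a₁ * Real.cos θ + b₁ * Real.sin θ) := by
  have hpi := Real.pi_pos
  have hs1 : ContDiff ℝ (⊤ : ℕ∞) (deriv p) := (contDiff_infty_iff_deriv.1 hp).2
  have hs2 : ContDiff ℝ (⊤ : ℕ∞) (deriv (deriv p)) := (contDiff_infty_iff_deriv.1 hs1).2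
  have hs3 : ContDiff ℝ (⊤ : ℕ∞) (deriv (deriv (deriv p))) := (contDiff_infty_iff_deriv.1 hs2).2
  have i2 : iteratedDeriv 2 p = deriv (deriv p) := by
    simp [iteratedDeriv_succ, iteratedDeriv_zero]
  have i3 : iteratedDeriv 3 p = deriv (deriv (deriv p)) := by
    simp [iteratedDeriv_succ, iteratedDeriv_zero]
  rw [i2] at hρdef hAt
  rw [i3] at hρβ
  have d0 : ∀ x, HasDerivAt p (deriv p x) x := fun x => (hp.differentiable (by simp) x).hasDerivAt
  have d1 : ∀ x, HasDerivAt (deriv p) (deriv (deriv p) x) x :=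
    fun x => (hs1.differentiable (by simp) x).hasDerivAt
  have d2 : ∀ x, HasDerivAt (deriv (deriv p)) (deriv (deriv (deriv p)) x) x :=
    fun x => (hs2.differentiable (by simp) x).hasDerivAt
  have hder : ∀ f : ℝ → ℝ, (∀ s, f (s + 2 * Real.pi) = f s) → 
      ∀ s, deriv f (s + 2 * Real.pi) = deriv f s := by
    intro f h s
    rw [← deriv_comp_add_const]
    congr 1; ext s; exact h s
  have e0 : p (2 * Real.pi) = p 0 := by simpa using hper 0
  have e1 : deriv p (2 * Real.pi) = deriv p 0 := by simpa using hder p hper 0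
  have e2 : deriv (deriv p) (2 * Real.pi) = deriv (deriv p) 0 := by
    simpa using hder _ (hder p hper) 0
  have c0 := hp.continuous
  have c1 := hs1.continuous
  have c2 := hs2.continuous
  have c3 := hs3.continuous
  have hsupp := supp hp hper (by intro s; have := hρpos s; rw [hρdef] at this; exact this)
  obtain ⟨a1, a2, Re, hRe1, hRe2, hRe3, hRe4⟩ := key hp hper
  obtain ⟨b1, b2, Ri, hRi1, hRi2, hRi3, -⟩ := key (f := fun θ => -p θ) hp.neg
    (by intro s; simp only [hper])
  set p1 := deriv p with hp1
  set p2 := deriv p1 with hp2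
  set p3 := deriv p2 with hp3
  obtain ⟨I0, hI0⟩ : ∃ I, I = ∫ θ in (0:ℝ)..(2 * Real.pi), p θ ^ 2 := ⟨_, rfl⟩
  obtain ⟨P1, hP1⟩ : ∃ I, I = ∫ θ in (0:ℝ)..(2 * Real.pi), p1 θ ^ 2 := ⟨_, rfl⟩
  obtain ⟨P2, hP2⟩ : ∃ I, I = ∫ θ in (0:ℝ)..(2 * Real.pi), p2 θ ^ 2 := ⟨_, rfl⟩
  obtain ⟨P3, hP3⟩ : ∃ I, I = ∫ θ in (0:ℝ)..(2 * Real.pi), p3 θ ^ 2 := ⟨_, rfl⟩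
  have ii : ∀ {g : ℝ → ℝ}, Continuous g → IntervalIntegrable g volume 0 (2 * Real.pi) :=
    fun h => h.intervalIntegrable _ _
  have hLp : L = ∫ θ in (0:ℝ)..(2 * Real.pi), p θ := by
    rw [hL, hρdef, intervalIntegral.integral_add (ii c0) (ii c2),
      intervalIntegral.integral_eq_sub_of_hasDerivAt (fun x _ => d1 x) (ii c2), e1]
    simp
  have hA' : ∫ θ in (0:ℝ)..(2 * Real.pi), (p θ ^ 2 - p1 θ ^ 2) = I0 - P1 := by
    rw [intervalIntegral.integral_sub (ii (by fun_prop)) (ii (by fun_prop)), hI0, hP1]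
  have hAt' : ∫ θ in (0:ℝ)..(2 * Real.pi), (p1 θ ^ 2 - p2 θ ^ 2) = P1 - P2 := by
    rw [intervalIntegral.integral_sub (ii (by fun_prop)) (ii (by fun_prop)), hP2, hP1]
  have hpar : ∫ θ in (0:ℝ)..(2 * Real.pi), (p1 θ * p1 θ + p θ * p2 θ) = 0 := by
    rw [intervalIntegral.integral_eq_sub_of_hasDerivAt (fun x _ => (d0 x).mul (d1 x))
      (ii (by fun_prop))]
    simp [e0, e1]
  have hpar2 : ∫ θ in (0:ℝ)..(2 * Real.pi), (p2 θ * p2 θ + p1 θ * p3 θ) = 0 := by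
    rw [intervalIntegral.integral_eq_sub_of_hasDerivAt (fun x _ => (d1 x).mul (d2 x))
      (ii (by fun_prop))]
    simp [e2, e1]
  have hρ2 : ∫ θ in (0:ℝ)..(2 * Real.pi), ρ θ ^ 2 = I0 - 2 * P1 + P2 := by
    have : I0 - 2 * P1 + P2 = I0 - 2 * P1 + P2
      + 2 * ∫ θ in (0:ℝ)..(2 * Real.pi), (p1 θ * p1 θ + p θ * p2 θ) := by rw [hpar]; ring
    rw [this, hI0, hP1, hP2, ← intervalIntegral.integral_const_mul,
      ← intervalIntegral.integral_const_mul,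
      ← intervalIntegral.integral_sub (ii (by fun_prop)) (ii (by fun_prop)),
      ← intervalIntegral.integral_add (ii (by fun_prop)) (ii (by fun_prop)),
      ← intervalIntegral.integral_add (ii (by fun_prop)) (ii (by fun_prop))]
    congr 1; ext s; rw [hρdef]; ring
  have hρβ2 : ∫ θ in (0:ℝ)..(2 * Real.pi), ρβ θ ^ 2 = P1 - 2 * P2 + P3 := by
    have : P1 - 2 * P2 + P3 = P1 - 2 * P2 + P3
      + 2 * ∫ θ in (0:ℝ)..(2 * Real.pi), (p2 θ * p2 θ + p1 θ * p3 θ) := by rw [hpar2]; ring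
    rw [this, hP3, hP1, hP2, ← intervalIntegral.integral_const_mul,
      ← intervalIntegral.integral_const_mul,
      ← intervalIntegral.integral_sub (ii (by fun_prop)) (ii (by fun_prop)),
      ← intervalIntegral.integral_add (ii (by fun_prop)) (ii (by fun_prop)),
      ← intervalIntegral.integral_add (ii (by fun_prop)) (ii (by fun_prop))]
    congr 1; ext s; rw [hρβ]; simp only [sq_abs]; ring
  have hsq : ∀ (g : ℝ → ℝ) (c : ℝ), Continuous g → ∫ θ in (0:ℝ)..(2 * Real.pi), (g θ - c) ^ 2 =
      (∫ θ in (0:ℝ)..(2 * Real.pi), g θ ^ 2) - 2 * c * (∫ θ in (0:ℝ)..(2 * Real.pi), g θ)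
        + 2 * Real.pi * c ^ 2 := by
    intro g c hg
    have hR : ∫ s in (0:ℝ)..(2 * Real.pi), c ^ 2 = 2 * Real.pi * c ^ 2 := by simp
    rw [← hR, ← intervalIntegral.integral_const_mul,
      ← intervalIntegral.integral_sub (ii (by fun_prop)) (ii (by fun_prop)),
      ← intervalIntegral.integral_add (ii (by fun_prop)) (ii (by fun_prop))]
    congr 1; ext s; ring
  obtain ⟨P0, hP0⟩ : ∃ P0, P0 = I0 - L ^ 2 / (2 * Real.pi) := ⟨_, rfl⟩
  have hP0' : ∫ θ in (0:ℝ)..(2 * Real.pi), (p θ - L / (2 * Real.pi)) ^ 2 = P0 := by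
    rw [hsq p _ c0, ← hI0, ← hLp, hP0]; field_simp; ring
  have f1 : 0 ≤ P2 - 5 * P1 + 4 * P0 := by
    have := four (p := fun θ => p θ - L / (2 * Real.pi)) (fun x => (d0 x).sub_const _) d1 c2
      (by simp only [e0]) e1
    rwa [hP0', ← hP1, ← hP2] at this
  have f2 : 0 ≤ P3 - 5 * P2 + 4 * P1 := by
    have := four d1 d2 c3 e1 e2
    rwa [← hP3, ← hP1, ← hP2] at this
  -- the radii
  have hLpos : 0 < L := by
    rw [hL]
    apply intervalIntegral.intervalIntegral_pos_of_pos_on (ii (by rw [hρdef]; fun_prop))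
      (fun x _ => hρpos x) (by linarith)
  have hγ : ∀ θ : ℝ, (!₂[p θ * Real.cos θ - p1 θ * Real.sin θ,
      p θ * Real.sin θ + p1 θ * Real.cos θ] : EuclideanSpace ℝ (Fin 2)) ∈ K := by
    intro θ
    rw [hK]
    intro φ
    have := hsupp θ φ
    rw [Real.cos_sub, Real.sin_sub] at this
    simp
    linarith
  have hout : ∀ (r : ℝ) (c : EuclideanSpace ℝ (Fin 2)), 0 ≤ r → (K ⊆ Metric.closedBall c r ↔
      ∀ θ, p θ - (c 0 * Real.cos θ + c 1 * Real.sin θ) ≤ r) := by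
    intro r c hr
    constructor
    · intro h θ
      have h1 := (mem_ball_iff' _ c hr).1 (h (hγ θ)) θ
      simp at h1
      have h2 := Real.sin_sq_add_cos_sq θ
      have h3 : p θ = p θ * (Real.sin θ ^ 2 + Real.cos θ ^ 2) := by rw [h2, mul_one]
      linarith
    · intro h x hx
      rw [mem_ball_iff' _ _ hr]
      intro θ
      rw [hK] at hx
      have h1 := hx θ
      have h2 := h θ
      linarith
  have hin : ∀ (r : ℝ) (c : EuclideanSpace ℝ (Fin 2)), 0 ≤ r → (Metric.closedBall c r ⊆ K ↔
      ∀ θ, -p θ - ((-c 0) * Real.cos θ + (-c 1) * Real.sin θ) ≤ -r) := by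
    intro r c hr
    constructor
    · intro h θ
      have h1 : (!₂[c 0 + r * Real.cos θ, c 1 + r * Real.sin θ] : EuclideanSpace ℝ (Fin 2)) ∈
          Metric.closedBall c r := by
        rw [mem_ball_iff' _ _ hr]
        intro φ
        simp
        have := mul_le_mul_of_nonneg_left (Real.cos_le_one (θ - φ)) hr
        rw [Real.cos_sub] at this
        linarith
      have h2 := h h1
      rw [hK] at h2
      have h4 := h2 θ
      simp at h4
      have h2 := Real.sin_sq_add_cos_sq θ
      have h3 : r = r * (Real.sin θ ^ 2 + Real.cos θ ^ 2) := by rw [h2, mul_one]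
      linarith
    · intro h x hx
      rw [mem_ball_iff' _ _ hr] at hx
      rw [hK]
      intro θ
      have h1 := hx θ
      have h2 := h θ
      linarith
  have hγ0 := hγ 0
  rw [hK] at hγ0
  have hRe0 : 0 ≤ Re := by
    have h1 := hγ0 0
    have h2 := hγ0 Real.pi
    have h3 := hRe1 0
    have h4 := hRe1 Real.pi
    simp at h1 h2 h3 h4
    linarith
  have hρe' : ρe = Re := by
    rw [hρe]
    apply IsLeast.csInf_eq
    constructor
    · refine ⟨hRe0, !₂[a1, a2], ?_⟩
      rw [hout _ _ hRe0]
      simpa using hRe1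
    · rintro r ⟨hr, c, hc⟩
      exact hRe2 _ _ _ ((hout r c hr).1 hc)
  have hRi0 : 0 ≤ -Ri := by
    have := hRi2 (-(p 0 * Real.cos 0 - p1 0 * Real.sin 0)) (-(p 0 * Real.sin 0 + p1 0 * Real.cos 0)) 0
      (by intro θ
          have := hγ0 θ
          simp at this ⊢
          linarith)
    linarith
  have hρi' : ρi = -Ri := by
    rw [hρi]
    apply IsGreatest.csSup_eq
    constructor
    · refine ⟨hRi0, !₂[-b1, -b2], ?_⟩
      rw [hin _ _ hRi0]
      simpa using hRi1
    · rintro r ⟨hr, c, hc⟩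
      have := hRi2 _ _ _ ((hin r c hr).1 hc)
      linarith
  have hdneg : deriv (fun θ => -p θ) = fun θ => -p1 θ := funext fun x => (d0 x).neg.deriv
  simp only [hdneg, neg_sq, intervalIntegral.integral_neg] at hRi3
  rw [hA', ← hLp] at hRi3 hRe3 hRe4
  have hP0m : 2 * Real.pi * P0 = 2 * Real.pi * I0 - L ^ 2 := by rw [hP0]; field_simp
  have ge : (2 * Real.pi * ρe - L) ^ 2 ≤ 2 * Real.pi * (P1 - P0) := by
    rw [hρe']
    have := mul_nonpos_of_nonneg_of_nonpos (show 0 ≤ 2 * Real.pi by positivity) hRe3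
    linarith
  have gi : (2 * Real.pi * ρi - L) ^ 2 ≤ 2 * Real.pi * (P1 - P0) := by
    rw [hρi']
    have := mul_nonpos_of_nonneg_of_nonpos (show 0 ≤ 2 * Real.pi by positivity) hRi3
    linarith
  have hX : 0 ≤ P1 - P0 := by
    have : 0 ≤ 2 * Real.pi * (P1 - P0) := le_trans (sq_nonneg _) ge
    exact nonneg_of_mul_nonneg_right this (by positivity)
  have hρc : Continuous ρ := by rw [hρdef]; fun_prop
  have hcomp : IsCompact (ρ '' Set.Icc (0:ℝ) (2 * Real.pi)) := isCompact_Icc.image hρc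
  have hup : ∀ θ ∈ Set.Icc (0:ℝ) (2 * Real.pi), ρ θ ≤ ρM := fun θ hθ => by
    rw [hρM]; exact le_csSup hcomp.bddAbove ⟨θ, hθ, rfl⟩
  have hlo : ∀ θ ∈ Set.Icc (0:ℝ) (2 * Real.pi), ρm ≤ ρ θ := fun θ hθ => by
    rw [hρm]; exact csInf_le hcomp.bddBelow ⟨θ, hθ, rfl⟩
  have hosc : (P2 - P1) - (P1 - P0) ≤ Real.pi / 2 * (ρM - ρm) ^ 2 := by
    have h1 : ∫ θ in (0:ℝ)..(2 * Real.pi), (ρ θ - (ρM + ρm) / 2) ^ 2 ≤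
        ∫ θ in (0:ℝ)..(2 * Real.pi), ((ρM - ρm) / 2) ^ 2 := by
      apply intervalIntegral.integral_mono_on (by linarith) (ii (by fun_prop)) (ii (by fun_prop))
      intro θ hθ
      have h1 := hup θ hθ
      have h2 := hlo θ hθ
      apply sq_le_sq'
      · linarith
      · linarith
    rw [hsq ρ _ hρc, hρ2, ← hL, intervalIntegral.integral_const, smul_eq_mul, sub_zero] at h1
    have h2 := sq_nonneg (2 * Real.pi * ((ρM + ρm) / 2) - L)
    have h3 : 0 ≤ 2 * Real.pi * (Real.pi / 2 * (ρM - ρm) ^ 2 - ((P2 - P1) - (P1 - P0))) := by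
      have h4 := mul_le_mul_of_nonneg_left h1 (show 0 ≤ 2 * Real.pi by positivity)
      linarith
    have := nonneg_of_mul_nonneg_right h3 (by positivity)
    linarith
  have habs : |Atilde| = (P2 - P1) / 2 := by
    rw [hAt, hAt', abs_of_nonpos (by linarith)]; ring
  have hWe : W = α * ((P2 - P1) - (P1 - P0)) - μ * (P1 - P0) / 2 + σ * ((P2 - P1) / 2)
      + η * ((P3 - P2) - (P2 - P1)) + lam * (ρe - ρi) ^ 2 + ξ * (ρM - ρm) ^ 2 := by
    have hI : I0 = P0 + L ^ 2 / (2 * Real.pi) := by rw [hP0]; ring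
    rw [hW, hρ2, hρβ2, habs, hA, hA', hI]
    have hδ : δ * L ^ 2 = -(2 * α + μ) / 2 * (L ^ 2 / (2 * Real.pi)) := by
      have : δ = -(2 * α + μ) / (4 * Real.pi) := by field_simp; linarith
      rw [this]; field_simp; ring
    rw [hδ]; ring
  constructor
  · intro hW0
    rw [hWe] at hW0
    have := alg hpi ge gi (by linarith) (by linarith) hosc hη hξ hlam hnz hc2 hc3 hW0
    refine ⟨Re, a1, a2, hRe4 ?_⟩
    rw [hρe'] at this
    have h2 : 2 * Real.pi * (I0 - P1 - 2 * Re * L + 2 * Real.pi * Re ^ 2) = 0 := by linarith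
    rcases mul_eq_zero.1 h2 with h | h
    · linarith
    · exact h
  · rintro ⟨a₀, s₁, s₂, hpe⟩
    have q1 : p1 = fun θ => -(s₁ * Real.sin θ) + s₂ * Real.cos θ := by
      rw [hp1]; ext x
      have hpf : p = fun θ => a₀ + s₁ * Real.cos θ + s₂ * Real.sin θ := funext hpe
      rw [hpf]
      refine HasDerivAt.deriv ?_
      refine ((((Real.hasDerivAt_cos x).const_mul s₁).const_add a₀).add
        ((Real.hasDerivAt_sin x).const_mul s₂)).congr_deriv ?_
      ring
    have q2 : p2 = fun θ => a₀ - p θ := by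
      rw [hp2]; ext x
      rw [q1]
      refine HasDerivAt.deriv ?_
      refine (((Real.hasDerivAt_sin x).const_mul s₁).neg.add
        ((Real.hasDerivAt_cos x).const_mul s₂)).congr_deriv ?_
      rw [hpe]; ring
    have q3 : p3 = fun θ => -p1 θ := by
      rw [hp3]; ext x
      rw [q2]
      exact ((d0 x).const_sub a₀).deriv
    have hρa : ρ = fun _ => a₀ := by
      rw [hρdef, q2]; ext x; ring
    have hLa : L = 2 * Real.pi * a₀ := by
      rw [hL, hρa]; simp
    have r0 : P2 = P0 := by
      rw [← hP0', hP2, q2, hLa]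
      congr 1; ext x; field_simp; ring
    have r1 : P3 = P1 := by
      rw [hP3, hP1, q3]; simp
    have r2 : P1 - P0 = 0 := by linarith
    have hie : Set.Icc (0:ℝ) (2 * Real.pi) ≠ ∅ := by
      rw [← Set.nonempty_iff_ne_empty]; exact ⟨0, le_refl _, by linarith⟩
    have hMm : ρM - ρm = 0 := by
      rw [hρM, hρm, hρa, Set.Nonempty.image_const (Set.nonempty_iff_ne_empty.2 hie)]; simp
    have hei : ρe - ρi = 0 := by
      rw [r2, mul_zero] at ge gi
      have x1 : 2 * Real.pi * ρe - L = 0 := by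
        rw [← sq_nonpos_iff]; exact ge
      have x2 : 2 * Real.pi * ρi - L = 0 := by
        rw [← sq_nonpos_iff]; exact gi
      have : 2 * Real.pi * (ρe - ρi) = 0 := by linarith
      rcases mul_eq_zero.1 this with h | h
      · linarith
      · exact h
    have r3 : P2 - P1 = 0 := by linarith
    have r4 : P3 - P2 = 0 := by linarith
    rw [hWe, hMm, hei, r2, r3, r4]; ring
end
end
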